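/- The infimum inf{E(a,φ) : (a,φ) a degree-d field pair} is finite, and it is attained: there exists a degree-d field pair (a,φ) which is a GL solution and satisfies E(a,φ) = inf{E(a',φ') : (a',φ') a degree-d field pair}. -/

import Mathlib

open MeasureTheory Complex

noncomputable section

/-- Partial derivative in the first coordinate direction. -/
def pd1 {E : Type*} [NormedAddCommGroup E] [NormedSpace ℝ E]
    (f : ℝ × ℝ → E) (x : ℝ × ℝ) : E := fderiv ℝ f x (1, 0)

/-- Partial derivative in the second coordinate direction. -/
def pd2 {E : Type*} [NormedAddCommGroup E] [NormedSpace ℝ E]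
    (f : ℝ × ℝ → E) (x : ℝ × ℝ) : E := fderiv ℝ f x (0, 1)

/-- Covariant derivative `D₁φ = ∂₁φ + i a₁ φ`. -/
def D1 (a1 : ℝ × ℝ → ℝ) (φ : ℝ × ℝ → ℂ) : ℝ × ℝ → ℂ :=
  fun x => pd1 φ x + Complex.I * (a1 x : ℂ) * φ x

/-- Covariant derivative `D₂φ = ∂₂φ + i a₂ φ`. -/
def D2 (a2 : ℝ × ℝ → ℝ) (φ : ℝ × ℝ → ℂ) : ℝ × ℝ → ℂ :=
  fun x => pd2 φ x + Complex.I * (a2 x : ℂ) * φ x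

/-- Curvature `F(a) = ∂₁a₂ − ∂₂a₁`. -/
def curv (a1 a2 : ℝ × ℝ → ℝ) : ℝ × ℝ → ℝ :=
  fun x => pd1 a2 x - pd2 a1 x

/-- The fundamental domain `[0,1]²`. -/
def unitSquare : Set (ℝ × ℝ) := Set.Icc (0, 0) (1, 1)

/-- A degree-`d` field pair on the torus: smooth quasi-periodic `(a, φ)`. -/
structure FieldPair (d : ℤ) where
  a1 : ℝ × ℝ → ℝ
  a2 : ℝ × ℝ → ℝ
  φ : ℝ × ℝ → ℂ
  smooth_a1 : ContDiff ℝ (⊤ : ℕ∞) a1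
  smooth_a2 : ContDiff ℝ (⊤ : ℕ∞) a2
  smooth_φ : ContDiff ℝ (⊤ : ℕ∞) φ
  per1_a1 : ∀ x : ℝ × ℝ, a1 (x.1 + 1, x.2) = a1 x
  per1_a2 : ∀ x : ℝ × ℝ, a2 (x.1 + 1, x.2) = a2 x
  per1_φ : ∀ x : ℝ × ℝ, φ (x.1 + 1, x.2) = φ x
  per2_a2 : ∀ x : ℝ × ℝ, a2 (x.1, x.2 + 1) = a2 x
  per2_a1 : ∀ x : ℝ × ℝ, a1 (x.1, x.2 + 1) = a1 x - 2 * Real.pi * d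
  per2_φ : ∀ x : ℝ × ℝ, φ (x.1, x.2 + 1) =
      Complex.exp (2 * Real.pi * Complex.I * (d : ℂ) * (x.1 : ℂ)) * φ x

/-- The smooth ℤ²-periodic external field with `∫_{[0,1]²} F₀ = 2πd`. -/
def ExternalField (d : ℤ) (F₀ : ℝ × ℝ → ℝ) : Prop :=
  ContDiff ℝ (⊤ : ℕ∞) F₀ ∧ (∀ x : ℝ × ℝ, F₀ (x.1 + 1, x.2) = F₀ x) ∧
    (∀ x : ℝ × ℝ, F₀ (x.1, x.2 + 1) = F₀ x) ∧
    (∫ x in unitSquare, F₀ x) = 2 * Real.pi * d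

/-- The Ginzburg–Landau free energy. -/
def energy (α β : ℝ) (F₀ : ℝ × ℝ → ℝ) {d : ℤ} (P : FieldPair d) : ℝ :=
  (1 / 2) * ∫ x in unitSquare,
    ((curv P.a1 P.a2 x - F₀ x) ^ 2 + ‖D1 P.a1 P.φ x‖ ^ 2 + ‖D2 P.a2 P.φ x‖ ^ 2
      - α * ‖P.φ x‖ ^ 2 + (β / 2) * ‖P.φ x‖ ^ 4)

/-- The Ginzburg–Landau equations. -/
def IsGLSolution (α β : ℝ) (F₀ : ℝ × ℝ → ℝ) {d : ℤ} (P : FieldPair d) : Prop :=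
  (∀ x : ℝ × ℝ,
      pd2 (fun y => curv P.a1 P.a2 y - F₀ y) x
        + ((starRingEnd ℂ) (P.φ x) * D1 P.a1 P.φ x).im = 0) ∧
  (∀ x : ℝ × ℝ,
      -pd1 (fun y => curv P.a1 P.a2 y - F₀ y) x
        + ((starRingEnd ℂ) (P.φ x) * D2 P.a2 P.φ x).im = 0) ∧
  (∀ x : ℝ × ℝ,
      -(D1 P.a1 (D1 P.a1 P.φ) x + D2 P.a2 (D2 P.a2 P.φ) x)
        = (α : ℂ) * P.φ x - (β : ℂ) * (‖P.φ x‖ : ℂ) ^ 2 * P.φ x)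

/-- The set of energies of all degree-`d` field pairs. -/
def energySet (α β : ℝ) (F₀ : ℝ × ℝ → ℝ) (d : ℤ) : Set ℝ :=
  { t : ℝ | ∃ P : FieldPair d, t = energy α β F₀ P }

/-- `λ₁`, the lowest eigenvalue of the covariant Laplacian among connections
with curvature `F₀`. -/
def lambda1 (d : ℤ) (F₀ : ℝ × ℝ → ℝ) : ℝ :=
  sInf { t : ℝ | ∃ P : FieldPair d,
    (∀ x : ℝ × ℝ, curv P.a1 P.a2 x = F₀ x) ∧
    (∫ x in unitSquare, ‖P.φ x‖ ^ 2) = 1 ∧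
    t = ∫ x in unitSquare, (‖D1 P.a1 P.φ x‖ ^ 2 + ‖D2 P.a2 P.φ x‖ ^ 2) }

open scoped ENNReal

/-- The weight `(1 + |k₁| + |k₂|)^{1/2}` on the frequency lattice. -/
def wt (k : ℤ × ℤ) : ℝ≥0∞ := ENNReal.ofReal (√(1 + |(k.1 : ℝ)| + |(k.2 : ℝ)|))

/-- Convolution of `[0,∞]`-valued sequences on the frequency lattice. -/
def conv (f g : ℤ × ℤ → ℝ≥0∞) (k : ℤ × ℤ) : ℝ≥0∞ := ∑' l, f l * g (k - l)

theorem one_le_wt (k : ℤ × ℤ) : 1 ≤ wt k := by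
  unfold wt
  rw [ENNReal.one_le_ofReal, Real.one_le_sqrt]
  have := abs_nonneg (k.1 : ℝ)
  have := abs_nonneg (k.2 : ℝ)
  linarith

theorem wt_ne_top (k : ℤ × ℤ) : wt k ≠ ⊤ := ENNReal.ofReal_ne_top

theorem wt_ne_zero (k : ℤ × ℤ) : wt k ≠ 0 := (zero_lt_one.trans_le (one_le_wt k)).ne'

theorem wt_neg (k : ℤ × ℤ) : wt (-k) = wt k := by simp [wt]

theorem wt_zero : wt 0 = 1 := by simp [wt]

theorem wt_sq (k : ℤ × ℤ) : wt k ^ 2 = ENNReal.ofReal (1 + |(k.1 : ℝ)| + |(k.2 : ℝ)|) := by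
  unfold wt
  rw [← ENNReal.ofReal_pow (Real.sqrt_nonneg _), Real.sq_sqrt (by positivity)]

theorem wt_add_le_mul (l m : ℤ × ℤ) : wt (l + m) ≤ wt l * wt m := by
  unfold wt
  rw [← ENNReal.ofReal_mul (Real.sqrt_nonneg _), ← Real.sqrt_mul (by positivity)]
  apply ENNReal.ofReal_le_ofReal
  apply Real.sqrt_le_sqrt
  have h1 := abs_add_le (l.1 : ℝ) m.1
  have h2 := abs_add_le (l.2 : ℝ) m.2
  simp only [Prod.fst_add, Prod.snd_add, Int.cast_add]
  nlinarith [abs_nonneg (l.1 : ℝ), abs_nonneg (l.2 : ℝ), abs_nonneg (m.1 : ℝ),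
    abs_nonneg (m.2 : ℝ), mul_nonneg (abs_nonneg (l.1 : ℝ)) (abs_nonneg (m.1 : ℝ)),
    mul_nonneg (abs_nonneg (l.1 : ℝ)) (abs_nonneg (m.2 : ℝ)),
    mul_nonneg (abs_nonneg (l.2 : ℝ)) (abs_nonneg (m.1 : ℝ)),
    mul_nonneg (abs_nonneg (l.2 : ℝ)) (abs_nonneg (m.2 : ℝ))]

theorem wt_sq_add_le (l m : ℤ × ℤ) : wt (l + m) ^ 2 ≤ wt l ^ 2 + wt m ^ 2 := by
  rw [wt_sq, wt_sq, wt_sq, ← ENNReal.ofReal_add (by positivity) (by positivity)]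
  apply ENNReal.ofReal_le_ofReal
  have h1 := abs_add_le (l.1 : ℝ) m.1
  have h2 := abs_add_le (l.2 : ℝ) m.2
  simp only [Prod.fst_add, Prod.snd_add, Int.cast_add]
  linarith

theorem inv_wt_add_le (l m : ℤ × ℤ) : (wt (l + m))⁻¹ ≤ (wt l)⁻¹ * wt m := by
  have h := wt_add_le_mul (l + m) (-m)
  rw [wt_neg, add_neg_cancel_right] at h
  rw [mul_comm, ← div_eq_mul_inv, ENNReal.le_div_iff_mul_le (.inl (wt_ne_zero _))
    (.inl (wt_ne_top _)), mul_comm, ← div_eq_mul_inv]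
  exact ENNReal.div_le_of_le_mul' h

theorem tsum_inv_wt_pow_ne_top : ∑' k, (wt k)⁻¹ ^ 5 ≠ ⊤ := by
  have h1 : Summable fun n : ℤ => (1 + |(n : ℝ)|) ^ (-(5 / 4) : ℝ) := by
    have h : Summable fun n : ℕ => (1 + (n : ℝ)) ^ (-(5 / 4) : ℝ) := by
      have := (summable_nat_add_iff 1).2 (Real.summable_nat_rpow (p := -(5 / 4)) |>.2 (by norm_num))
      refine this.congr fun n => ?_
      push_cast
      rw [add_comm]
    refine Summable.of_nat_of_neg ?_ ?_ <;> simpa using h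
  have h2 := h1.mul_of_nonneg h1 (fun n => by positivity) (fun n => by positivity)
  have h3 : ∀ k : ℤ × ℤ, (wt k)⁻¹ ^ 5 ≤ ENNReal.ofReal
      ((1 + |(k.1 : ℝ)|) ^ (-(5 / 4) : ℝ) * (1 + |(k.2 : ℝ)|) ^ (-(5 / 4) : ℝ)) := by
    intro k
    have a1 := abs_nonneg (k.1 : ℝ)
    have a2 := abs_nonneg (k.2 : ℝ)
    unfold wt
    rw [← ENNReal.ofReal_inv_of_pos (by positivity), ← ENNReal.ofReal_pow (by positivity)]
    apply ENNReal.ofReal_le_ofReal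
    set s := 1 + |(k.1 : ℝ)| + |(k.2 : ℝ)|
    have hs : 0 < s := by positivity
    have e : (√s)⁻¹ ^ 5 = s ^ (-(5 / 4) : ℝ) * s ^ (-(5 / 4) : ℝ) := by
      rw [Real.sqrt_eq_rpow, ← Real.rpow_neg hs.le, ← Real.rpow_natCast, ← Real.rpow_mul hs.le,
        ← Real.rpow_add hs]
      norm_num
    rw [e]
    gcongr ?_ * ?_
    · exact Real.rpow_le_rpow_of_nonpos (by positivity) (by simp only [s]; linarith) (by norm_num)
    · exact Real.rpow_le_rpow_of_nonpos (by positivity) (by simp only [s]; linarith) (by norm_num)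
  refine ne_top_of_le_ne_top ?_ (ENNReal.tsum_le_tsum h3)
  exact h2.tsum_ofReal_ne_top

theorem tsum_sub_right (f : ℤ × ℤ → ℝ≥0∞) (l : ℤ × ℤ) : ∑' k, f (k - l) = ∑' k, f k :=
  (Equiv.subRight l).tsum_eq f

theorem tsum_sub_left (f : ℤ × ℤ → ℝ≥0∞) (l : ℤ × ℤ) : ∑' k, f (l - k) = ∑' k, f k :=
  (Equiv.subLeft l).tsum_eq f

theorem conv_comm (f g : ℤ × ℤ → ℝ≥0∞) : conv f g = conv g f := by
  funext k
  unfold conv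
  rw [← tsum_sub_left _ k]
  simp [mul_comm]

theorem conv_mono {f f' g g' : ℤ × ℤ → ℝ≥0∞} (hf : f ≤ f') (hg : g ≤ g') :
    conv f g ≤ conv f' g' := fun _ =>
  ENNReal.tsum_le_tsum fun l => mul_le_mul' (hf l) (hg _)

theorem tsum_mul_conv_le {p p₁ p₂ f g : ℤ × ℤ → ℝ≥0∞} (hp : ∀ l m, p (l + m) ≤ p₁ l * p₂ m) :
    ∑' k, p k * conv f g k ≤ (∑' k, p₁ k * f k) * ∑' k, p₂ k * g k := by
  calc ∑' k, p k * conv f g k = ∑' l, ∑' k, p k * (f l * g (k - l)) := by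
        rw [ENNReal.tsum_comm]; simp only [conv, ENNReal.tsum_mul_left]
    _ ≤ ∑' l, ∑' k, (p₁ l * f l) * (p₂ (k - l) * g (k - l)) := by
        refine ENNReal.tsum_le_tsum fun l => ENNReal.tsum_le_tsum fun k => ?_
        calc p k * (f l * g (k - l)) ≤ (p₁ l * p₂ (k - l)) * (f l * g (k - l)) := by
              gcongr; simpa using hp l (k - l)
          _ = _ := by ring
    _ = _ := by
        simp only [ENNReal.tsum_mul_left, tsum_sub_right (fun k => p₂ k * g k),
          ENNReal.tsum_mul_right]

theorem ENNReal.mul_le_sq_add_sq (a b : ℝ≥0∞) : a * b ≤ a ^ 2 + b ^ 2 := by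
  rcases le_total a b with h | h
  · calc a * b ≤ b * b := by gcongr
      _ ≤ _ := by rw [sq b]; exact le_add_self
  · calc a * b ≤ a * a := by gcongr
      _ ≤ _ := by rw [sq a]; exact le_self_add

theorem ENNReal.add_sq_le (a b : ℝ≥0∞) : (a + b) ^ 2 ≤ 3 * (a ^ 2 + b ^ 2) := by
  calc (a + b) ^ 2 = a ^ 2 + b ^ 2 + 2 * (a * b) := by ring
    _ ≤ a ^ 2 + b ^ 2 + 2 * (a ^ 2 + b ^ 2) := by gcongr; exact ENNReal.mul_le_sq_add_sq a b
    _ = _ := by ring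

theorem ENNReal.tsum_mul_sq_le {ι : Type*} (f g : ι → ℝ≥0∞) :
    (∑' i, f i * g i) ^ 2 ≤ (∑' i, f i ^ 2) * ∑' i, g i ^ 2 := by
  let _ : MeasurableSpace ι := ⊤
  have h := ENNReal.lintegral_mul_le_Lp_mul_Lq (Measure.count : Measure ι)
    Real.HolderConjugate.two_two (f := f) (g := g) (measurable_from_top.aemeasurable)
    (measurable_from_top.aemeasurable)
  simp only [Pi.mul_apply, lintegral_count] at h
  have h2 := pow_le_pow_left' h 2
  refine h2.trans (le_of_eq ?_)
  rw [mul_pow, ← ENNReal.rpow_natCast, ← ENNReal.rpow_natCast, ← ENNReal.rpow_mul,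
    ← ENNReal.rpow_mul]
  norm_num

theorem inv_wt_mul_le (a b : ℕ) (h : a + b ≥ 5) (x y : ℤ × ℤ) :
    (wt x)⁻¹ ^ a * (wt y)⁻¹ ^ b ≤ (wt x)⁻¹ ^ 5 + (wt y)⁻¹ ^ 5 := by
  have hx : (wt x)⁻¹ ≤ 1 := ENNReal.inv_le_one.2 (one_le_wt x)
  have hy : (wt y)⁻¹ ≤ 1 := ENNReal.inv_le_one.2 (one_le_wt y)
  rcases le_total (wt x)⁻¹ (wt y)⁻¹ with h' | h'
  · calc _ ≤ (wt y)⁻¹ ^ a * (wt y)⁻¹ ^ b := by gcongr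
      _ = (wt y)⁻¹ ^ (a + b) := by rw [pow_add]
      _ ≤ (wt y)⁻¹ ^ 5 := pow_le_pow_right_of_le_one' hy h
      _ ≤ _ := le_add_self
  · calc _ ≤ (wt x)⁻¹ ^ a * (wt x)⁻¹ ^ b := by gcongr
      _ = (wt x)⁻¹ ^ (a + b) := by rw [pow_add]
      _ ≤ (wt x)⁻¹ ^ 5 := pow_le_pow_right_of_le_one' hx h
      _ ≤ _ := le_self_add

theorem eq_inv_wt_mul (k : ℤ × ℤ) (x : ℝ≥0∞) : x = (wt k)⁻¹ ^ 2 * (wt k ^ 2 * x) := by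
  rw [← mul_assoc, ← mul_pow, ENNReal.inv_mul_cancel (wt_ne_zero k) (wt_ne_top k), one_pow, one_mul]

/-- The embedding `H¹ ⊂ L⁴` on the torus, on the Fourier side. -/
theorem tsum_conv_sq_le (H : ℤ × ℤ → ℝ≥0∞) :
    ∑' k, conv H H k ^ 2 ≤ 2 * (∑' k, (wt k)⁻¹ ^ 5) * (∑' k, (wt k ^ 2 * H k) ^ 2) ^ 2 := by
  set f : ℤ × ℤ → ℝ≥0∞ := fun k => wt k ^ 2 * H k with hf
  have hk : ∀ k, conv H H k ^ 2 ≤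
      conv (fun l => f l ^ 2) (fun l => f l ^ 2) k * (2 * ∑' k, (wt k)⁻¹ ^ 5) := by
    intro k
    calc conv H H k ^ 2 = (∑' l, (f l * f (k - l)) * ((wt l)⁻¹ ^ 2 * (wt (k - l))⁻¹ ^ 2)) ^ 2 := by
          unfold conv
          congr 1
          refine tsum_congr fun l => ?_
          conv_lhs => rw [eq_inv_wt_mul l (H l), eq_inv_wt_mul (k - l) (H (k - l))]
          simp only [hf]; ring
      _ ≤ (∑' l, (f l * f (k - l)) ^ 2) * ∑' l, ((wt l)⁻¹ ^ 2 * (wt (k - l))⁻¹ ^ 2) ^ 2 :=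
          ENNReal.tsum_mul_sq_le _ _
      _ ≤ conv (fun l => f l ^ 2) (fun l => f l ^ 2) k * (2 * ∑' k, (wt k)⁻¹ ^ 5) := by
          gcongr
          · refine le_of_eq (tsum_congr fun l => ?_)
            ring
          · calc ∑' l, ((wt l)⁻¹ ^ 2 * (wt (k - l))⁻¹ ^ 2) ^ 2
                ≤ ∑' l, ((wt l)⁻¹ ^ 5 + (wt (k - l))⁻¹ ^ 5) := by
                  refine ENNReal.tsum_le_tsum fun l => ?_
                  rw [mul_pow, ← pow_mul, ← pow_mul]
                  exact inv_wt_mul_le 4 4 (by norm_num) _ _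
              _ = _ := by
                  rw [ENNReal.tsum_add, tsum_sub_left (fun l => (wt l)⁻¹ ^ 5)]
                  ring
  calc ∑' k, conv H H k ^ 2
      ≤ ∑' k, conv (fun l => f l ^ 2) (fun l => f l ^ 2) k * (2 * ∑' k, (wt k)⁻¹ ^ 5) :=
        ENNReal.tsum_le_tsum hk
    _ ≤ _ := by
        rw [ENNReal.tsum_mul_right, mul_comm]
        gcongr
        have := tsum_mul_conv_le (p := 1) (p₁ := 1) (p₂ := 1) (f := fun l => f l ^ 2)
          (g := fun l => f l ^ 2) (by simp)
        simp only [Pi.one_apply, one_mul] at this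
        exact this.trans_eq (sq _).symm

/-- A bilinear estimate: `w⁻³ (K * H)` is summable if `K` and `w² H` are square summable. -/
theorem tsum_inv_wt_conv_le (K H : ℤ × ℤ → ℝ≥0∞) :
    ∑' k, (wt k)⁻¹ ^ 3 * conv K H k ≤
      (∑' k, (wt k)⁻¹ ^ 5) * (∑' k, (wt k ^ 2 * H k) ^ 2 + 2 * ∑' k, K k ^ 2) := by
  set f : ℤ × ℤ → ℝ≥0∞ := fun k => wt k ^ 2 * H k with hf
  set S := ∑' k, (wt k)⁻¹ ^ 5
  have h1 : ∀ k l, (wt k)⁻¹ ^ 3 * (K l * H (k - l)) ≤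
      (wt k)⁻¹ ^ 5 * f (k - l) ^ 2 + ((wt k)⁻¹ ^ 5 + (wt (k - l))⁻¹ ^ 5) * K l ^ 2 := by
    intro k l
    calc (wt k)⁻¹ ^ 3 * (K l * H (k - l))
        = (wt k)⁻¹ * (((wt k)⁻¹ ^ 2 * f (k - l)) * ((wt (k - l))⁻¹ ^ 2 * K l)) := by
          conv_lhs => rw [eq_inv_wt_mul (k - l) (H (k - l))]
          simp only [hf]; ring
      _ ≤ (wt k)⁻¹ * (((wt k)⁻¹ ^ 2 * f (k - l)) ^ 2 + ((wt (k - l))⁻¹ ^ 2 * K l) ^ 2) := by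
          gcongr; exact ENNReal.mul_le_sq_add_sq _ _
      _ = (wt k)⁻¹ ^ 5 * f (k - l) ^ 2 + ((wt k)⁻¹ ^ 1 * (wt (k - l))⁻¹ ^ 4) * K l ^ 2 := by ring
      _ ≤ _ := by gcongr; exact inv_wt_mul_le 1 4 (by norm_num) _ _
  calc ∑' k, (wt k)⁻¹ ^ 3 * conv K H k
      = ∑' k, ∑' l, (wt k)⁻¹ ^ 3 * (K l * H (k - l)) := by
        simp only [conv, ENNReal.tsum_mul_left]
    _ ≤ ∑' k, ∑' l, ((wt k)⁻¹ ^ 5 * f (k - l) ^ 2 +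
          ((wt k)⁻¹ ^ 5 + (wt (k - l))⁻¹ ^ 5) * K l ^ 2) :=
        ENNReal.tsum_le_tsum fun k => ENNReal.tsum_le_tsum fun l => h1 k l
    _ = (∑' k, ∑' l, (wt k)⁻¹ ^ 5 * f (k - l) ^ 2) +
          ∑' l, ∑' k, ((wt k)⁻¹ ^ 5 + (wt (k - l))⁻¹ ^ 5) * K l ^ 2 := by
        rw [ENNReal.tsum_comm (f := fun l k => ((wt k)⁻¹ ^ 5 + (wt (k - l))⁻¹ ^ 5) * K l ^ 2)]
        simp only [ENNReal.tsum_add]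
    _ = S * (∑' k, f k ^ 2) + (S + S) * ∑' l, K l ^ 2 := by
        simp only [ENNReal.tsum_mul_left, ENNReal.tsum_mul_right, ENNReal.tsum_add,
          tsum_sub_left (fun l => f l ^ 2), tsum_sub_right (fun l => (wt l)⁻¹ ^ 5)]
        rfl
    _ = _ := by ring

/-- The quadratic part `w² H + H * H` of the nonlinearity. -/
def quadMaj (H : ℤ × ℤ → ℝ≥0∞) (k : ℤ × ℤ) : ℝ≥0∞ := wt k ^ 2 * H k + conv H H k

theorem tsum_wt_mul_ne_top_step {a : ℤ × ℤ → ℝ≥0∞} (ha : ∀ s : ℕ, ∑' k, wt k ^ s * a k ≠ ⊤)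
    {C : ℝ≥0∞} (hC : C ≠ ⊤) (r : ℕ) {B : ℝ≥0∞} (hB : B ≠ ⊤) :
    ∃ B' : ℝ≥0∞, B' ≠ ⊤ ∧ ∀ H : ℤ × ℤ → ℝ≥0∞,
      (∀ k, wt k ^ 4 * H k ≤ C * conv (quadMaj H) H k + C * (wt k ^ 4 * a k)) →
      ∑' k, wt k ^ (r + 1) * H k ≤ B → ∑' k, wt k ^ (r + 3) * H k ≤ B' := by
  refine ⟨C * ((B + B * B) * B) + C * ∑' k, wt k ^ (r + 3) * a k, ?_, fun H hH hB' => ?_⟩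
  · have := ha (r + 3)
    finiteness
  have key : ∀ k, wt k ^ (r + 3) * H k ≤
      C * ((wt k ^ r * (wt k)⁻¹) * conv (quadMaj H) H k) + C * (wt k ^ (r + 3) * a k) := by
    intro k
    have e : ∀ x, wt k ^ (r + 3) * x = wt k ^ r * (wt k)⁻¹ * (wt k ^ 4 * x) := fun x => by
      have : (wt k)⁻¹ * wt k = 1 := ENNReal.inv_mul_cancel (wt_ne_zero k) (wt_ne_top k)
      calc _ = wt k ^ (r + 3) * x * 1 := by ring
        _ = wt k ^ (r + 3) * x * ((wt k)⁻¹ * wt k) := by rw [this]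
        _ = _ := by ring
    rw [e (H k), e (a k)]
    calc _ ≤ wt k ^ r * (wt k)⁻¹ * (C * conv (quadMaj H) H k + C * (wt k ^ 4 * a k)) := by
          gcongr; exact hH k
      _ = _ := by ring
  have hr : ∑' k, wt k ^ r * H k ≤ B := by
    refine le_trans (ENNReal.tsum_le_tsum fun k => ?_) hB'
    gcongr
    · exact one_le_wt k
    · omega
  have hq : ∑' k, (wt k ^ r * (wt k)⁻¹) * quadMaj H k ≤ B + B * B := by
    calc _ ≤ ∑' k, (wt k ^ (r + 1) * H k + wt k ^ r * conv H H k) := by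
          refine ENNReal.tsum_le_tsum fun k => ?_
          unfold quadMaj
          rw [mul_add]
          refine add_le_add (le_of_eq ?_) ?_
          · calc _ = wt k ^ r * ((wt k)⁻¹ * wt k) * wt k * H k := by ring
              _ = _ := by
                rw [ENNReal.inv_mul_cancel (wt_ne_zero k) (wt_ne_top k)]; ring
          · gcongr
            exact mul_le_of_le_one_right' (ENNReal.inv_le_one.2 (one_le_wt k))
      _ ≤ B + B * B := by
          rw [ENNReal.tsum_add]
          gcongr
          refine (tsum_mul_conv_le (p₁ := fun k => wt k ^ r) (p₂ := fun k => wt k ^ r)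
            fun l m => ?_).trans (mul_le_mul' hr hr)
          rw [← mul_pow]
          gcongr
          exact wt_add_le_mul l m
  calc _ ≤ ∑' k, (C * ((wt k ^ r * (wt k)⁻¹) * conv (quadMaj H) H k) +
        C * (wt k ^ (r + 3) * a k)) := ENNReal.tsum_le_tsum key
    _ = C * (∑' k, (wt k ^ r * (wt k)⁻¹) * conv (quadMaj H) H k) +
        C * ∑' k, (wt k ^ (r + 3) * a k) := by
        rw [ENNReal.tsum_add, ENNReal.tsum_mul_left, ENNReal.tsum_mul_left]
    _ ≤ _ := by
        gcongr
        refine (tsum_mul_conv_le (p := fun k => wt k ^ r * (wt k)⁻¹)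
          (p₁ := fun k => wt k ^ r * (wt k)⁻¹) (p₂ := fun k => wt k ^ (r + 1))
            fun l m => ?_).trans (mul_le_mul' hq hB')
        calc wt (l + m) ^ r * (wt (l + m))⁻¹ ≤ (wt l * wt m) ^ r * ((wt l)⁻¹ * wt m) := by
              gcongr
              · exact wt_add_le_mul l m
              · exact inv_wt_add_le l m
          _ = _ := by ring

/-- Elliptic regularity on the Fourier side: an `H¹` bound and the majorised Euler–Lagrange
equation imply bounds in every weighted `ℓ¹` space. -/
theorem exists_bound_tsum_wt_mul {a : ℤ × ℤ → ℝ≥0∞} (ha : ∀ s : ℕ, ∑' k, wt k ^ s * a k ≠ ⊤)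
    {C M : ℝ≥0∞} (hC : C ≠ ⊤) (hM : M ≠ ⊤) (s : ℕ) :
    ∃ B : ℝ≥0∞, B ≠ ⊤ ∧ ∀ H : ℤ × ℤ → ℝ≥0∞,
      (∀ k, wt k ^ 4 * H k ≤ C * conv (quadMaj H) H k + C * (wt k ^ 4 * a k)) →
      ∑' k, (wt k ^ 2 * H k) ^ 2 ≤ M → ∑' k, wt k ^ s * H k ≤ B := by
  have main : ∀ n : ℕ, ∃ B : ℝ≥0∞, B ≠ ⊤ ∧ ∀ H : ℤ × ℤ → ℝ≥0∞,
      (∀ k, wt k ^ 4 * H k ≤ C * conv (quadMaj H) H k + C * (wt k ^ 4 * a k)) →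
      ∑' k, (wt k ^ 2 * H k) ^ 2 ≤ M → ∑' k, wt k ^ (2 * n + 1) * H k ≤ B := by
    intro n
    induction n with
    | zero =>
      set S := ∑' k, (wt k)⁻¹ ^ 5 with hSdef
      have hS : S ≠ ⊤ := tsum_inv_wt_pow_ne_top
      refine ⟨C * (S * (M + 2 * (3 * (M + 2 * S * M ^ 2)))) + C * ∑' k, wt k ^ 1 * a k, ?_,
        fun H hH hHM => ?_⟩
      · have := ha 1
        finiteness
      have key : ∀ k, wt k ^ 1 * H k ≤
          C * ((wt k)⁻¹ ^ 3 * conv (quadMaj H) H k) + C * (wt k ^ 1 * a k) := by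
        intro k
        have e : ∀ x, wt k ^ 1 * x = (wt k)⁻¹ ^ 3 * (wt k ^ 4 * x) := fun x => by
          have : (wt k)⁻¹ * wt k = 1 := ENNReal.inv_mul_cancel (wt_ne_zero k) (wt_ne_top k)
          calc _ = wt k * x * 1 ^ 3 := by ring
            _ = wt k * x * ((wt k)⁻¹ * wt k) ^ 3 := by rw [this]
            _ = _ := by ring
        rw [e (H k), e (a k)]
        calc _ ≤ (wt k)⁻¹ ^ 3 * (C * conv (quadMaj H) H k + C * (wt k ^ 4 * a k)) := by
              gcongr; exact hH k
          _ = _ := by ring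
      have hK : ∑' k, quadMaj H k ^ 2 ≤ 3 * (M + 2 * S * M ^ 2) := by
        calc _ ≤ ∑' k, 3 * ((wt k ^ 2 * H k) ^ 2 + conv H H k ^ 2) :=
              ENNReal.tsum_le_tsum fun k => ENNReal.add_sq_le _ _
          _ = 3 * (∑' k, (wt k ^ 2 * H k) ^ 2 + ∑' k, conv H H k ^ 2) := by
              rw [ENNReal.tsum_mul_left, ENNReal.tsum_add]
          _ ≤ _ := by
              gcongr
              exact (tsum_conv_sq_le H).trans (by gcongr)
      calc _ ≤ ∑' k, (C * ((wt k)⁻¹ ^ 3 * conv (quadMaj H) H k) + C * (wt k ^ 1 * a k)) := by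
            refine ENNReal.tsum_le_tsum fun k => ?_
            simpa using key k
        _ = C * (∑' k, (wt k)⁻¹ ^ 3 * conv (quadMaj H) H k) + C * ∑' k, wt k ^ 1 * a k := by
            rw [ENNReal.tsum_add, ENNReal.tsum_mul_left, ENNReal.tsum_mul_left]
        _ ≤ _ := by
            gcongr
            exact (tsum_inv_wt_conv_le _ _).trans (by gcongr)
    | succ n ih =>
      obtain ⟨B, hB, h⟩ := ih
      obtain ⟨B', hB', h'⟩ := tsum_wt_mul_ne_top_step ha hC (2 * n) hB
      exact ⟨B', hB', fun H h1 h2 => h' H h1 (h H h1 h2)⟩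
  obtain ⟨B, hB, h⟩ := main s
  refine ⟨B, hB, fun H h1 h2 => le_trans (ENNReal.tsum_le_tsum fun k => ?_) (h H h1 h2)⟩
  gcongr
  · exact one_le_wt k
  · omega

section PartialDerivatives

variable {E : Type*} [NormedAddCommGroup E] [NormedSpace ℝ E]

theorem ContDiff.differentiable_top {f : ℝ × ℝ → E} (hf : ContDiff ℝ (⊤ : ℕ∞) f) :
    Differentiable ℝ f := hf.differentiable (by simp)

theorem ContDiff.pd1 {f : ℝ × ℝ → E} (hf : ContDiff ℝ (⊤ : ℕ∞) f) :
    ContDiff ℝ (⊤ : ℕ∞) (pd1 f) :=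
  (hf.fderiv_right (m := (⊤ : ℕ∞)) (by simp)).clm_apply contDiff_const

theorem ContDiff.pd2 {f : ℝ × ℝ → E} (hf : ContDiff ℝ (⊤ : ℕ∞) f) :
    ContDiff ℝ (⊤ : ℕ∞) (pd2 f) :=
  (hf.fderiv_right (m := (⊤ : ℕ∞)) (by simp)).clm_apply contDiff_const

theorem fst_add_one_eq (x : ℝ × ℝ) : (x.1 + 1, x.2) = x + (1, 0) := by ext <;> simp

theorem snd_add_one_eq (x : ℝ × ℝ) : (x.1, x.2 + 1) = x + (0, 1) := by ext <;> simp

theorem fderiv_add_of_periodic {f : ℝ × ℝ → E} {c : ℝ × ℝ} (h : ∀ x, f (x + c) = f x)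
    (x : ℝ × ℝ) : fderiv ℝ f (x + c) = fderiv ℝ f x := by
  rw [← fderiv_comp_add_right]
  congr 1
  funext y
  exact h y

theorem pd1_add {f g : ℝ × ℝ → E} (hf : Differentiable ℝ f) (hg : Differentiable ℝ g)
    (x : ℝ × ℝ) : pd1 (fun y => f y + g y) x = pd1 f x + pd1 g x := by
  simp [pd1, fderiv_fun_add (hf x) (hg x)]

theorem pd2_add {f g : ℝ × ℝ → E} (hf : Differentiable ℝ f) (hg : Differentiable ℝ g)
    (x : ℝ × ℝ) : pd2 (fun y => f y + g y) x = pd2 f x + pd2 g x := by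
  simp [pd2, fderiv_fun_add (hf x) (hg x)]

theorem pd1_sub {f g : ℝ × ℝ → E} (hf : Differentiable ℝ f) (hg : Differentiable ℝ g)
    (x : ℝ × ℝ) : pd1 (fun y => f y - g y) x = pd1 f x - pd1 g x := by
  simp [pd1, fderiv_fun_sub (hf x) (hg x)]

theorem pd2_sub {f g : ℝ × ℝ → E} (hf : Differentiable ℝ f) (hg : Differentiable ℝ g)
    (x : ℝ × ℝ) : pd2 (fun y => f y - g y) x = pd2 f x - pd2 g x := by
  simp [pd2, fderiv_fun_sub (hf x) (hg x)]

theorem pd1_mul {A : Type*} [NormedCommRing A] [NormedAlgebra ℝ A] {f g : ℝ × ℝ → A}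
    (hf : Differentiable ℝ f) (hg : Differentiable ℝ g) (x : ℝ × ℝ) :
    pd1 (fun y => f y * g y) x = pd1 f x * g x + f x * pd1 g x := by
  simp only [pd1, fderiv_fun_mul (hf x) (hg x), add_apply,
    smul_apply, smul_eq_mul]
  ring

theorem pd2_mul {A : Type*} [NormedCommRing A] [NormedAlgebra ℝ A] {f g : ℝ × ℝ → A}
    (hf : Differentiable ℝ f) (hg : Differentiable ℝ g) (x : ℝ × ℝ) :
    pd2 (fun y => f y * g y) x = pd2 f x * g x + f x * pd2 g x := by
  simp only [pd2, fderiv_fun_mul (hf x) (hg x), add_apply,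
    smul_apply, smul_eq_mul]
  ring

theorem pd1_clm {F : Type*} [NormedAddCommGroup F] [NormedSpace ℝ F] (L : E →L[ℝ] F)
    {f : ℝ × ℝ → E} (hf : Differentiable ℝ f) (x : ℝ × ℝ) :
    pd1 (fun y => L (f y)) x = L (pd1 f x) := by
  have := (L.hasFDerivAt.comp x (hf x).hasFDerivAt).fderiv
  simp only [pd1]
  rw [show (fun y => L (f y)) = L ∘ f from rfl, this]
  rfl

theorem pd2_clm {F : Type*} [NormedAddCommGroup F] [NormedSpace ℝ F] (L : E →L[ℝ] F)
    {f : ℝ × ℝ → E} (hf : Differentiable ℝ f) (x : ℝ × ℝ) :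
    pd2 (fun y => L (f y)) x = L (pd2 f x) := by
  have := (L.hasFDerivAt.comp x (hf x).hasFDerivAt).fderiv
  simp only [pd2]
  rw [show (fun y => L (f y)) = L ∘ f from rfl, this]
  rfl

theorem pd1_conj {f : ℝ × ℝ → ℂ} (hf : Differentiable ℝ f) (x : ℝ × ℝ) :
    pd1 (fun y => (starRingEnd ℂ) (f y)) x = (starRingEnd ℂ) (pd1 f x) :=
  pd1_clm conjCLE.toContinuousLinearMap hf x

theorem pd2_conj {f : ℝ × ℝ → ℂ} (hf : Differentiable ℝ f) (x : ℝ × ℝ) :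
    pd2 (fun y => (starRingEnd ℂ) (f y)) x = (starRingEnd ℂ) (pd2 f x) :=
  pd2_clm conjCLE.toContinuousLinearMap hf x

theorem pd1_ofReal {f : ℝ × ℝ → ℝ} (hf : Differentiable ℝ f) (x : ℝ × ℝ) :
    pd1 (fun y => (f y : ℂ)) x = ((pd1 f x : ℝ) : ℂ) :=
  pd1_clm ofRealCLM hf x

theorem pd2_ofReal {f : ℝ × ℝ → ℝ} (hf : Differentiable ℝ f) (x : ℝ × ℝ) :
    pd2 (fun y => (f y : ℂ)) x = ((pd2 f x : ℝ) : ℂ) :=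
  pd2_clm ofRealCLM hf x

theorem pd1_const (c : E) (x : ℝ × ℝ) : pd1 (fun _ => c) x = 0 := by simp [pd1]

theorem pd2_const (c : E) (x : ℝ × ℝ) : pd2 (fun _ => c) x = 0 := by simp [pd2]

theorem pd1_pd2_comm {f : ℝ × ℝ → E} (hf : ContDiff ℝ (⊤ : ℕ∞) f) (x : ℝ × ℝ) :
    pd1 (pd2 f) x = pd2 (pd1 f) x := by
  have hs : IsSymmSndFDerivAt ℝ f x :=
    hf.contDiffAt.isSymmSndFDerivAt (by simpa using WithTop.coe_le_coe.2 (le_top : (2 : ℕ∞) ≤ ⊤))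
  have hd : Differentiable ℝ (fderiv ℝ f) :=
    (hf.fderiv_right (m := (⊤ : ℕ∞)) (by simp)).differentiable (by simp)
  have e : ∀ v w : ℝ × ℝ, fderiv ℝ (fun y => fderiv ℝ f y v) x w = fderiv ℝ (fderiv ℝ f) x w v := by
    intro v w
    rw [fderiv_clm_apply (hd x) (by fun_prop)]
    simp
  change fderiv ℝ (fun y => fderiv ℝ f y (0, 1)) x (1, 0) =
    fderiv ℝ (fun y => fderiv ℝ f y (1, 0)) x (0, 1)
  rw [e, e]
  exact hs _ _

end PartialDerivatives

/-- Smooth `ℤ²`-periodic functions. -/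
structure SmoothPer (f : ℝ × ℝ → ℂ) : Prop where
  smooth : ContDiff ℝ (⊤ : ℕ∞) f
  per1 : ∀ x : ℝ × ℝ, f (x.1 + 1, x.2) = f x
  per2 : ∀ x : ℝ × ℝ, f (x.1, x.2 + 1) = f x

namespace SmoothPer

variable {f g : ℝ × ℝ → ℂ}

theorem diff (hf : SmoothPer f) : Differentiable ℝ f := hf.smooth.differentiable_top

theorem cont (hf : SmoothPer f) : Continuous f := hf.smooth.continuous

theorem add (hf : SmoothPer f) (hg : SmoothPer g) : SmoothPer fun x => f x + g x :=
  ⟨hf.smooth.add hg.smooth, fun x => by rw [hf.per1, hg.per1], fun x => by rw [hf.per2, hg.per2]⟩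

theorem sub (hf : SmoothPer f) (hg : SmoothPer g) : SmoothPer fun x => f x - g x :=
  ⟨hf.smooth.sub hg.smooth, fun x => by rw [hf.per1, hg.per1], fun x => by rw [hf.per2, hg.per2]⟩

theorem mul (hf : SmoothPer f) (hg : SmoothPer g) : SmoothPer fun x => f x * g x :=
  ⟨hf.smooth.mul hg.smooth, fun x => by rw [hf.per1, hg.per1], fun x => by rw [hf.per2, hg.per2]⟩

theorem const (c : ℂ) : SmoothPer fun _ => c := ⟨contDiff_const, fun _ => rfl, fun _ => rfl⟩

theorem neg (hf : SmoothPer f) : SmoothPer fun x => -f x :=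
  ⟨hf.smooth.neg, fun x => by rw [hf.per1], fun x => by rw [hf.per2]⟩

theorem conj (hf : SmoothPer f) : SmoothPer fun x => (starRingEnd ℂ) (f x) :=
  ⟨conjCLE.contDiff.comp hf.smooth, fun x => by rw [hf.per1], fun x => by rw [hf.per2]⟩

theorem pd1 (hf : SmoothPer f) : SmoothPer (pd1 f) := by
  refine ⟨hf.smooth.pd1, fun x => ?_, fun x => ?_⟩
  · rw [fst_add_one_eq]
    unfold _root_.pd1
    rw [fderiv_add_of_periodic fun y => by rw [← fst_add_one_eq, hf.per1]]
  · rw [snd_add_one_eq]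
    unfold _root_.pd1
    rw [fderiv_add_of_periodic fun y => by rw [← snd_add_one_eq, hf.per2]]

theorem pd2 (hf : SmoothPer f) : SmoothPer (pd2 f) := by
  refine ⟨hf.smooth.pd2, fun x => ?_, fun x => ?_⟩
  · rw [fst_add_one_eq]
    unfold _root_.pd2
    rw [fderiv_add_of_periodic fun y => by rw [← fst_add_one_eq, hf.per1]]
  · rw [snd_add_one_eq]
    unfold _root_.pd2
    rw [fderiv_add_of_periodic fun y => by rw [← snd_add_one_eq, hf.per2]]

end SmoothPer

theorem integrableOn_unitSquare {E : Type*} [NormedAddCommGroup E] {f : ℝ × ℝ → E}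
    (hf : Continuous f) : IntegrableOn f unitSquare := by
  apply hf.continuousOn.integrableOn_compact
  rw [unitSquare, ← Set.Icc_prod_Icc]
  exact isCompact_Icc.prod isCompact_Icc

theorem setIntegral_unitSquare {E : Type*} [NormedAddCommGroup E] [NormedSpace ℝ E]
    {f : ℝ × ℝ → E} (hf : Continuous f) :
    ∫ x in unitSquare, f x = ∫ s in (0 : ℝ)..1, ∫ t in (0 : ℝ)..1, f (s, t) := by
  have h := integrableOn_unitSquare hf
  rw [unitSquare, ← Set.Icc_prod_Icc] at h ⊢
  rw [Measure.volume_eq_prod] at h ⊢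
  rw [setIntegral_prod _ h]
  simp only [intervalIntegral.integral_of_le zero_le_one, integral_Icc_eq_integral_Ioc]

theorem setIntegral_unitSquare' {E : Type*} [NormedAddCommGroup E] [NormedSpace ℝ E]
    {f : ℝ × ℝ → E} (hf : Continuous f) :
    ∫ x in unitSquare, f x = ∫ t in (0 : ℝ)..1, ∫ s in (0 : ℝ)..1, f (s, t) := by
  refine Eq.trans ?_ (setIntegral_unitSquare (f := fun x => f x.swap) (by fun_prop))
  have := setIntegral_prod_swap (μ := volume) (ν := volume) (Set.Icc (0 : ℝ) 1)
    (Set.Icc (0 : ℝ) 1) f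
  rw [Set.Icc_prod_Icc] at this
  exact this.symm

theorem setIntegral_pd1_eq_zero {f : ℝ × ℝ → ℂ} (hf : SmoothPer f) :
    ∫ x in unitSquare, pd1 f x = 0 := by
  rw [setIntegral_unitSquare' hf.pd1.cont]
  have : ∀ t : ℝ, ∫ s in (0 : ℝ)..1, pd1 f (s, t) = 0 := by
    intro t
    have hd : ∀ s : ℝ, HasDerivAt (fun s => f (s, t)) (pd1 f (s, t)) s := by
      intro s
      have h1 : HasDerivAt (fun s : ℝ => (s, t)) ((1 : ℝ), (0 : ℝ)) s :=
        (hasDerivAt_id s).prodMk (hasDerivAt_const s t)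
      exact (hf.diff (s, t)).hasFDerivAt.comp_hasDerivAt s h1
    rw [intervalIntegral.integral_eq_sub_of_hasDerivAt (fun s _ => hd s)
      ((hf.pd1.cont.comp (by fun_prop : Continuous fun s : ℝ => (s, t))).intervalIntegrable _ _)]
    have := hf.per1 (0, t)
    simp only [zero_add] at this
    rw [this, sub_self]
  simp [this]

theorem setIntegral_pd2_eq_zero {f : ℝ × ℝ → ℂ} (hf : SmoothPer f) :
    ∫ x in unitSquare, pd2 f x = 0 := by
  rw [setIntegral_unitSquare hf.pd2.cont]
  have : ∀ s : ℝ, ∫ t in (0 : ℝ)..1, pd2 f (s, t) = 0 := by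
    intro s
    have hd : ∀ t : ℝ, HasDerivAt (fun t => f (s, t)) (pd2 f (s, t)) t := by
      intro t
      have h1 : HasDerivAt (fun t : ℝ => (s, t)) ((0 : ℝ), (1 : ℝ)) t :=
        (hasDerivAt_const t s).prodMk (hasDerivAt_id t)
      exact (hf.diff (s, t)).hasFDerivAt.comp_hasDerivAt t h1
    rw [intervalIntegral.integral_eq_sub_of_hasDerivAt (fun s _ => hd s)
      ((hf.pd2.cont.comp (by fun_prop : Continuous fun t : ℝ => (s, t))).intervalIntegrable _ _)]
    have := hf.per2 (s, 0)
    simp only [zero_add] at this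
    rw [this, sub_self]
  simp [this]

theorem setIntegral_unitSquare_one : ∫ _ in unitSquare, (1 : ℂ) = 1 := by
  rw [setIntegral_unitSquare continuous_const]
  simp

theorem setIntegral_pd1_mul {f g : ℝ × ℝ → ℂ} (hf : SmoothPer f) (hg : SmoothPer g) :
    ∫ x in unitSquare, pd1 f x * g x = -∫ x in unitSquare, f x * pd1 g x := by
  have h := setIntegral_pd1_eq_zero (hf.mul hg)
  simp only [pd1_mul hf.diff hg.diff] at h
  rw [integral_add (integrableOn_unitSquare (hf.pd1.mul hg).cont)
    (integrableOn_unitSquare (hf.mul hg.pd1).cont)] at h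
  exact eq_neg_of_add_eq_zero_left h

theorem setIntegral_pd2_mul {f g : ℝ × ℝ → ℂ} (hf : SmoothPer f) (hg : SmoothPer g) :
    ∫ x in unitSquare, pd2 f x * g x = -∫ x in unitSquare, f x * pd2 g x := by
  have h := setIntegral_pd2_eq_zero (hf.mul hg)
  simp only [pd2_mul hf.diff hg.diff] at h
  rw [integral_add (integrableOn_unitSquare (hf.pd2.mul hg).cont)
    (integrableOn_unitSquare (hf.mul hg.pd2).cont)] at h
  exact eq_neg_of_add_eq_zero_left h

/-- The characters of the torus. -/
def fe (k : ℤ × ℤ) (x : ℝ × ℝ) : ℂ := exp (2 * Real.pi * I * (k.1 * x.1 + k.2 * x.2))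

theorem fe_add (k l : ℤ × ℤ) (x : ℝ × ℝ) : fe (k + l) x = fe k x * fe l x := by
  unfold fe
  rw [← Complex.exp_add]
  congr 1
  push_cast [Prod.fst_add, Prod.snd_add]
  ring

theorem fe_zero (x : ℝ × ℝ) : fe 0 x = 1 := by simp [fe]

theorem norm_fe (k : ℤ × ℤ) (x : ℝ × ℝ) : ‖fe k x‖ = 1 := by
  rw [fe, show (2 * Real.pi * I * (k.1 * x.1 + k.2 * x.2) : ℂ) =
    ((2 * Real.pi * (k.1 * x.1 + k.2 * x.2) : ℝ) : ℂ) * I by push_cast; ring]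
  exact Complex.norm_exp_ofReal_mul_I _

theorem conj_fe (k : ℤ × ℤ) (x : ℝ × ℝ) : (starRingEnd ℂ) (fe k x) = fe (-k) x := by
  unfold fe
  rw [← Complex.exp_conj]
  simp [Complex.conj_ofNat]
  ring_nf

theorem smoothPer_fe (k : ℤ × ℤ) : SmoothPer (fe k) := by
  refine ⟨?_, fun x => ?_, fun x => ?_⟩
  · unfold fe
    refine ContDiff.cexp (contDiff_const.mul (ContDiff.add (contDiff_const.mul ?_)
      (contDiff_const.mul ?_)))
    · exact ofRealCLM.contDiff.comp contDiff_fst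
    · exact ofRealCLM.contDiff.comp contDiff_snd
  · unfold fe
    rw [show (2 * Real.pi * I * (k.1 * ((x.1 + 1 : ℝ) : ℂ) + k.2 * x.2) : ℂ) =
      2 * Real.pi * I * (k.1 * x.1 + k.2 * x.2) + k.1 * (2 * Real.pi * I) by push_cast; ring,
      Complex.exp_add, Complex.exp_int_mul_two_pi_mul_I, mul_one]
  · unfold fe
    rw [show (2 * Real.pi * I * (k.1 * x.1 + k.2 * ((x.2 + 1 : ℝ) : ℂ)) : ℂ) =
      2 * Real.pi * I * (k.1 * x.1 + k.2 * x.2) + k.2 * (2 * Real.pi * I) by push_cast; ring,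
      Complex.exp_add, Complex.exp_int_mul_two_pi_mul_I, mul_one]

theorem hasFDerivAt_fe (k : ℤ × ℤ) (x : ℝ × ℝ) :
    HasFDerivAt (fe k) (fe k x • ((2 * Real.pi * I) • ((k.1 : ℂ) •
      (ofRealCLM.comp (ContinuousLinearMap.fst ℝ ℝ ℝ)) + (k.2 : ℂ) •
      (ofRealCLM.comp (ContinuousLinearMap.snd ℝ ℝ ℝ))))) x := by
  unfold fe
  refine HasFDerivAt.cexp (HasFDerivAt.const_mul (HasFDerivAt.add (HasFDerivAt.const_mul ?_ _)
    (HasFDerivAt.const_mul ?_ _)) _)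
  · exact (ofRealCLM.comp (ContinuousLinearMap.fst ℝ ℝ ℝ)).hasFDerivAt
  · exact (ofRealCLM.comp (ContinuousLinearMap.snd ℝ ℝ ℝ)).hasFDerivAt

theorem pd1_fe (k : ℤ × ℤ) (x : ℝ × ℝ) : pd1 (fe k) x = 2 * Real.pi * I * k.1 * fe k x := by
  simp only [pd1, (hasFDerivAt_fe k x).fderiv]
  simp
  ring

theorem pd2_fe (k : ℤ × ℤ) (x : ℝ × ℝ) : pd2 (fe k) x = 2 * Real.pi * I * k.2 * fe k x := by
  simp only [pd2, (hasFDerivAt_fe k x).fderiv]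
  simp
  ring

/-- Fourier coefficients. -/
def fc (f : ℝ × ℝ → ℂ) (k : ℤ × ℤ) : ℂ := ∫ x in unitSquare, f x * fe (-k) x

section FourierCoefficients

variable {f g : ℝ × ℝ → ℂ}

theorem integrableOn_mul_fe (hf : Continuous f) (k : ℤ × ℤ) :
    IntegrableOn (fun x => f x * fe k x) unitSquare :=
  integrableOn_unitSquare (hf.mul (smoothPer_fe k).cont)

theorem fc_add (hf : Continuous f) (hg : Continuous g) (k : ℤ × ℤ) :
    fc (fun x => f x + g x) k = fc f k + fc g k := by
  simp only [fc, add_mul]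
  exact integral_add (integrableOn_mul_fe hf _) (integrableOn_mul_fe hg _)

theorem fc_sub (hf : Continuous f) (hg : Continuous g) (k : ℤ × ℤ) :
    fc (fun x => f x - g x) k = fc f k - fc g k := by
  simp only [fc, sub_mul]
  exact integral_sub (integrableOn_mul_fe hf _) (integrableOn_mul_fe hg _)

theorem fc_const_mul (c : ℂ) (f : ℝ × ℝ → ℂ) (k : ℤ × ℤ) :
    fc (fun x => c * f x) k = c * fc f k := by
  simp only [fc, mul_assoc]
  exact integral_const_mul _ _

theorem setIntegral_fe (k : ℤ × ℤ) : ∫ x in unitSquare, fe k x = if k = 0 then 1 else 0 := by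
  split_ifs with h
  · subst h
    simpa only [fe_zero] using setIntegral_unitSquare_one
  · have hp : (2 * Real.pi * I : ℂ) ≠ 0 := Complex.two_pi_I_ne_zero
    have h1 := setIntegral_pd1_eq_zero (smoothPer_fe k)
    have h2 := setIntegral_pd2_eq_zero (smoothPer_fe k)
    simp only [pd1_fe, pd2_fe] at h1 h2
    rw [integral_const_mul] at h1 h2
    by_contra h0
    apply h
    have e1 : k.1 = 0 := by simpa [hp, h0] using h1
    have e2 : k.2 = 0 := by simpa [hp, h0] using h2
    exact Prod.ext e1 e2

theorem fc_fe (l k : ℤ × ℤ) : fc (fe l) k = if l = k then 1 else 0 := by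
  simp only [fc, ← fe_add, setIntegral_fe, ← sub_eq_add_neg, sub_eq_zero]

theorem fc_pd1 (hf : SmoothPer f) (k : ℤ × ℤ) :
    fc (pd1 f) k = 2 * Real.pi * I * k.1 * fc f k := by
  rw [fc, setIntegral_pd1_mul hf (smoothPer_fe _), fc, ← integral_const_mul, ← integral_neg]
  congr 1
  funext x
  rw [pd1_fe]
  push_cast [Prod.fst_neg]
  ring

theorem fc_pd2 (hf : SmoothPer f) (k : ℤ × ℤ) :
    fc (pd2 f) k = 2 * Real.pi * I * k.2 * fc f k := by
  rw [fc, setIntegral_pd2_mul hf (smoothPer_fe _), fc, ← integral_const_mul, ← integral_neg]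
  congr 1
  funext x
  rw [pd2_fe]
  push_cast [Prod.snd_neg]
  ring

theorem fc_conj (f : ℝ × ℝ → ℂ) (k : ℤ × ℤ) :
    fc (fun x => (starRingEnd ℂ) (f x)) k = (starRingEnd ℂ) (fc f (-k)) := by
  rw [fc, fc, ← integral_conj]
  congr 1
  funext x
  rw [map_mul, conj_fe, neg_neg]

theorem norm_fc_le (f : ℝ × ℝ → ℂ) (k : ℤ × ℤ) : ‖fc f k‖ ≤ ∫ x in unitSquare, ‖f x‖ := by
  refine (norm_integral_le_integral_norm _).trans_eq ?_
  simp only [norm_mul, norm_fe, mul_one]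

end FourierCoefficients

/-- Rapidly decreasing coefficient families. -/
def Rapid (c : ℤ × ℤ → ℂ) : Prop := ∀ s : ℕ, ∑' k, wt k ^ s * ‖c k‖ₑ ≠ ∞

theorem Rapid.of_le {c c' : ℤ × ℤ → ℂ} (hc : Rapid c) {C : ℝ≥0∞} (hC : C ≠ ∞) (r : ℕ)
    (h : ∀ k, ‖c' k‖ₑ ≤ C * (wt k ^ r * ‖c k‖ₑ)) : Rapid c' := by
  intro s
  refine ne_top_of_le_ne_top (ENNReal.mul_ne_top hC (hc (s + r))) ?_
  rw [← ENNReal.tsum_mul_left]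
  refine ENNReal.tsum_le_tsum fun k => ?_
  calc wt k ^ s * ‖c' k‖ₑ ≤ wt k ^ s * (C * (wt k ^ r * ‖c k‖ₑ)) := by gcongr; exact h k
    _ = C * (wt k ^ (s + r) * ‖c k‖ₑ) := by rw [pow_add]; ring

theorem enorm_intCast_le_wt_sq (k : ℤ × ℤ) :
    ‖(k.1 : ℂ)‖ₑ ≤ wt k ^ 2 ∧ ‖(k.2 : ℂ)‖ₑ ≤ wt k ^ 2 := by
  rw [wt_sq, ← ofReal_norm, ← ofReal_norm, Complex.norm_intCast,
    Complex.norm_intCast]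
  constructor <;> apply ENNReal.ofReal_le_ofReal <;>
    linarith [abs_nonneg (k.1 : ℝ), abs_nonneg (k.2 : ℝ)]

/-- Symbol multiplication corresponding to the first partial derivative. -/
def dc1 (c : ℤ × ℤ → ℂ) (k : ℤ × ℤ) : ℂ := 2 * Real.pi * I * k.1 * c k

/-- Symbol multiplication corresponding to the second partial derivative. -/
def dc2 (c : ℤ × ℤ → ℂ) (k : ℤ × ℤ) : ℂ := 2 * Real.pi * I * k.2 * c k

theorem enorm_dc1_le (c : ℤ × ℤ → ℂ) (k : ℤ × ℤ) :
    ‖dc1 c k‖ₑ ≤ ‖(2 * Real.pi * I : ℂ)‖ₑ * (wt k ^ 2 * ‖c k‖ₑ) := by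
  rw [dc1, mul_assoc, enorm_mul _ (k.1 * c k), enorm_mul (k.1 : ℂ)]
  exact mul_le_mul_right (mul_le_mul_left (enorm_intCast_le_wt_sq k).1 _) _

theorem enorm_dc2_le (c : ℤ × ℤ → ℂ) (k : ℤ × ℤ) :
    ‖dc2 c k‖ₑ ≤ ‖(2 * Real.pi * I : ℂ)‖ₑ * (wt k ^ 2 * ‖c k‖ₑ) := by
  rw [dc2, mul_assoc, enorm_mul _ (k.2 * c k), enorm_mul (k.2 : ℂ)]
  exact mul_le_mul_right (mul_le_mul_left (enorm_intCast_le_wt_sq k).2 _) _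

namespace Rapid

variable {c : ℤ × ℤ → ℂ}

theorem dc1 (hc : Rapid c) : Rapid (dc1 c) := hc.of_le enorm_ne_top 2 (enorm_dc1_le c)

theorem dc2 (hc : Rapid c) : Rapid (dc2 c) := hc.of_le enorm_ne_top 2 (enorm_dc2_le c)

theorem summable_norm (hc : Rapid c) : Summable fun k => ‖c k‖ := by
  have h := hc 0
  simp only [pow_zero, one_mul] at h
  have := ENNReal.summable_toReal h
  simpa [toReal_enorm] using this

end Rapid

/-- The sum of the Fourier series with coefficients `c`. -/
def ev (c : ℤ × ℤ → ℂ) (x : ℝ × ℝ) : ℂ := ∑' k, c k * fe k x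

section Evaluation

variable {c : ℤ × ℤ → ℂ}

theorem summable_mul_fe (hc : Summable fun k => ‖c k‖) (x : ℝ × ℝ) :
    Summable fun k => c k * fe k x := by
  refine Summable.of_norm ?_
  simpa only [norm_mul, norm_fe, mul_one] using hc

theorem hasFDerivAt_ev (hc : Rapid c) (x : ℝ × ℝ) :
    HasFDerivAt (ev c) (ev (dc1 c) x • (ofRealCLM.comp (ContinuousLinearMap.fst ℝ ℝ ℝ)) +
      ev (dc2 c) x • (ofRealCLM.comp (ContinuousLinearMap.snd ℝ ℝ ℝ))) x := by
  set L1 : ℝ × ℝ →L[ℝ] ℂ := ofRealCLM.comp (ContinuousLinearMap.fst ℝ ℝ ℝ)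
  set L2 : ℝ × ℝ →L[ℝ] ℂ := ofRealCLM.comp (ContinuousLinearMap.snd ℝ ℝ ℝ)
  have h := hasFDerivAt_tsum (𝕜 := ℝ) (f := fun k y => c k * fe k y)
    (f' := fun k y => (dc1 c k * fe k y) • L1 + (dc2 c k * fe k y) • L2)
    (u := fun k => ‖dc1 c k‖ * ‖L1‖ + ‖dc2 c k‖ * ‖L2‖)
    ((hc.dc1.summable_norm.mul_right _).add (hc.dc2.summable_norm.mul_right _))
    (fun k y => ?_) (fun k y => ?_) (summable_mul_fe hc.summable_norm x) x
  · have s1 := summable_mul_fe hc.dc1.summable_norm x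
    have s2 := summable_mul_fe hc.dc2.summable_norm x
    rw [(s1.smul_const L1).tsum_add (s2.smul_const L2), s1.tsum_smul_const,
      s2.tsum_smul_const] at h
    exact h
  · refine ((hasFDerivAt_fe k y).const_mul (c k)).congr_fderiv ?_
    ext <;> simp [dc1, dc2, L1, L2] <;> ring
  · refine (norm_add_le _ _).trans ?_
    simp [norm_smul, norm_fe]

theorem pd1_ev (hc : Rapid c) : pd1 (ev c) = ev (dc1 c) := by
  funext x
  simp [pd1, (hasFDerivAt_ev hc x).fderiv]

theorem pd2_ev (hc : Rapid c) : pd2 (ev c) = ev (dc2 c) := by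
  funext x
  simp [pd2, (hasFDerivAt_ev hc x).fderiv]

theorem contDiff_ev (hc : Rapid c) : ContDiff ℝ (⊤ : ℕ∞) (ev c) := by
  have key : ∀ n : ℕ, ∀ c, Rapid c → ContDiff ℝ n (ev c) := by
    intro n
    induction n with
    | zero =>
      intro c hc
      have : Differentiable ℝ (ev c) := fun x => (hasFDerivAt_ev hc x).differentiableAt
      exact contDiff_zero.2 this.continuous
    | succ n ih =>
      intro c hc
      rw [show ((n + 1 : ℕ) : WithTop ℕ∞) = (n : WithTop ℕ∞) + 1 by push_cast; rfl,
        contDiff_succ_iff_fderiv]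
      refine ⟨fun x => (hasFDerivAt_ev hc x).differentiableAt, by simp, ?_⟩
      rw [funext fun x => (hasFDerivAt_ev hc x).fderiv]
      exact ((ih _ hc.dc1).smul contDiff_const).add ((ih _ hc.dc2).smul contDiff_const)
  exact contDiff_infty.2 fun n => key n c hc

theorem smoothPer_ev (hc : Rapid c) : SmoothPer (ev c) := by
  refine ⟨contDiff_ev hc, fun x => ?_, fun x => ?_⟩
  · exact tsum_congr fun k => by rw [(smoothPer_fe k).per1]
  · exact tsum_congr fun k => by rw [(smoothPer_fe k).per2]

theorem setIntegral_tsum_mul {g : ℝ × ℝ → ℂ} (hc : Summable fun k => ‖c k‖)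
    (hg : Continuous g) :
    ∫ x in unitSquare, (∑' k, c k * fe k x) * g x =
      ∑' k, c k * ∫ x in unitSquare, fe k x * g x := by
  have h := integral_tsum_of_summable_integral_norm (μ := volume.restrict unitSquare)
    (F := fun k x => c k * (fe k x * g x))
    (fun k => integrableOn_unitSquare
      (continuous_const.mul ((smoothPer_fe k).cont.mul hg))) ?_
  · simp only [integral_const_mul] at h
    rw [h]
    congr 1
    funext x
    rw [← tsum_mul_right]
    exact tsum_congr fun k => by ring
  · simp only [norm_mul, norm_fe, one_mul, integral_const_mul]
    exact hc.mul_right _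

theorem fc_ev (hc : Rapid c) : fc (ev c) = c := by
  funext k
  simp only [fc, ev]
  rw [setIntegral_tsum_mul hc.summable_norm (smoothPer_fe _).cont,
    tsum_eq_single k fun l hl => ?_]
  · simp [← fe_add, setIntegral_fe]
  · simp only [← fe_add, setIntegral_fe, ← sub_eq_add_neg, sub_eq_zero, if_neg hl, mul_zero]

end Evaluation

theorem exists_bound_wt_pow_mul_fc (n : ℕ) : ∀ f : ℝ × ℝ → ℂ, SmoothPer f →
    ∃ C : ℝ≥0∞, C ≠ ∞ ∧ ∀ k, wt k ^ (2 * n) * ‖fc f k‖ₑ ≤ C := by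
  induction n with
  | zero =>
    intro f hf
    refine ⟨ENNReal.ofReal (∫ x in unitSquare, ‖f x‖), ENNReal.ofReal_ne_top, fun k => ?_⟩
    rw [mul_zero, pow_zero, one_mul, ← ofReal_norm]
    exact ENNReal.ofReal_le_ofReal (norm_fc_le f k)
  | succ n ih =>
    intro f hf
    obtain ⟨C, hC, h⟩ := ih f hf
    obtain ⟨C1, hC1, h1⟩ := ih _ hf.pd1
    obtain ⟨C2, hC2, h2⟩ := ih _ hf.pd2
    refine ⟨C + C1 + C2, by simp [*], fun k => ?_⟩
    have key : wt k ^ 2 * ‖fc f k‖ₑ ≤ ‖fc f k‖ₑ + ‖fc (pd1 f) k‖ₑ + ‖fc (pd2 f) k‖ₑ := by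
      rw [fc_pd1 hf, fc_pd2 hf, wt_sq]
      simp only [← ofReal_norm]
      rw [← ENNReal.ofReal_mul (by positivity), ← ENNReal.ofReal_add (by positivity)
        (by positivity), ← ENNReal.ofReal_add (by positivity) (by positivity)]
      apply ENNReal.ofReal_le_ofReal
      simp only [norm_mul, Complex.norm_intCast, Complex.norm_I, Complex.norm_real,
        Real.norm_eq_abs, abs_of_pos Real.pi_pos, mul_one]
      have hp : (1 : ℝ) ≤ ‖(2 : ℂ)‖ * Real.pi := by
        rw [Complex.norm_two]; linarith [Real.pi_gt_three]
      have a1 : (0 : ℝ) ≤ |(k.1 : ℝ)| * ‖fc f k‖ := by positivity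
      have a2 : (0 : ℝ) ≤ |(k.2 : ℝ)| * ‖fc f k‖ := by positivity
      nlinarith
    calc wt k ^ (2 * (n + 1)) * ‖fc f k‖ₑ = wt k ^ (2 * n) * (wt k ^ 2 * ‖fc f k‖ₑ) := by ring
      _ ≤ wt k ^ (2 * n) * (‖fc f k‖ₑ + ‖fc (pd1 f) k‖ₑ + ‖fc (pd2 f) k‖ₑ) := by gcongr
      _ = wt k ^ (2 * n) * ‖fc f k‖ₑ + wt k ^ (2 * n) * ‖fc (pd1 f) k‖ₑ +
          wt k ^ (2 * n) * ‖fc (pd2 f) k‖ₑ := by ring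
      _ ≤ C + C1 + C2 := by gcongr; exacts [h k, h1 k, h2 k]

theorem rapid_of_wt_pow_mul_le {c : ℤ × ℤ → ℂ}
    (h : ∀ s : ℕ, ∃ B : ℝ≥0∞, B ≠ ∞ ∧ ∀ k, wt k ^ s * ‖c k‖ₑ ≤ B) : Rapid c := by
  intro s
  obtain ⟨C, hC, h⟩ := h (s + 5)
  refine ne_top_of_le_ne_top (ENNReal.mul_ne_top hC tsum_inv_wt_pow_ne_top) ?_
  rw [← ENNReal.tsum_mul_left]
  refine ENNReal.tsum_le_tsum fun k => ?_
  have h5 : wt k ^ 5 * (wt k)⁻¹ ^ 5 = 1 := by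
    rw [← mul_pow, ENNReal.mul_inv_cancel (wt_ne_zero k) (wt_ne_top k), one_pow]
  calc wt k ^ s * ‖c k‖ₑ = (wt k ^ (s + 5) * ‖c k‖ₑ) * (wt k)⁻¹ ^ 5 := by
        rw [pow_add, mul_right_comm, mul_assoc (wt k ^ s), h5, mul_one]
    _ ≤ C * (wt k)⁻¹ ^ 5 := by gcongr; exact h k

theorem SmoothPer.rapid {f : ℝ × ℝ → ℂ} (hf : SmoothPer f) : Rapid (fc f) := by
  refine rapid_of_wt_pow_mul_le fun s => ?_
  obtain ⟨C, hC, h⟩ := exists_bound_wt_pow_mul_fc s f hf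
  refine ⟨C, hC, fun k => le_trans ?_ (h k)⟩
  gcongr
  · exact one_le_wt k
  · omega

theorem eq_zero_of_fourier_integral_eq_zero {g : ℝ → ℂ} (hg : Continuous g)
    (hp : ∀ x, g (x + 1) = g x)
    (h : ∀ n : ℤ, ∫ t in (0 : ℝ)..1, g t * exp (2 * Real.pi * I * (n * t)) = 0) : g = 0 := by
  have hper : Function.Periodic g 1 := hp
  have hc : Continuous (hper.lift) := by
    rw [continuous_coinduced_dom]
    exact hg
  let G : C(AddCircle (1 : ℝ), ℂ) := ⟨hper.lift, hc⟩
  have hGc : ∀ t : ℝ, G (t : AddCircle (1 : ℝ)) = g t := fun t => hper.lift_coe t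
  clear_value G
  have h0 : ∀ n, fourierCoeff G n = 0 := by
    intro n
    rw [fourierCoeff_eq_intervalIntegral _ n 0]
    simp only [zero_add, div_one, one_smul, hGc]
    rw [← h (-n)]
    refine intervalIntegral.integral_congr fun t _ => ?_
    simp only [fourier_coe_apply, smul_eq_mul]
    rw [mul_comm]
    congr 2
    push_cast
    ring
  funext x
  have hs := has_pointwise_sum_fourier_series_of_summable (f := G) (by
    rw [show fourierCoeff G = 0 from funext h0]; exact summable_zero) (x : AddCircle (1 : ℝ))
  simp only [h0, smul_eq_mul, zero_mul, hGc] at hs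
  exact hs.unique hasSum_zero

theorem eq_zero_of_fc_eq_zero {f : ℝ × ℝ → ℂ} (hf : SmoothPer f) (h : ∀ k, fc f k = 0) :
    f = 0 := by
  have h1 : ∀ m : ℤ, (fun t : ℝ => ∫ s in (0 : ℝ)..1,
      f (s, t) * exp (2 * Real.pi * I * (m * s))) = 0 := by
    intro m
    apply eq_zero_of_fourier_integral_eq_zero
    · apply intervalIntegral.continuous_parametric_intervalIntegral_of_continuous'
      have := hf.cont
      fun_prop
    · intro t
      congr 1
      funext s
      have := hf.per2 (s, t)
      simp only at this
      rw [this]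
    · intro n
      have := h (-m, -n)
      rw [fc, setIntegral_unitSquare' (hf.mul (smoothPer_fe _)).cont] at this
      rw [← this]
      congr 1
      funext t
      rw [← intervalIntegral.integral_mul_const]
      congr 1
      funext s
      rw [fe, mul_assoc, ← Complex.exp_add]
      congr 2
      push_cast [Prod.fst_neg, Prod.snd_neg]
      ring
  funext x
  have h2 : (fun s : ℝ => f (s, x.2)) = 0 := by
    apply eq_zero_of_fourier_integral_eq_zero
    · have := hf.cont
      fun_prop
    · intro s
      exact hf.per1 (s, x.2)
    · intro m
      exact congrFun (h1 m) x.2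
  exact congrFun h2 x.1

theorem SmoothPer.eq_ev {f : ℝ × ℝ → ℂ} (hf : SmoothPer f) : f = ev (fc f) := by
  have he := smoothPer_ev hf.rapid
  have := eq_zero_of_fc_eq_zero (hf.sub he) fun k => by
    rw [fc_sub hf.cont he.cont, fc_ev hf.rapid, sub_self]
  funext x
  exact sub_eq_zero.1 (congrFun this x)

theorem fc_mul {f g : ℝ × ℝ → ℂ} (hf : SmoothPer f) (hg : Continuous g) (k : ℤ × ℤ) :
    fc (fun x => f x * g x) k = ∑' l, fc f l * fc g (k - l) := by
  have h := setIntegral_tsum_mul (g := fun x => g x * fe (-k) x) hf.rapid.summable_norm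
    (hg.mul (smoothPer_fe _).cont)
  rw [fc]
  conv_lhs => rw [hf.eq_ev]
  simp only [mul_assoc]
  refine h.trans (tsum_congr fun l => ?_)
  rw [fc]
  congr 2
  funext x
  rw [show -(k - l) = l + -k by abel, fe_add]
  ring

theorem enorm_fc_mul_le {f g : ℝ × ℝ → ℂ} (hf : SmoothPer f) (hg : Continuous g) (k : ℤ × ℤ) :
    ‖fc (fun x => f x * g x) k‖ₑ ≤ conv (fun l => ‖fc f l‖ₑ) (fun l => ‖fc g l‖ₑ) k := by
  rw [fc_mul hf hg]
  refine enorm_tsum_le_tsum_enorm.trans_eq ?_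
  simp only [enorm_mul, conv]

theorem hasSum_sq_norm_fc {f : ℝ × ℝ → ℂ} (hf : SmoothPer f) :
    HasSum (fun k => ‖fc f k‖ ^ 2) (∫ x in unitSquare, ‖f x‖ ^ 2) := by
  have hs : Summable fun k => ‖fc f k‖ ^ 2 := by
    have h1 := hf.rapid.summable_norm
    refine .of_nonneg_of_le (fun _ => by positivity) (fun k => ?_)
      (h1.mul_left (∫ x in unitSquare, ‖f x‖))
    rw [sq]
    gcongr
    exact norm_fc_le f k
  have h := fc_mul hf hf.conj.cont 0
  simp only [fc_conj, zero_sub, neg_neg, Complex.mul_conj', ← ofReal_pow] at h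
  rw [fc, ← Complex.ofReal_tsum] at h
  simp only [neg_zero, fe_zero, mul_one] at h
  rw [integral_complex_ofReal] at h
  rw [Complex.ofReal_inj.1 h]
  exact hs.hasSum

theorem tsum_sq_enorm_fc {f : ℝ × ℝ → ℂ} (hf : SmoothPer f) :
    ∑' k, ‖fc f k‖ₑ ^ 2 = ENNReal.ofReal (∫ x in unitSquare, ‖f x‖ ^ 2) := by
  have h := hasSum_sq_norm_fc hf
  rw [← h.tsum_eq, ENNReal.ofReal_tsum_of_nonneg (fun _ => by positivity) h.summable]
  refine tsum_congr fun k => ?_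
  rw [ENNReal.ofReal_pow (norm_nonneg _), ofReal_norm]

section EvaluationLimits

open Filter Topology

variable {c : ℤ × ℤ → ℂ} {B : ℝ≥0∞}

theorem norm_le_of_wt_pow_mul_le (hB : B ≠ ∞) (h : ∀ k, wt k ^ 5 * ‖c k‖ₑ ≤ B) (k : ℤ × ℤ) :
    ‖c k‖ ≤ (B * (wt k)⁻¹ ^ 5).toReal := by
  rw [← toReal_enorm]
  refine ENNReal.toReal_mono (ENNReal.mul_ne_top hB
    (ENNReal.pow_ne_top (ENNReal.inv_ne_top.2 (wt_ne_zero k)))) ?_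
  have h5 : wt k ^ 5 * (wt k)⁻¹ ^ 5 = 1 := by
    rw [← mul_pow, ENNReal.mul_inv_cancel (wt_ne_zero k) (wt_ne_top k), one_pow]
  calc ‖c k‖ₑ = (wt k ^ 5 * ‖c k‖ₑ) * (wt k)⁻¹ ^ 5 := by rw [mul_right_comm, h5, one_mul]
    _ ≤ B * (wt k)⁻¹ ^ 5 := by gcongr; exact h k

theorem summable_toReal_mul_inv_wt (hB : B ≠ ∞) :
    Summable fun k => (B * (wt k)⁻¹ ^ 5).toReal := by
  refine ENNReal.summable_toReal ?_
  rw [ENNReal.tsum_mul_left]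
  exact ENNReal.mul_ne_top hB tsum_inv_wt_pow_ne_top

theorem norm_ev_le (hB : B ≠ ∞) (h : ∀ k, wt k ^ 5 * ‖c k‖ₑ ≤ B) (x : ℝ × ℝ) :
    ‖ev c x‖ ≤ ∑' k, (B * (wt k)⁻¹ ^ 5).toReal := by
  refine tsum_of_norm_bounded (summable_toReal_mul_inv_wt hB).hasSum fun k => ?_
  rw [norm_mul, norm_fe, mul_one]
  exact norm_le_of_wt_pow_mul_le hB h k

theorem tendsto_ev {c : ℕ → ℤ × ℤ → ℂ} {c' : ℤ × ℤ → ℂ} (hB : B ≠ ∞)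
    (h : ∀ n k, wt k ^ 5 * ‖c n k‖ₑ ≤ B) (hc : ∀ k, Tendsto (fun n => c n k) atTop (𝓝 (c' k)))
    (x : ℝ × ℝ) : Tendsto (fun n => ev (c n) x) atTop (𝓝 (ev c' x)) := by
  refine tendsto_tsum_of_dominated_convergence (summable_toReal_mul_inv_wt hB)
    (fun k => (hc k).mul_const _) (Eventually.of_forall fun n k => ?_)
  rw [norm_mul, norm_fe, mul_one]
  exact norm_le_of_wt_pow_mul_le hB (h n) k

theorem wt_pow_mul_dc_le (h : ∀ k, wt k ^ 7 * ‖c k‖ₑ ≤ B) (k : ℤ × ℤ) :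
    wt k ^ 5 * ‖dc1 c k‖ₑ ≤ ‖(2 * Real.pi * I : ℂ)‖ₑ * B ∧
      wt k ^ 5 * ‖dc2 c k‖ₑ ≤ ‖(2 * Real.pi * I : ℂ)‖ₑ * B := by
  have key : wt k ^ 5 * (‖(2 * Real.pi * I : ℂ)‖ₑ * (wt k ^ 2 * ‖c k‖ₑ)) ≤
      ‖(2 * Real.pi * I : ℂ)‖ₑ * B := by
    rw [show wt k ^ 5 * (‖(2 * Real.pi * I : ℂ)‖ₑ * (wt k ^ 2 * ‖c k‖ₑ)) =
      ‖(2 * Real.pi * I : ℂ)‖ₑ * (wt k ^ 7 * ‖c k‖ₑ) by ring]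
    exact mul_le_mul_right (h k) _
  exact ⟨(mul_le_mul_right (enorm_dc1_le c k) _).trans key,
    (mul_le_mul_right (enorm_dc2_le c k) _).trans key⟩

theorem wt_pow_five_mul_le (h : ∀ k, wt k ^ 7 * ‖c k‖ₑ ≤ B) (k : ℤ × ℤ) :
    wt k ^ 5 * ‖c k‖ₑ ≤ B := by
  refine le_trans ?_ (h k)
  gcongr
  · exact one_le_wt k
  · norm_num

end EvaluationLimits

/-- The partial derivatives, indexed by the coordinate. -/
def pdv (k : Fin 2) (f : ℝ × ℝ → ℂ) : ℝ × ℝ → ℂ := ![pd1 f, pd2 f] k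

@[simp] theorem pdv_zero (f : ℝ × ℝ → ℂ) : pdv 0 f = pd1 f := rfl

@[simp] theorem pdv_one (f : ℝ × ℝ → ℂ) : pdv 1 f = pd2 f := rfl

/-- Multiplication by the symbol of `pdv k`. -/
def dcv (k : Fin 2) (c : ℤ × ℤ → ℂ) : ℤ × ℤ → ℂ := ![dc1 c, dc2 c] k

/-- Real coordinates of a complex number. -/
def coord (k : Fin 2) (z : ℂ) : ℝ := ![z.re, z.im] k

@[simp] theorem coord_zero (z : ℂ) : coord 0 z = z.re := rfl

@[simp] theorem coord_one (z : ℂ) : coord 1 z = z.im := rfl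

theorem continuous_coord (k : Fin 2) : Continuous (coord k) := by
  fin_cases k
  · exact Complex.continuous_re
  · exact Complex.continuous_im

theorem SmoothPer.pdv {f : ℝ × ℝ → ℂ} (hf : SmoothPer f) (k : Fin 2) : SmoothPer (pdv k f) := by
  fin_cases k
  · exact hf.pd1
  · exact hf.pd2

theorem pdv_ev {c : ℤ × ℤ → ℂ} (hc : Rapid c) (k : Fin 2) : pdv k (ev c) = ev (dcv k c) := by
  fin_cases k
  · exact pd1_ev hc
  · exact pd2_ev hc

/-- The coefficients of a Ginzburg-Landau functional for periodic functions. -/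
structure GLData where
  α : ℝ
  β : ℝ
  q : ℝ × ℝ → ℂ
  A : Fin 2 → Fin 2 → Fin 2 → ℝ × ℝ → ℂ
  P : Fin 2 → Fin 2 → ℝ × ℝ → ℂ
  α_pos : 0 < α
  β_pos : 0 < β
  smooth_q : SmoothPer q
  smooth_A : ∀ k i j, SmoothPer (A k i j)
  smooth_P : ∀ i j, SmoothPer (P i j)
  P_conj : ∀ i j x, (starRingEnd ℂ) (P i j x) = P j i x
  P_le : ∀ x (z : Fin 2 → ℂ),
    (∑ i, ∑ j, P i j x * (starRingEnd ℂ) (z i) * z j).re ≤ ∑ i, ‖z i‖ ^ 2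

namespace GLData

variable (D : GLData)

/-- The zeroth order part of the covariant derivative, as a function of the values of the fields. -/
def low (x : ℝ × ℝ) (p : Fin 3 → ℂ) (k i : Fin 2) : ℂ :=
  ∑ j, D.A k i j x * p j.succ + I * (coord k (p 0) : ℂ) * p i.succ

/-- The Lagrangian density, as a function of the first jet. -/
def lag (x : ℝ × ℝ) (p : Fin 3 → ℂ) (r : Fin 2 → Fin 3 → ℂ) : ℝ :=
  ∑ k, ‖r k 0‖ ^ 2 + 2 * (D.q x * (starRingEnd ℂ) (p 0)).re +
    ∑ k, ∑ i : Fin 2, ‖r k i.succ + D.low x p k i‖ ^ 2 -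
    D.α * (∑ i : Fin 2, ∑ j : Fin 2, D.P i j x * (starRingEnd ℂ) (p i.succ) * p j.succ).re +
    D.β / 2 * (∑ i : Fin 2, ‖p i.succ‖ ^ 2) ^ 2

/-- The action functional on periodic fields `v 0, v 1, v 2`. -/
def act (v : Fin 3 → ℝ × ℝ → ℂ) : ℝ :=
  ∫ x in unitSquare, D.lag x (fun i => v i x) (fun k i => pdv k (v i) x)

theorem continuous_low (k i : Fin 2) :
    Continuous fun y : (ℝ × ℝ) × (Fin 3 → ℂ) => D.low y.1 y.2 k i := by
  have hA : ∀ k i j, Continuous (D.A k i j) := fun k i j => (D.smooth_A k i j).cont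
  have := continuous_coord k
  unfold low
  fun_prop

theorem continuous_lag :
    Continuous fun y : (ℝ × ℝ) × (Fin 3 → ℂ) × (Fin 2 → Fin 3 → ℂ) =>
      D.lag y.1 y.2.1 y.2.2 := by
  have hq := D.smooth_q.cont
  have hP : ∀ i j, Continuous (D.P i j) := fun i j => (D.smooth_P i j).cont
  have hl : ∀ k i, Continuous fun y : (ℝ × ℝ) × (Fin 3 → ℂ) × (Fin 2 → Fin 3 → ℂ) =>
      D.low y.1 y.2.1 k i := fun k i => (D.continuous_low k i).comp
    (g := fun y : (ℝ × ℝ) × (Fin 3 → ℂ) => D.low y.1 y.2 k i)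
    (f := fun y : (ℝ × ℝ) × (Fin 3 → ℂ) × (Fin 2 → Fin 3 → ℂ) => (y.1, y.2.1)) (by fun_prop)
  have hre := Complex.continuous_re
  have hconj := Complex.continuous_conj
  unfold lag
  fun_prop

theorem continuous_lag_comp {v : Fin 3 → ℝ × ℝ → ℂ} (hv : ∀ i, SmoothPer (v i)) :
    Continuous fun x => D.lag x (fun i => v i x) (fun k i => pdv k (v i) x) := by
  have h1 : ∀ i, Continuous (v i) := fun i => (hv i).cont
  have h2 : ∀ k i, Continuous (pdv k (v i)) := fun k i => ((hv i).pdv k).cont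
  exact D.continuous_lag.comp
    (f := fun x => (x, (fun i => v i x), (fun k i => pdv k (v i) x))) (by fun_prop)

open Filter Topology

theorem tendsto_lag (x : ℝ × ℝ) {p : ℕ → Fin 3 → ℂ} {p' : Fin 3 → ℂ}
    {r : ℕ → Fin 2 → Fin 3 → ℂ} {r' : Fin 2 → Fin 3 → ℂ} (hp : Tendsto p atTop (𝓝 p'))
    (hr : Tendsto r atTop (𝓝 r')) :
    Tendsto (fun n => D.lag x (p n) (r n)) atTop (𝓝 (D.lag x p' r')) := by
  have h1 := D.continuous_lag.tendsto (x, p', r')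
  have h2 : Tendsto (fun n => (x, p n, r n)) atTop (𝓝 (x, p', r')) :=
    tendsto_const_nhds.prodMk_nhds (hp.prodMk_nhds hr)
  have h3 := h1.comp h2
  simp only [Function.comp_def] at h3
  exact h3

theorem tendsto_act {c : ℕ → Fin 3 → ℤ × ℤ → ℂ} {c' : Fin 3 → ℤ × ℤ → ℂ} {B : ℝ≥0∞}
    (hB : B ≠ ∞) (h : ∀ n i k, wt k ^ 7 * ‖c n i k‖ₑ ≤ B) (hr : ∀ n i, Rapid (c n i))
    (hr' : ∀ i, Rapid (c' i)) (hc : ∀ i k, Tendsto (fun n => c n i k) atTop (𝓝 (c' i k))) :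
    Tendsto (fun n => D.act fun i => ev (c n i)) atTop (𝓝 (D.act fun i => ev (c' i))) := by
  set B' := ‖(2 * Real.pi * I : ℂ)‖ₑ * B
  have hB' : B' ≠ ∞ := ENNReal.mul_ne_top enorm_ne_top hB
  have hdc : ∀ k n i l, wt l ^ 5 * ‖dcv k (c n i) l‖ₑ ≤ B' := by
    intro k n i l
    fin_cases k
    · exact (wt_pow_mul_dc_le (h n i) l).1
    · exact (wt_pow_mul_dc_le (h n i) l).2
  have hdl : ∀ k i l, Tendsto (fun n => dcv k (c n i) l) atTop (𝓝 (dcv k (c' i) l)) := by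
    intro k i l
    fin_cases k
    · exact (hc i l).const_mul _
    · exact (hc i l).const_mul _
  set K := ∑' k, (B * (wt k)⁻¹ ^ 5).toReal
  set K' := ∑' k, (B' * (wt k)⁻¹ ^ 5).toReal
  have hp : ∀ n i x, ‖ev (c n i) x‖ ≤ K := fun n i x =>
    norm_ev_le hB (wt_pow_five_mul_le (h n i)) x
  have hr1 : ∀ k n i x, ‖pdv k (ev (c n i)) x‖ ≤ K' := by
    intro k n i x
    rw [pdv_ev (hr n i)]
    exact norm_ev_le hB' (hdc k n i) x
  have hK : 0 ≤ K := (norm_nonneg _).trans (hp 0 0 0)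
  have hK' : 0 ≤ K' := (norm_nonneg _).trans (hr1 0 0 0 0)
  have hcomp : IsCompact (unitSquare ×ˢ (Metric.closedBall (0 : Fin 3 → ℂ) K ×ˢ
      Metric.closedBall (0 : Fin 2 → Fin 3 → ℂ) K')) := by
    refine IsCompact.prod ?_ ((isCompact_closedBall _ _).prod (isCompact_closedBall _ _))
    rw [unitSquare, ← Set.Icc_prod_Icc]
    exact isCompact_Icc.prod isCompact_Icc
  obtain ⟨C, hC⟩ := hcomp.exists_bound_of_continuousOn D.continuous_lag.continuousOn
  have hms : MeasurableSet unitSquare := measurableSet_Icc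
  refine tendsto_integral_of_dominated_convergence (fun _ => C) (fun n => ?_) ?_ (fun n => ?_) ?_
  · exact (D.continuous_lag_comp fun i => smoothPer_ev (hr n i)).aestronglyMeasurable
  · exact integrableOn_unitSquare continuous_const
  · refine (ae_restrict_iff' hms).2 (Eventually.of_forall fun x hx => ?_)
    refine hC (x, _, _) ⟨hx, ?_, ?_⟩
    · rw [mem_closedBall_zero_iff, pi_norm_le_iff_of_nonneg hK]
      exact fun i => hp n i x
    · rw [mem_closedBall_zero_iff, pi_norm_le_iff_of_nonneg hK']
      refine fun k => (pi_norm_le_iff_of_nonneg hK').2 fun i => hr1 k n i x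
  · refine Eventually.of_forall fun x => ?_
    refine D.tendsto_lag x (tendsto_pi_nhds.2 fun i => ?_)
      (tendsto_pi_nhds.2 fun k => tendsto_pi_nhds.2 fun i => ?_)
    · exact tendsto_ev hB (fun n => wt_pow_five_mul_le (h n i)) (hc i) x
    · simp only [pdv_ev (hr _ _), pdv_ev (hr' _)]
      exact tendsto_ev hB' (hdc k · i) (hdl k i) x

/-- Sequential compactness for uniformly rapidly decreasing coefficients. -/
theorem exists_subseq_tendsto_act {c : ℕ → Fin 3 → ℤ × ℤ → ℂ}
    (h : ∀ s : ℕ, ∃ B : ℝ≥0∞, B ≠ ∞ ∧ ∀ n i k, wt k ^ s * ‖c n i k‖ₑ ≤ B) :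
    ∃ (c' : Fin 3 → ℤ × ℤ → ℂ) (φ : ℕ → ℕ), StrictMono φ ∧ (∀ i, Rapid (c' i)) ∧
      (∀ i k, Tendsto (fun n => c (φ n) i k) atTop (𝓝 (c' i k))) ∧
      Tendsto (fun n => D.act fun i => ev (c (φ n) i)) atTop (𝓝 (D.act fun i => ev (c' i))) := by
  obtain ⟨B, hB, h0⟩ := h 0
  have hmem : ∀ n, c n ∈ Set.pi Set.univ fun _ : Fin 3 => Set.pi Set.univ fun _ : ℤ × ℤ =>
      Metric.closedBall (0 : ℂ) B.toReal := by
    intro n i _ k _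
    rw [mem_closedBall_zero_iff, ← toReal_enorm]
    exact ENNReal.toReal_mono hB (by simpa using h0 n i k)
  have hcpt : IsCompact (Set.pi Set.univ fun _ : Fin 3 => Set.pi Set.univ fun _ : ℤ × ℤ =>
      Metric.closedBall (0 : ℂ) B.toReal) :=
    isCompact_univ_pi fun _ => isCompact_univ_pi fun _ => isCompact_closedBall _ _
  obtain ⟨c', -, φ, hφ, hlim⟩ := hcpt.tendsto_subseq hmem
  have hl : ∀ i k, Tendsto (fun n => c (φ n) i k) atTop (𝓝 (c' i k)) := fun i k =>
    tendsto_pi_nhds.1 (tendsto_pi_nhds.1 hlim i) k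
  have hr : ∀ n i, Rapid (c n i) := fun n i => rapid_of_wt_pow_mul_le fun s => by
    obtain ⟨B, hB, hs⟩ := h s
    exact ⟨B, hB, hs n i⟩
  have hr' : ∀ i, Rapid (c' i) := fun i => rapid_of_wt_pow_mul_le fun s => by
    obtain ⟨B, hB, hs⟩ := h s
    refine ⟨B, hB, fun k => ?_⟩
    refine le_of_tendsto (ENNReal.Tendsto.const_mul (hl i k).enorm (Or.inr ?_))
      (Eventually.of_forall fun n => hs (φ n) i k)
    exact ENNReal.pow_ne_top (wt_ne_top k)
  obtain ⟨B7, hB7, h7⟩ := h 7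
  exact ⟨c', φ, hφ, hr', hl, D.tendsto_act hB7 (fun n => h7 (φ n)) (fun n => hr (φ n)) hr' hl⟩

end GLData

/-- `F s` depends polynomially on `s`, of degree at most four, with continuous coefficients, and
`c` is the linear coefficient. -/
def HasQuartic (F : ℝ → ℝ × ℝ → ℝ) (c : ℝ × ℝ → ℝ) : Prop :=
  Continuous c ∧ ∃ c0 c2 c3 c4 : ℝ × ℝ → ℝ,
    Continuous c0 ∧ Continuous c2 ∧ Continuous c3 ∧ Continuous c4 ∧
    ∀ s x, F s x = c0 x + s * c x + s ^ 2 * c2 x + s ^ 3 * c3 x + s ^ 4 * c4 x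

namespace HasQuartic

variable {F G : ℝ → ℝ × ℝ → ℝ} {c d : ℝ × ℝ → ℝ}

theorem add (hF : HasQuartic F c) (hG : HasQuartic G d) :
    HasQuartic (fun s x => F s x + G s x) (fun x => c x + d x) := by
  obtain ⟨h1, c0, c2, c3, c4, h0, h2, h3, h4, h⟩ := hF
  obtain ⟨k1, d0, d2, d3, d4, k0, k2, k3, k4, k⟩ := hG
  refine ⟨h1.add k1, _, _, _, _, h0.add k0, h2.add k2, h3.add k3, h4.add k4, fun s x => ?_⟩
  simp only [h, k, Pi.add_apply]
  ring

theorem const_mul (a : ℝ) (hF : HasQuartic F c) :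
    HasQuartic (fun s x => a * F s x) (fun x => a * c x) := by
  obtain ⟨h1, c0, c2, c3, c4, h0, h2, h3, h4, h⟩ := hF
  refine ⟨h1.const_mul a, _, _, _, _, h0.const_mul a, h2.const_mul a, h3.const_mul a,
    h4.const_mul a, fun s x => ?_⟩
  simp only [h]
  ring

theorem congr (hF : HasQuartic F c) (h : ∀ s x, G s x = F s x) (h' : ∀ x, d x = c x) :
    HasQuartic G d := by
  rwa [show G = F from funext fun s => funext (h s), show d = c from funext h']

theorem sum {ι : Type*} (t : Finset ι) {F : ι → ℝ → ℝ × ℝ → ℝ} {c : ι → ℝ × ℝ → ℝ}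
    (h : ∀ i, HasQuartic (F i) (c i)) :
    HasQuartic (fun s x => ∑ i ∈ t, F i s x) (fun x => ∑ i ∈ t, c i x) := by
  classical
  induction t using Finset.induction_on with
  | empty =>
    exact ⟨by simpa using continuous_const, fun _ => 0, fun _ => 0, fun _ => 0, fun _ => 0,
      by fun_prop, by fun_prop, by fun_prop, by fun_prop, by simp⟩
  | insert a t ha ih =>
    simp only [Finset.sum_insert ha]
    exact (h a).add ih

theorem affine {a b : ℝ × ℝ → ℝ} (ha : Continuous a) (hb : Continuous b) :
    HasQuartic (fun s x => a x + s * b x) b :=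
  ⟨hb, a, fun _ => 0, fun _ => 0, fun _ => 0, ha, by fun_prop, by fun_prop, by fun_prop,
    by simp⟩

theorem sq {a b e : ℝ × ℝ → ℝ} (ha : Continuous a) (hb : Continuous b) (he : Continuous e) :
    HasQuartic (fun s x => (a x + s * b x + s ^ 2 * e x) ^ 2) (fun x => 2 * (a x * b x)) :=
  ⟨by fun_prop, fun x => a x ^ 2, fun x => b x ^ 2 + 2 * (a x * e x), fun x => 2 * (b x * e x),
    fun x => e x ^ 2, by fun_prop, by fun_prop, by fun_prop, by fun_prop, fun s x => by ring⟩

theorem normSq {X Y Z : ℝ × ℝ → ℂ} (hX : Continuous X) (hY : Continuous Y) (hZ : Continuous Z) :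
    HasQuartic (fun s x => ‖X x + s * Y x + (s : ℂ) ^ 2 * Z x‖ ^ 2)
      (fun x => 2 * (X x * (starRingEnd ℂ) (Y x)).re) := by
  have hre := Complex.continuous_re
  have him := Complex.continuous_im
  have h1 := sq (hre.comp hX) (hre.comp hY) (hre.comp hZ)
  have h2 := sq (him.comp hX) (him.comp hY) (him.comp hZ)
  refine (h1.add h2).congr (fun s x => ?_) fun x => ?_
  · rw [← Complex.normSq_eq_norm_sq, Complex.normSq_apply]
    simp [← ofReal_pow]
    ring
  · simp
    ring

theorem mul_conj {W X Y X' Y' : ℝ × ℝ → ℂ} (hW : Continuous W) (hX : Continuous X)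
    (hY : Continuous Y) (hX' : Continuous X') (hY' : Continuous Y') :
    HasQuartic (fun s x => (W x * (starRingEnd ℂ) (X x + s * Y x) * (X' x + s * Y' x)).re)
      (fun x => (W x * ((starRingEnd ℂ) (X x) * Y' x + (starRingEnd ℂ) (Y x) * X' x)).re) := by
  have hre := Complex.continuous_re
  have hconj := Complex.continuous_conj
  refine ⟨by fun_prop, fun x => (W x * (starRingEnd ℂ) (X x) * X' x).re,
    fun x => (W x * (starRingEnd ℂ) (Y x) * Y' x).re, fun _ => 0, fun _ => 0, by fun_prop,
    by fun_prop, by fun_prop, by fun_prop, fun s x => ?_⟩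
  simp
  ring

theorem setIntegral_eq_zero (h : HasQuartic F c)
    (hmin : ∀ s, ∫ x in unitSquare, F 0 x ≤ ∫ x in unitSquare, F s x) :
    ∫ x in unitSquare, c x = 0 := by
  obtain ⟨h1, c0, c2, c3, c4, h0, h2, h3, h4, h⟩ := h
  have i0 := integrableOn_unitSquare h0
  have i1 := integrableOn_unitSquare h1
  have i2 := integrableOn_unitSquare h2
  have i3 := integrableOn_unitSquare h3
  have i4 := integrableOn_unitSquare h4
  have key : ∀ s, ∫ x in unitSquare, F s x = (∫ x in unitSquare, c0 x) +
      s * (∫ x in unitSquare, c x) + s ^ 2 * (∫ x in unitSquare, c2 x) +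
      s ^ 3 * (∫ x in unitSquare, c3 x) + s ^ 4 * (∫ x in unitSquare, c4 x) := by
    intro s
    simp only [h, ← integral_const_mul]
    rw [integral_add, integral_add, integral_add, integral_add]
    all_goals first
      | exact i0
      | exact i1.const_mul _
      | exact i2.const_mul _
      | exact i3.const_mul _
      | exact i4.const_mul _
      | exact i0.add (i1.const_mul _)
      | exact (i0.add (i1.const_mul _)).add (i2.const_mul _)
      | exact ((i0.add (i1.const_mul _)).add (i2.const_mul _)).add (i3.const_mul _)
  have hd : HasDerivAt (fun s => ∫ x in unitSquare, F s x) (∫ x in unitSquare, c x) 0 := by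
    rw [funext key]
    have e0 := (hasDerivAt_id (0 : ℝ)).mul_const (∫ x in unitSquare, c x)
    have e2 := (hasDerivAt_pow 2 (0 : ℝ)).mul_const (∫ x in unitSquare, c2 x)
    have e3 := (hasDerivAt_pow 3 (0 : ℝ)).mul_const (∫ x in unitSquare, c3 x)
    have e4 := (hasDerivAt_pow 4 (0 : ℝ)).mul_const (∫ x in unitSquare, c4 x)
    refine ((((e0.const_add (∫ x in unitSquare, c0 x)).add e2).add e3).add e4).congr_deriv ?_
    simp
  exact IsLocalMin.hasDerivAt_eq_zero (Filter.Eventually.of_forall hmin) hd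

end HasQuartic

namespace GLData

variable (D : GLData)

/-- The derivative of the Lagrangian with respect to the derivatives of the fields. -/
def mom (x : ℝ × ℝ) (p : Fin 3 → ℂ) (r : Fin 2 → Fin 3 → ℂ) (k : Fin 2) : Fin 3 → ℂ :=
  Fin.cons (r k 0) fun i => r k i.succ + D.low x p k i

/-- The derivative of the Lagrangian with respect to the values of the fields. -/
def frc (x : ℝ × ℝ) (p : Fin 3 → ℂ) (r : Fin 2 → Fin 3 → ℂ) : Fin 3 → ℂ :=
  Fin.cons (D.q x + ∑ i : Fin 2, (((D.mom x p r 0 i.succ * (starRingEnd ℂ) (I * p i.succ)).re : ℂ)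
      + I * (D.mom x p r 1 i.succ * (starRingEnd ℂ) (I * p i.succ)).re))
    fun i => ∑ k, (∑ j : Fin 2, D.mom x p r k j.succ * (starRingEnd ℂ) (D.A k j i x) -
      I * (coord k (p 0) : ℂ) * D.mom x p r k i.succ) -
      D.α * ∑ j : Fin 2, D.P i j x * p j.succ +
      D.β * (∑ j : Fin 2, p j.succ * (starRingEnd ℂ) (p j.succ)) * p i.succ

/-- The linear part of the variation of the Lagrangian. -/
def dlag (x : ℝ × ℝ) (p : Fin 3 → ℂ) (r : Fin 2 → Fin 3 → ℂ) (π : Fin 3 → ℂ)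
    (ρ : Fin 2 → Fin 3 → ℂ) : ℝ :=
  2 * (∑ k, ∑ i, D.mom x p r k i * (starRingEnd ℂ) (ρ k i) +
    ∑ i, D.frc x p r i * (starRingEnd ℂ) (π i)).re

/-- The linear part of the variation of `low`. -/
def dlow (x : ℝ × ℝ) (p π : Fin 3 → ℂ) (k i : Fin 2) : ℂ :=
  ∑ j, D.A k i j x * π j.succ + I * (coord k (p 0) : ℂ) * π i.succ +
    I * (coord k (π 0) : ℂ) * p i.succ

theorem coord_add_mul (k : Fin 2) (s : ℝ) (z w : ℂ) :
    coord k (z + s * w) = coord k z + s * coord k w := by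
  fin_cases k <;> simp

theorem low_add (x : ℝ × ℝ) (p π : Fin 3 → ℂ) (s : ℝ) (k i : Fin 2) :
    D.low x (fun i => p i + s * π i) k i = D.low x p k i + s * D.dlow x p π k i +
      (s : ℂ) ^ 2 * (I * (coord k (π 0) : ℂ) * π i.succ) := by
  simp only [low, dlow, coord_add_mul, Fin.sum_univ_two]
  push_cast
  ring

theorem dlag_eq (x : ℝ × ℝ) (p : Fin 3 → ℂ) (r : Fin 2 → Fin 3 → ℂ) (π : Fin 3 → ℂ)
    (ρ : Fin 2 → Fin 3 → ℂ) : D.dlag x p r π ρ =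
    ∑ k, 2 * (r k 0 * (starRingEnd ℂ) (ρ k 0)).re + 2 * (D.q x * (starRingEnd ℂ) (π 0)).re +
    ∑ k, ∑ i : Fin 2, 2 * ((r k i.succ + D.low x p k i) *
      (starRingEnd ℂ) (ρ k i.succ + D.dlow x p π k i)).re +
    (-D.α) * ∑ i : Fin 2, ∑ j : Fin 2, (D.P i j x * ((starRingEnd ℂ) (p i.succ) * π j.succ +
      (starRingEnd ℂ) (π i.succ) * p j.succ)).re +
    D.β / 2 * (2 * ((∑ i : Fin 2, ‖p i.succ‖ ^ 2) *
      ∑ i : Fin 2, 2 * (p i.succ * (starRingEnd ℂ) (π i.succ)).re)) := by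
  have hP : (∑ i : Fin 2, ∑ j : Fin 2, D.P i j x * ((starRingEnd ℂ) (p i.succ) * π j.succ)).re =
      (∑ i : Fin 2, ∑ j : Fin 2, D.P i j x * ((starRingEnd ℂ) (π i.succ) * p j.succ)).re := by
    rw [← Complex.conj_re]
    simp only [map_sum, map_mul, D.P_conj, Complex.conj_conj]
    rw [Finset.sum_comm]
    simp only [mul_comm]
  have hn : ∀ z : ℂ, ‖z‖ ^ 2 = z.re * z.re + z.im * z.im := fun z => by
    rw [← Complex.normSq_eq_norm_sq, Complex.normSq_apply]
  simp only [mul_add, Complex.add_re, Finset.sum_add_distrib, ← Complex.re_sum] at hP ⊢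
  rw [hP]
  simp only [dlag, frc, mom, dlow, Fin.sum_univ_succ, Fin.cons_zero, Fin.cons_succ, hn]
  generalize D.low x p = l
  simp
  ring

theorem hasQuartic_lag {p π : ℝ × ℝ → Fin 3 → ℂ} {r ρ : ℝ × ℝ → Fin 2 → Fin 3 → ℂ}
    (hp : Continuous p) (hπ : Continuous π) (hr : Continuous r) (hρ : Continuous ρ) :
    HasQuartic (fun s x => D.lag x (fun i => p x i + s * π x i)
      (fun k i => r x k i + s * ρ x k i)) (fun x => D.dlag x (p x) (r x) (π x) (ρ x)) := by
  have hq := D.smooth_q.cont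
  have hA : ∀ k i j, Continuous (D.A k i j) := fun k i j => (D.smooth_A k i j).cont
  have hP : ∀ i j, Continuous (D.P i j) := fun i j => (D.smooth_P i j).cont
  have hl : ∀ k i, Continuous fun x => D.low x (p x) k i := fun k i =>
    (D.continuous_low k i).comp (f := fun x => (x, p x)) (by fun_prop)
  have hcoord := continuous_coord
  have hdl : ∀ k i, Continuous fun x => D.dlow x (p x) (π x) k i := fun k i => by
    have := hcoord k
    unfold dlow
    fun_prop
  have hre := Complex.continuous_re
  have hconj := Complex.continuous_conj
  have t1 := HasQuartic.sum Finset.univ fun k : Fin 2 => HasQuartic.normSq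
    (X := fun x => r x k 0) (Y := fun x => ρ x k 0) (Z := fun _ => 0) (by fun_prop) (by fun_prop)
    (by fun_prop)
  have t2 := HasQuartic.affine (a := fun x => 2 * (D.q x * (starRingEnd ℂ) (p x 0)).re)
    (b := fun x => 2 * (D.q x * (starRingEnd ℂ) (π x 0)).re) (by fun_prop) (by fun_prop)
  have t3 := HasQuartic.sum Finset.univ fun k : Fin 2 => HasQuartic.sum Finset.univ
    fun i : Fin 2 => HasQuartic.normSq
    (X := fun x => r x k i.succ + D.low x (p x) k i)
    (Y := fun x => ρ x k i.succ + D.dlow x (p x) (π x) k i)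
    (Z := fun x => I * (coord k (π x 0) : ℂ) * π x i.succ) (by fun_prop) (by fun_prop)
    (by have := hcoord k; fun_prop)
  have t4 := (HasQuartic.sum Finset.univ fun i : Fin 2 => HasQuartic.sum Finset.univ
    fun j : Fin 2 => HasQuartic.mul_conj (W := D.P i j) (X := fun x => p x i.succ)
    (Y := fun x => π x i.succ) (X' := fun x => p x j.succ) (Y' := fun x => π x j.succ)
    (by fun_prop) (by fun_prop) (by fun_prop) (by fun_prop) (by fun_prop)).const_mul (-D.α)
  have t5 := (HasQuartic.sq (a := fun x => ∑ i : Fin 2, ‖p x i.succ‖ ^ 2)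
    (b := fun x => ∑ i : Fin 2, 2 * (p x i.succ * (starRingEnd ℂ) (π x i.succ)).re)
    (e := fun x => ∑ i : Fin 2, ‖π x i.succ‖ ^ 2) (by fun_prop) (by fun_prop)
    (by fun_prop)).const_mul (D.β / 2)
  refine ((((t1.add t2).add t3).add t4).add t5).congr (fun s x => ?_) fun x => ?_
  · have hn : ∀ z w : ℂ, ‖z + s * w‖ ^ 2 = ‖z‖ ^ 2 + s * (2 * (z * (starRingEnd ℂ) w).re) +
        s ^ 2 * ‖w‖ ^ 2 := by
      intro z w
      simp only [← Complex.normSq_eq_norm_sq, Complex.normSq_apply]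
      simp
      ring
    rw [lag]
    simp only [low_add, mul_zero, add_zero, Complex.re_sum]
    congr 1
    · rw [sub_eq_add_neg, neg_mul]
      congr 2
      congr 1
      · rw [map_add, map_mul, Complex.conj_ofReal]
        simp
        ring
      · refine Finset.sum_congr rfl fun k _ => Finset.sum_congr rfl fun i _ => ?_
        congr 2
        ring
    · congr 2
      simp only [hn, Finset.sum_add_distrib, Finset.mul_sum]
  · rw [dlag_eq]

theorem setIntegral_dlag_eq_zero {v η : Fin 3 → ℝ × ℝ → ℂ} (hv : ∀ i, SmoothPer (v i))
    (hη : ∀ i, SmoothPer (η i))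
    (hmin : ∀ s : ℝ, D.act v ≤ D.act fun i x => v i x + s * η i x) :
    ∫ x in unitSquare, D.dlag x (fun i => v i x) (fun k i => pdv k (v i) x) (fun i => η i x)
      (fun k i => pdv k (η i) x) = 0 := by
  have h1 : ∀ i, Continuous (v i) := fun i => (hv i).cont
  have h2 : ∀ i, Continuous (η i) := fun i => (hη i).cont
  have h3 : ∀ k i, Continuous (pdv k (v i)) := fun k i => ((hv i).pdv k).cont
  have h4 : ∀ k i, Continuous (pdv k (η i)) := fun k i => ((hη i).pdv k).cont
  have h := D.hasQuartic_lag (p := fun x i => v i x) (π := fun x i => η i x)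
    (r := fun x k i => pdv k (v i) x) (ρ := fun x k i => pdv k (η i) x) (by fun_prop)
    (by fun_prop) (by fun_prop) (by fun_prop)
  refine h.setIntegral_eq_zero fun s => ?_
  have e : ∀ s : ℝ, ∫ x in unitSquare, D.lag x (fun i => v i x + s * η i x)
      (fun k i => pdv k (v i) x + s * pdv k (η i) x) = D.act fun i x => v i x + s * η i x := by
    intro s
    rw [act]
    congr 1
    funext x
    congr 1
    funext k i
    have hc := SmoothPer.const (s : ℂ)
    fin_cases k
    · simp [pd1_add (hv i).diff (hc.mul (hη i)).diff, pd1_mul hc.diff (hη i).diff, pd1_const]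
    · simp [pd2_add (hv i).diff (hc.mul (hη i)).diff, pd2_mul hc.diff (hη i).diff, pd2_const]
  rw [e, e]
  simpa using hmin s

end GLData

/-- `Maj f h`: the Fourier coefficients of the smooth periodic function `f` are dominated by
`h`. -/
structure Maj (f : ℝ × ℝ → ℂ) (h : ℤ × ℤ → ℝ≥0∞) : Prop where
  smooth : SmoothPer f
  le : ∀ k, ‖fc f k‖ₑ ≤ h k

theorem conv_const_mul_left (c : ℝ≥0∞) (f g : ℤ × ℤ → ℝ≥0∞) (k : ℤ × ℤ) :
    conv (fun l => c * f l) g k = c * conv f g k := by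
  simp only [conv, mul_assoc, ENNReal.tsum_mul_left]

theorem conv_const_mul_right (c : ℝ≥0∞) (f g : ℤ × ℤ → ℝ≥0∞) (k : ℤ × ℤ) :
    conv f (fun l => c * g l) k = c * conv f g k := by
  rw [conv_comm, conv_const_mul_left, conv_comm]

theorem le_conv {f g : ℤ × ℤ → ℝ≥0∞} (hg : 1 ≤ g 0) (k : ℤ × ℤ) : f k ≤ conv f g k :=
  calc f k = f k * 1 := (mul_one _).symm
    _ ≤ f k * g (k - k) := by rw [sub_self]; gcongr
    _ ≤ _ := ENNReal.le_tsum (f := fun l => f l * g (k - l)) k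

theorem conv_neg {f g : ℤ × ℤ → ℝ≥0∞} (hf : ∀ k, f (-k) = f k) (hg : ∀ k, g (-k) = g k)
    (k : ℤ × ℤ) : conv f g (-k) = conv f g k := by
  unfold conv
  rw [← (Equiv.neg (ℤ × ℤ)).tsum_eq]
  refine tsum_congr fun l => ?_
  rw [Equiv.neg_apply, hf, neg_sub_neg, ← neg_sub k l, hg]

theorem quadMaj_neg {H : ℤ × ℤ → ℝ≥0∞} (hH : ∀ k, H (-k) = H k) (k : ℤ × ℤ) :
    quadMaj H (-k) = quadMaj H k := by
  rw [quadMaj, quadMaj, wt_neg, hH, conv_neg hH hH]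

theorem le_quadMaj (H : ℤ × ℤ → ℝ≥0∞) (k : ℤ × ℤ) : H k ≤ quadMaj H k :=
  calc H k = 1 ^ 2 * H k := by ring
    _ ≤ wt k ^ 2 * H k := by gcongr; exact one_le_wt k
    _ ≤ _ := le_self_add

theorem wt_sq_mul_conv_le (H : ℤ × ℤ → ℝ≥0∞) (k : ℤ × ℤ) :
    wt k ^ 2 * conv H H k ≤ 2 * conv (quadMaj H) H k :=
  calc wt k ^ 2 * conv H H k = ∑' l, wt k ^ 2 * (H l * H (k - l)) := by
        rw [conv, ENNReal.tsum_mul_left]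
    _ ≤ ∑' l, ((wt l ^ 2 * H l) * H (k - l) + H l * (wt (k - l) ^ 2 * H (k - l))) := by
        refine ENNReal.tsum_le_tsum fun l => ?_
        have h := wt_sq_add_le l (k - l)
        rw [add_sub_cancel] at h
        calc _ ≤ (wt l ^ 2 + wt (k - l) ^ 2) * (H l * H (k - l)) := by gcongr
          _ = _ := by ring
    _ = conv (fun l => wt l ^ 2 * H l) H k + conv H (fun l => wt l ^ 2 * H l) k :=
        ENNReal.tsum_add
    _ = 2 * conv (fun l => wt l ^ 2 * H l) H k := by rw [conv_comm H, two_mul]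
    _ ≤ 2 * conv (quadMaj H) H k := by
        gcongr
        exact conv_mono (fun _ => le_self_add) le_rfl k

namespace Maj

variable {f g : ℝ × ℝ → ℂ} {h h' : ℤ × ℤ → ℝ≥0∞}

theorem mono (hf : Maj f h) (hh : ∀ k, h k ≤ h' k) : Maj f h' :=
  ⟨hf.smooth, fun k => (hf.le k).trans (hh k)⟩

theorem add (hf : Maj f h) (hg : Maj g h') : Maj (fun x => f x + g x) fun k => h k + h' k :=
  ⟨hf.smooth.add hg.smooth, fun k => by
    rw [fc_add hf.smooth.cont hg.smooth.cont]
    exact (enorm_add_le _ _).trans (add_le_add (hf.le k) (hg.le k))⟩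

theorem sub (hf : Maj f h) (hg : Maj g h') : Maj (fun x => f x - g x) fun k => h k + h' k :=
  ⟨hf.smooth.sub hg.smooth, fun k => by
    rw [fc_sub hf.smooth.cont hg.smooth.cont]
    exact enorm_sub_le.trans (add_le_add (hf.le k) (hg.le k))⟩

theorem mul (hf : Maj f h) (hg : Maj g h') : Maj (fun x => f x * g x) (conv h h') :=
  ⟨hf.smooth.mul hg.smooth, fun k =>
    (enorm_fc_mul_le hf.smooth hg.smooth.cont k).trans (conv_mono hf.le hg.le k)⟩

theorem const_mul (c : ℂ) (hf : Maj f h) : Maj (fun x => c * f x) fun k => ‖c‖ₑ * h k :=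
  ⟨(SmoothPer.const c).mul hf.smooth, fun k => by
    rw [fc_const_mul, enorm_mul]
    exact mul_le_mul_right (hf.le k) _⟩

theorem I_mul (hf : Maj f h) : Maj (fun x => I * f x) h := by
  refine (hf.const_mul I).mono fun k => ?_
  rw [← ofReal_norm, Complex.norm_I, ENNReal.ofReal_one, one_mul]

theorem conj (hh : ∀ k, h (-k) = h k) (hf : Maj f h) :
    Maj (fun x => (starRingEnd ℂ) (f x)) h :=
  ⟨hf.smooth.conj, fun k => by
    rw [fc_conj, RCLike.enorm_conj, ← hh]
    exact hf.le _⟩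

theorem enorm_half_le : ‖(1 / 2 : ℂ)‖ₑ ≤ 1 := by
  rw [← ofReal_norm]
  norm_num

theorem coord (hh : ∀ k, h (-k) = h k) (hf : Maj f h) (k : Fin 2) :
    Maj (fun x => (coord k (f x) : ℂ)) fun l => 2 * h l := by
  have key : ∀ l, ‖(1 / 2 : ℂ)‖ₑ * (h l + h l) ≤ 2 * h l := fun l =>
    calc _ ≤ 1 * (h l + h l) := by gcongr; exact enorm_half_le
      _ = _ := by ring
  fin_cases k
  · have := ((hf.add (hf.conj hh)).const_mul (1 / 2)).mono key
    convert this using 2 with x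
    simp [Complex.add_conj]
  · have := ((hf.sub (hf.conj hh)).const_mul (1 / 2)).I_mul.I_mul.I_mul.mono key
    convert this using 2 with x
    simp [Complex.sub_conj]
    linear_combination ((f x).im : ℂ) * (1 - I ^ 2) * Complex.I_sq

theorem pdv (hf : Maj f h) (k : Fin 2) :
    Maj (pdv k f) fun l => ‖(2 * Real.pi * I : ℂ)‖ₑ * (wt l ^ 2 * h l) := by
  refine ⟨hf.smooth.pdv k, fun l => ?_⟩
  have key : ‖(2 * Real.pi * I : ℂ)‖ₑ * (wt l ^ 2 * ‖fc f l‖ₑ) ≤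
      ‖(2 * Real.pi * I : ℂ)‖ₑ * (wt l ^ 2 * h l) := by
    gcongr
    exact hf.le l
  fin_cases k
  · rw [Fin.zero_eta, pdv_zero, fc_pd1 hf.smooth]
    exact (enorm_dc1_le _ l).trans key
  · rw [Fin.mk_one, pdv_one, fc_pd2 hf.smooth]
    exact (enorm_dc2_le _ l).trans key

end Maj

/-- The Fourier symbol of `pdv k`. -/
def sym (k : Fin 2) (κ : ℤ × ℤ) : ℂ := ![2 * Real.pi * I * κ.1, 2 * Real.pi * I * κ.2] k

theorem conj_sym (k : Fin 2) (κ : ℤ × ℤ) : (starRingEnd ℂ) (sym k κ) = -sym k κ := by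
  fin_cases k <;> simp [sym, Complex.conj_ofNat]

theorem pdv_fe (k : Fin 2) (κ : ℤ × ℤ) (x : ℝ × ℝ) : pdv k (fe κ) x = sym k κ * fe κ x := by
  fin_cases k
  · exact pd1_fe κ x
  · exact pd2_fe κ x

theorem fc_pdv {f : ℝ × ℝ → ℂ} (hf : SmoothPer f) (k : Fin 2) (κ : ℤ × ℤ) :
    fc (pdv k f) κ = sym k κ * fc f κ := by
  fin_cases k
  · exact fc_pd1 hf κ
  · exact fc_pd2 hf κ

theorem enorm_sym_le (k : Fin 2) (κ : ℤ × ℤ) :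
    ‖sym k κ‖ₑ ≤ ‖(2 * Real.pi * I : ℂ)‖ₑ * wt κ ^ 2 := by
  fin_cases k <;> simp only [sym, Fin.zero_eta, Fin.mk_one, Matrix.cons_val_zero,
    Matrix.cons_val_one, enorm_mul _ (Int.cast _ : ℂ)]
  · exact mul_le_mul_right (enorm_intCast_le_wt_sq κ).1 _
  · exact mul_le_mul_right (enorm_intCast_le_wt_sq κ).2 _

theorem pdv_const_mul (k : Fin 2) (z : ℂ) {f : ℝ × ℝ → ℂ} (hf : SmoothPer f) (x : ℝ × ℝ) :
    pdv k (fun x => z * f x) x = z * pdv k f x := by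
  fin_cases k
  · simp [pd1_mul (SmoothPer.const z).diff hf.diff, pd1_const]
  · simp [pd2_mul (SmoothPer.const z).diff hf.diff, pd2_const]

theorem wt_pow_four_le_enorm_sum_sym {κ : ℤ × ℤ} (hκ : κ ≠ 0) :
    wt κ ^ 4 ≤ ‖∑ k, sym k κ * sym k κ‖ₑ := by
  have e : ∑ k, sym k κ * sym k κ =
      ((-(4 * Real.pi ^ 2 * ((κ.1 : ℝ) ^ 2 + (κ.2 : ℝ) ^ 2)) : ℝ) : ℂ) := by
    simp only [sym, Fin.sum_univ_two, Matrix.cons_val_zero, Matrix.cons_val_one]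
    push_cast
    linear_combination 4 * (Real.pi : ℂ) ^ 2 * ((κ.1 : ℂ) ^ 2 + (κ.2 : ℂ) ^ 2) * Complex.I_sq
  rw [e, ← ofReal_norm, Complex.norm_real, Real.norm_eq_abs, abs_neg,
    abs_of_nonneg (by positivity), show wt κ ^ 4 = (wt κ ^ 2) ^ 2 by ring, wt_sq,
    ← ENNReal.ofReal_pow (by positivity)]
  refine ENNReal.ofReal_le_ofReal ?_
  have h1 : (1 : ℝ) ≤ (κ.1 : ℝ) ^ 2 + (κ.2 : ℝ) ^ 2 := by
    have : 1 ≤ κ.1 ^ 2 + κ.2 ^ 2 := by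
      by_contra! h
      have h1 : κ.1 = 0 := by nlinarith [sq_nonneg κ.1, sq_nonneg κ.2]
      have h2 : κ.2 = 0 := by nlinarith [sq_nonneg κ.1, sq_nonneg κ.2]
      exact hκ (Prod.ext h1 h2)
    exact_mod_cast this
  have hpi : (9 : ℝ) ≤ Real.pi ^ 2 := by nlinarith [Real.pi_gt_three]
  have h2 : 36 * ((κ.1 : ℝ) ^ 2 + (κ.2 : ℝ) ^ 2) ≤
      4 * Real.pi ^ 2 * ((κ.1 : ℝ) ^ 2 + (κ.2 : ℝ) ^ 2) := by
    gcongr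
    linarith
  have a1 := sq_abs (κ.1 : ℝ)
  have a2 := sq_abs (κ.2 : ℝ)
  nlinarith [sq_nonneg (1 - |(κ.1 : ℝ)|), sq_nonneg (1 - |(κ.2 : ℝ)|),
    sq_nonneg (|(κ.1 : ℝ)| - |(κ.2 : ℝ)|)]

namespace GLData

variable (D : GLData)

/-- The momenta of the field configuration `v`. -/
def momF (v : Fin 3 → ℝ × ℝ → ℂ) (k : Fin 2) (i : Fin 3) (x : ℝ × ℝ) : ℂ :=
  D.mom x (fun i => v i x) (fun k i => pdv k (v i) x) k i

/-- The forces of the field configuration `v`. -/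
def frcF (v : Fin 3 → ℝ × ℝ → ℂ) (i : Fin 3) (x : ℝ × ℝ) : ℂ :=
  D.frc x (fun i => v i x) (fun k i => pdv k (v i) x) i

/-- The Euler-Lagrange equation of component `j` at frequency `κ`. -/
def IsCritical (v : Fin 3 → ℝ × ℝ → ℂ) (j : Fin 3) (κ : ℤ × ℤ) : Prop :=
  ∑ k, sym k κ * fc (D.momF v k j) κ = fc (D.frcF v j) κ

section Majorants

variable {v : Fin 3 → ℝ × ℝ → ℂ} {H : ℤ × ℤ → ℝ≥0∞}

/-- `H` is an even majorant of the fields and of the coefficients. -/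
structure IsMajorant (v : Fin 3 → ℝ × ℝ → ℂ) (H : ℤ × ℤ → ℝ≥0∞) : Prop where
  even : ∀ k, H (-k) = H k
  one_le : 1 ≤ H 0
  v : ∀ i, Maj (v i) H
  q : Maj D.q H
  A : ∀ k i j, Maj (D.A k i j) H
  P : ∀ i j, Maj (D.P i j) H

variable {D}

theorem IsMajorant.low (h : D.IsMajorant v H) (k i : Fin 2) :
    Maj (fun x => D.low x (fun i => v i x) k i) fun l => 4 * conv H H l := by
  simp only [GLData.low, Fin.sum_univ_two]
  refine ((((h.A k i 0).mul (h.v _)).add ((h.A k i 1).mul (h.v _))).add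
    ((((h.v 0).coord h.even k).I_mul).mul (h.v _))).mono fun l => ?_
  rw [conv_const_mul_left]
  exact le_of_eq (by ring)

/-- The constant in the majorant of the momenta. -/
def momConst : ℝ≥0∞ := ‖(2 * Real.pi * I : ℂ)‖ₑ + 4

theorem IsMajorant.momF (h : D.IsMajorant v H) (k : Fin 2) (i : Fin 3) :
    Maj (D.momF v k i) fun l => momConst * quadMaj H l := by
  unfold GLData.momF mom momConst
  refine Fin.cases ?_ (fun i => ?_) i
  · simp only [Fin.cons_zero]
    refine ((h.v 0).pdv k).mono fun l => ?_
    gcongr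
    · exact le_self_add
    · exact le_self_add
  · simp only [Fin.cons_succ]
    refine (((h.v _).pdv k).add (h.low k i)).mono fun l => ?_
    rw [quadMaj, mul_add]
    gcongr
    · exact le_self_add
    · exact le_add_self

variable (D) in
/-- The constant in the majorant of the forces. -/
def frcConst : ℝ≥0∞ := 1 + 8 * momConst + 2 * ‖(D.α : ℂ)‖ₑ + 2 * ‖(D.β : ℂ)‖ₑ

theorem IsMajorant.frcF (h : D.IsMajorant v H) (i : Fin 3) :
    Maj (D.frcF v i) fun l => D.frcConst * conv (quadMaj H) H l := by
  have hQ : ∀ l, momConst * quadMaj H (-l) = momConst * quadMaj H l := fun l => by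
    rw [quadMaj_neg h.even]
  have hm := h.momF
  unfold GLData.momF at hm
  unfold GLData.frcF frc frcConst
  refine Fin.cases ?_ (fun i => ?_) i
  · simp only [Fin.cons_zero, Fin.sum_univ_two]
    have hK : ∀ l, conv (fun l => momConst * quadMaj H l) H (-l) =
        conv (fun l => momConst * quadMaj H l) H l := conv_neg hQ h.even
    have t : ∀ (i : Fin 2) (k : Fin 2), Maj (fun x => ((D.mom x (fun i => v i x)
        (fun k i => pdv k (v i) x) k i.succ * (starRingEnd ℂ) (I * v i.succ x)).re : ℂ))
        fun l => 2 * conv (fun l => momConst * quadMaj H l) H l := fun i k =>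
      ((hm k i.succ).mul ((h.v i.succ).I_mul.conj h.even)).coord hK 0
    refine (h.q.add (((t 0 0).add (t 0 1).I_mul).add ((t 1 0).add (t 1 1).I_mul))).mono
      fun l => ?_
    rw [conv_const_mul_left]
    have h1 : H l ≤ conv (quadMaj H) H l := (le_quadMaj H l).trans (le_conv h.one_le l)
    calc _ ≤ conv (quadMaj H) H l + 8 * (momConst * conv (quadMaj H) H l) := by
          refine add_le_add h1 (le_of_eq (by ring))
      _ = (1 + 8 * momConst) * conv (quadMaj H) H l := by ring
      _ ≤ _ := by
          rw [add_assoc (1 + 8 * momConst)]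
          exact mul_le_mul_left le_self_add _
  · simp only [Fin.cons_succ, Fin.sum_univ_two]
    have c : ∀ j k : Fin 2, Maj (fun x => I * (coord k (v 0 x) : ℂ) * D.mom x (fun i => v i x)
        (fun k i => pdv k (v i) x) k j.succ) _ := fun j k =>
      ((h.v 0).coord h.even k).I_mul.mul (hm k j.succ)
    have a : ∀ k j : Fin 2, Maj (fun x => D.mom x (fun i => v i x)
        (fun k i => pdv k (v i) x) k j.succ * (starRingEnd ℂ) (D.A k j i x)) _ := fun k j =>
      (hm k j.succ).mul ((h.A k j i).conj h.even)
    have p : ∀ j : Fin 2, Maj (fun x => D.P i j x * v j.succ x) _ := fun j =>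
      (h.P i j).mul (h.v j.succ)
    have n : ∀ j : Fin 2, Maj (fun x => v j.succ x * (starRingEnd ℂ) (v j.succ x)) _ := fun j =>
      (h.v j.succ).mul ((h.v j.succ).conj h.even)
    refine ((((((a 0 0).add (a 0 1)).sub (c i 0)).add (((a 1 0).add (a 1 1)).sub (c i 1))).sub
      (((p 0).add (p 1)).const_mul D.α)).add ((((n 0).add (n 1)).const_mul D.β).mul
      (h.v i.succ))).mono fun l => ?_
    have h2 : conv H H l ≤ conv (quadMaj H) H l := conv_mono (le_quadMaj H) le_rfl l
    have h3 : conv (fun l => ‖(D.β : ℂ)‖ₑ * (conv H H l + conv H H l)) H l ≤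
        2 * ‖(D.β : ℂ)‖ₑ * conv (quadMaj H) H l := by
      rw [conv_const_mul_left, mul_comm 2, mul_assoc]
      gcongr
      rw [← conv_const_mul_left]
      refine conv_mono (fun k => ?_) le_rfl l
      rw [← two_mul]
      gcongr
      exact le_add_self
    have h4 : conv (fun l => 2 * H l) (fun l => momConst * quadMaj H l) l =
        2 * (momConst * conv (quadMaj H) H l) := by
      rw [conv_const_mul_left, conv_const_mul_right, conv_comm]
    simp only [h4, conv_const_mul_left _ (quadMaj H)]
    calc _ ≤ 8 * momConst * conv (quadMaj H) H l + ‖(D.α : ℂ)‖ₑ *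
            (conv (quadMaj H) H l + conv (quadMaj H) H l) +
            2 * ‖(D.β : ℂ)‖ₑ * conv (quadMaj H) H l := by
          gcongr
          exact le_of_eq (by ring)
      _ = (8 * momConst + 2 * ‖(D.α : ℂ)‖ₑ + 2 * ‖(D.β : ℂ)‖ₑ) * conv (quadMaj H) H l := by ring
      _ ≤ _ := by
          gcongr
          exact le_add_self

end Majorants

end GLData

namespace GLData

variable (D : GLData)

theorem isMajorant_top {v : Fin 3 → ℝ × ℝ → ℂ} (hv : ∀ i, SmoothPer (v i)) :
    D.IsMajorant v fun _ => ∞ where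
  even _ := rfl
  one_le := le_top
  v i := ⟨hv i, fun _ => le_top⟩
  q := ⟨D.smooth_q, fun _ => le_top⟩
  A k i j := ⟨D.smooth_A k i j, fun _ => le_top⟩
  P i j := ⟨D.smooth_P i j, fun _ => le_top⟩

theorem smoothPer_momF {v : Fin 3 → ℝ × ℝ → ℂ} (hv : ∀ i, SmoothPer (v i)) (k : Fin 2)
    (i : Fin 3) : SmoothPer (D.momF v k i) := ((D.isMajorant_top hv).momF k i).smooth

theorem smoothPer_frcF {v : Fin 3 → ℝ × ℝ → ℂ} (hv : ∀ i, SmoothPer (v i)) (i : Fin 3) :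
    SmoothPer (D.frcF v i) := ((D.isMajorant_top hv).frcF i).smooth

theorem isCritical_of_forall_le {v : Fin 3 → ℝ × ℝ → ℂ} (hv : ∀ i, SmoothPer (v i)) (j : Fin 3)
    (κ : ℤ × ℤ) (hmin : ∀ z : ℂ, D.act v ≤
      D.act fun i x => v i x + (if i = j then z else 0) * fe κ x) : D.IsCritical v j κ := by
  set X : ℂ := ∑ k, -sym k κ * fc (D.momF v k j) κ + fc (D.frcF v j) κ with hX
  have hη : ∀ i : Fin 3, SmoothPer fun x => (if i = j then X else 0) * fe κ x := fun i =>
    (SmoothPer.const _).mul (smoothPer_fe κ)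
  have h := D.setIntegral_dlag_eq_zero hv hη fun s => by
    refine (hmin (s * X)).trans_eq ?_
    congr 1
    funext i x
    split_ifs
    · ring
    · ring
  have e : ∀ x, D.dlag x (fun i => v i x) (fun k i => pdv k (v i) x)
      (fun i => (if i = j then X else 0) * fe κ x)
      (fun k i => pdv k (fun x => (if i = j then X else 0) * fe κ x) x) =
      (2 * (starRingEnd ℂ) X * (∑ k, -sym k κ * (D.momF v k j x * fe (-κ) x) +
        D.frcF v j x * fe (-κ) x)).re := by
    intro x
    have h2 : ∀ z : ℂ, 2 * z.re = (2 * z).re := fun z => by simp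
    simp only [dlag, pdv_const_mul _ _ (smoothPer_fe κ), pdv_fe, map_mul, conj_fe, conj_sym, h2]
    congr 1
    simp only [apply_ite (starRingEnd ℂ), map_zero, ite_mul, zero_mul, mul_ite, mul_zero,
      Finset.sum_ite_eq', Finset.mem_univ, if_true, momF, frcF, Fin.sum_univ_two]
    ring
  have hm := fun k => (D.smoothPer_momF hv k j).cont
  have hf := (D.smoothPer_frcF hv j).cont
  have hfe := (smoothPer_fe (-κ)).cont
  have key : ∫ x in unitSquare, (2 * (starRingEnd ℂ) X * (∑ k, -sym k κ *
      (D.momF v k j x * fe (-κ) x) + D.frcF v j x * fe (-κ) x)) =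
      2 * (starRingEnd ℂ) X * X := by
    rw [integral_const_mul, integral_add (integrableOn_unitSquare (by fun_prop))
      (integrableOn_unitSquare (by fun_prop)), integral_finsetSum _ fun k _ =>
      integrableOn_unitSquare (by have := hm k; fun_prop)]
    simp only [integral_const_mul]
    rfl
  rw [integral_congr_ae (Filter.Eventually.of_forall e)] at h
  have h3 := integral_re (𝕜 := ℂ) (μ := volume.restrict unitSquare)
    (f := fun x => 2 * (starRingEnd ℂ) X * (∑ k, -sym k κ *
      (D.momF v k j x * fe (-κ) x) + D.frcF v j x * fe (-κ) x))
    (integrableOn_unitSquare (by fun_prop))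
  rw [key] at h3
  have h4 : (2 * (starRingEnd ℂ) X * X).re = 0 := h3.symm.trans h
  have hX0 : X = 0 := by
    rw [mul_assoc, Complex.conj_mul', ← Complex.ofReal_pow, ← Complex.ofReal_ofNat,
      ← Complex.ofReal_mul, Complex.ofReal_re] at h4
    simpa using h4
  simp only [neg_mul, Finset.sum_neg_distrib] at hX
  rw [IsCritical]
  linear_combination hX - hX0

/-- Existence of a rapidly decreasing even majorant of the coefficients. -/
theorem exists_majorant : ∃ a : ℤ × ℤ → ℝ≥0∞, (∀ k, a (-k) = a k) ∧ 1 ≤ a 0 ∧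
    (∀ s : ℕ, ∑' k, wt k ^ s * a k ≠ ∞) ∧ (∀ k, ‖fc D.q k‖ₑ ≤ a k) ∧
    (∀ k i j l, ‖fc (D.A k i j) l‖ₑ ≤ a l) ∧ ∀ i j l, ‖fc (D.P i j) l‖ₑ ≤ a l := by
  set g : ℤ × ℤ → ℝ≥0∞ := fun l => ‖fc D.q l‖ₑ + ∑ k, ∑ i, ∑ j, ‖fc (D.A k i j) l‖ₑ +
    ∑ i, ∑ j, ‖fc (D.P i j) l‖ₑ with hg
  have hgs : ∀ s : ℕ, ∑' k, wt k ^ s * g k ≠ ∞ := by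
    intro s
    have hA := fun k i j => (D.smooth_A k i j).rapid s
    have hP := fun i j => (D.smooth_P i j).rapid s
    simp only [hg, mul_add, ENNReal.tsum_add, Fin.sum_univ_two]
    simp only [ENNReal.add_ne_top, D.smooth_q.rapid s, hA, hP, ne_eq, not_false_eq_true, and_self]
  have hle : ∀ l, g l ≤ g l + g (-l) + if l = 0 then 1 else 0 := fun l => by
    rw [add_assoc]
    exact le_self_add
  refine ⟨fun l => g l + g (-l) + if l = 0 then 1 else 0, fun k => ?_, ?_, fun s => ?_,
    fun k => le_trans ?_ (hle k), fun k i j l => le_trans ?_ (hle l),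
    fun i j l => le_trans ?_ (hle l)⟩
  · simp only [neg_neg, add_comm (g (-k)), neg_eq_zero]
  · simp
  · simp only [mul_add, ENNReal.tsum_add]
    refine ENNReal.add_ne_top.2 ⟨ENNReal.add_ne_top.2 ⟨hgs s, ?_⟩, ?_⟩
    · rw [← (Equiv.neg (ℤ × ℤ)).tsum_eq]
      simpa only [Equiv.neg_apply, neg_neg, wt_neg] using hgs s
    · simp [wt_zero, mul_ite]
  · simp only [hg, add_assoc]
    exact le_self_add
  · simp only [hg]
    refine le_trans ?_ (le_self_add.trans' le_add_self)
    exact (Finset.single_le_sum (f := fun j => ‖fc (D.A k i j) l‖ₑ) (fun _ _ => zero_le)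
      (Finset.mem_univ j)).trans ((Finset.single_le_sum
        (f := fun i => ∑ j, ‖fc (D.A k i j) l‖ₑ) (fun _ _ => zero_le) (Finset.mem_univ i)).trans
        (Finset.single_le_sum (f := fun k => ∑ i, ∑ j, ‖fc (D.A k i j) l‖ₑ)
          (fun _ _ => zero_le) (Finset.mem_univ k)))
  · refine le_trans ?_ le_add_self
    exact (Finset.single_le_sum (f := fun j => ‖fc (D.P i j) l‖ₑ) (fun _ _ => zero_le)
      (Finset.mem_univ j)).trans (Finset.single_le_sum
        (f := fun i => ∑ j, ‖fc (D.P i j) l‖ₑ) (fun _ _ => zero_le) (Finset.mem_univ i))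

/-- The elliptic estimate at a single frequency. -/
theorem IsMajorant.wt_pow_mul_le {v : Fin 3 → ℝ × ℝ → ℂ} {H : ℤ × ℤ → ℝ≥0∞}
    (h : D.IsMajorant v H) {j : Fin 3} {κ : ℤ × ℤ} (hκ : κ ≠ 0) (hc : D.IsCritical v j κ) :
    wt κ ^ 4 * ‖fc (v j) κ‖ₑ ≤
      (16 * ‖(2 * Real.pi * I : ℂ)‖ₑ + D.frcConst) * conv (quadMaj H) H κ := by
  have hlow : ∃ ℓ : Fin 2 → ℂ, (∀ k, ‖ℓ k‖ₑ ≤ 4 * conv H H κ) ∧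
      ∀ k, fc (D.momF v k j) κ = sym k κ * fc (v j) κ + ℓ k := by
    refine Fin.cases ⟨fun _ => 0, fun k => by simp, fun k => ?_⟩ (fun i => ?_) j
    · rw [add_zero, ← fc_pdv (h.v 0).smooth]
      rfl
    · refine ⟨fun k => fc (fun x => D.low x (fun i => v i x) k i) κ, fun k => (h.low k i).le κ,
        fun k => ?_⟩
      rw [← fc_pdv (h.v _).smooth, ← fc_add ((h.v _).smooth.pdv k).cont (h.low k i).smooth.cont]
      rfl
  obtain ⟨ℓ, hℓ, hmom⟩ := hlow
  simp only [IsCritical, hmom] at hc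
  have e : (∑ k, sym k κ * sym k κ) * fc (v j) κ = fc (D.frcF v j) κ - ∑ k, sym k κ * ℓ k := by
    rw [← hc]
    simp only [mul_add, Finset.sum_add_distrib, Finset.sum_mul, mul_assoc]
    ring
  have hs : ‖∑ k, sym k κ * ℓ k‖ₑ ≤
      16 * ‖(2 * Real.pi * I : ℂ)‖ₑ * conv (quadMaj H) H κ := by
    refine (enorm_sum_le _ _).trans ?_
    have : ∀ k, ‖sym k κ * ℓ k‖ₑ ≤ 8 * ‖(2 * Real.pi * I : ℂ)‖ₑ * conv (quadMaj H) H κ := by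
      intro k
      rw [enorm_mul]
      calc _ ≤ (‖(2 * Real.pi * I : ℂ)‖ₑ * wt κ ^ 2) * (4 * conv H H κ) :=
            mul_le_mul' (enorm_sym_le k κ) (hℓ k)
        _ = 4 * ‖(2 * Real.pi * I : ℂ)‖ₑ * (wt κ ^ 2 * conv H H κ) := by ring
        _ ≤ 4 * ‖(2 * Real.pi * I : ℂ)‖ₑ * (2 * conv (quadMaj H) H κ) :=
            mul_le_mul_right (wt_sq_mul_conv_le H κ) _
        _ = _ := by ring
    rw [Fin.sum_univ_two]
    exact (add_le_add (this 0) (this 1)).trans_eq (by ring)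
  calc _ ≤ ‖∑ k, sym k κ * sym k κ‖ₑ * ‖fc (v j) κ‖ₑ :=
        mul_le_mul_left (wt_pow_four_le_enorm_sum_sym hκ) _
    _ = ‖fc (D.frcF v j) κ - ∑ k, sym k κ * ℓ k‖ₑ := by rw [← enorm_mul, e]
    _ ≤ _ := enorm_sub_le
    _ ≤ D.frcConst * conv (quadMaj H) H κ +
        16 * ‖(2 * Real.pi * I : ℂ)‖ₑ * conv (quadMaj H) H κ := add_le_add ((h.frcF j).le κ) hs
    _ = _ := by ring

theorem momConst_ne_top : momConst ≠ ∞ := ENNReal.add_ne_top.2 ⟨enorm_ne_top, by simp⟩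

theorem frcConst_ne_top : D.frcConst ≠ ∞ := by
  have h : ∀ z : ℂ, 2 * ‖z‖ₑ ≠ ∞ := fun z => ENNReal.mul_ne_top (by simp) enorm_ne_top
  exact ENNReal.add_ne_top.2 ⟨ENNReal.add_ne_top.2 ⟨ENNReal.add_ne_top.2 ⟨by simp,
    ENNReal.mul_ne_top (by simp) momConst_ne_top⟩, h _⟩, h _⟩

/-- Uniform regularity: Galerkin critical points which are bounded in `H¹` are bounded in every
Sobolev norm. -/
theorem exists_bound_of_isCritical {M : ℝ≥0∞} (hM : M ≠ ∞) (s : ℕ) :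
    ∃ B : ℝ≥0∞, B ≠ ∞ ∧ ∀ v : Fin 3 → ℝ × ℝ → ℂ, (∀ i, SmoothPer (v i)) →
      (∀ j κ, κ ≠ 0 → fc (v j) κ = 0 ∨ D.IsCritical v j κ) →
      (∀ i, ∑' k, (wt k ^ 2 * ‖fc (v i) k‖ₑ) ^ 2 ≤ M) →
      ∀ i k, wt k ^ s * ‖fc (v i) k‖ₑ ≤ B := by
  obtain ⟨a, haneg, ha0, has, haq, haA, haP⟩ := D.exists_majorant
  set C₁ : ℝ≥0∞ := 16 * ‖(2 * Real.pi * I : ℂ)‖ₑ + D.frcConst with hC₁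
  have hC₁t : C₁ ≠ ∞ :=
    ENNReal.add_ne_top.2 ⟨ENNReal.mul_ne_top (by simp) enorm_ne_top, D.frcConst_ne_top⟩
  set C : ℝ≥0∞ := 6 * C₁ + 6 * (1 + M) + 1 with hC
  have hCt : C ≠ ∞ := ENNReal.add_ne_top.2 ⟨ENNReal.add_ne_top.2
    ⟨ENNReal.mul_ne_top (by simp) hC₁t,
      ENNReal.mul_ne_top (by simp) (ENNReal.add_ne_top.2 ⟨by simp, hM⟩)⟩, by simp⟩
  set M' : ℝ≥0∞ := 9 * (9 * (3 * M)) * 2 + 3 * (∑' k, wt k ^ 2 * a k) ^ 2 with hM'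
  have hM't : M' ≠ ∞ := ENNReal.add_ne_top.2 ⟨ENNReal.mul_ne_top (ENNReal.mul_ne_top (by simp)
    (ENNReal.mul_ne_top (by simp) (ENNReal.mul_ne_top (by simp) hM))) (by simp),
    ENNReal.mul_ne_top (by simp) (ENNReal.pow_ne_top (has 2))⟩
  obtain ⟨B, hB, hall⟩ := exists_bound_tsum_wt_mul has hCt hM't s
  refine ⟨B, hB, fun v hv hcrit hb i k => ?_⟩
  set S : ℤ × ℤ → ℝ≥0∞ := fun k => ∑ i, ‖fc (v i) k‖ₑ with hS
  have hle : ∀ i k, ‖fc (v i) k‖ₑ ≤ S k := fun i k =>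
    Finset.single_le_sum (f := fun i => ‖fc (v i) k‖ₑ) (fun _ _ => zero_le) (Finset.mem_univ i)
  set H : ℤ × ℤ → ℝ≥0∞ := fun k => S k + S (-k) + a k with hH
  have hSH : ∀ k, S k ≤ H k := fun k => by
    simp only [hH, add_assoc]
    exact le_self_add
  have haH : ∀ k, a k ≤ H k := fun k => le_add_self
  have hmaj : D.IsMajorant v H :=
    { even := fun k => by simp only [hH, neg_neg, haneg, add_comm (S k)]
      one_le := ha0.trans (haH 0)
      v := fun i => ⟨hv i, fun k => (hle i k).trans (hSH k)⟩
      q := ⟨D.smooth_q, fun k => (haq k).trans (haH k)⟩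
      A := fun k i j => ⟨D.smooth_A k i j, fun l => (haA k i j l).trans (haH l)⟩
      P := fun i j => ⟨D.smooth_P i j, fun l => (haP i j l).trans (haH l)⟩ }
  have hest : ∀ k, wt k ^ 4 * S k ≤
      3 * (C₁ * conv (quadMaj H) H k + (1 + M) * (wt k ^ 4 * a k)) := by
    intro k
    have h1 : ∀ j, wt k ^ 4 * ‖fc (v j) k‖ₑ ≤
        C₁ * conv (quadMaj H) H k + (1 + M) * (wt k ^ 4 * a k) := by
      intro j
      by_cases hk : k = 0
      · subst hk
        refine le_trans ?_ le_add_self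
        have h2 : ‖fc (v j) 0‖ₑ ^ 2 ≤ M := by
          refine le_trans ?_ (hb j)
          refine le_trans (le_of_eq ?_)
            (ENNReal.le_tsum (f := fun k => (wt k ^ 2 * ‖fc (v j) k‖ₑ) ^ 2) 0)
          rw [wt_zero, one_pow, one_mul]
        have h3 : ‖fc (v j) 0‖ₑ ≤ 1 + M := by
          rcases le_total ‖fc (v j) 0‖ₑ 1 with h | h
          · exact h.trans le_self_add
          · refine le_trans ?_ (h2.trans le_add_self)
            exact le_self_pow h (by norm_num)
        calc _ = ‖fc (v j) 0‖ₑ * 1 := by rw [wt_zero, one_pow, one_mul, mul_one]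
          _ ≤ (1 + M) * (wt 0 ^ 4 * a 0) := by
            rw [wt_zero, one_pow, one_mul]
            exact mul_le_mul' h3 ha0
      · refine le_trans ?_ le_self_add
        rcases hcrit j k hk with h | h
        · simp [h]
        · exact hmaj.wt_pow_mul_le D hk h
    rw [hS, Finset.mul_sum]
    refine (Finset.sum_le_card_nsmul _ _ _ fun j _ => h1 j).trans_eq ?_
    rw [Finset.card_univ, Fintype.card_fin, nsmul_eq_mul, Nat.cast_ofNat]
  have hstar : ∀ k, wt k ^ 4 * H k ≤ C * conv (quadMaj H) H k + C * (wt k ^ 4 * a k) := by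
    intro k
    have h2 := hest (-k)
    rw [wt_neg, haneg, conv_neg (quadMaj_neg hmaj.even) hmaj.even] at h2
    calc wt k ^ 4 * H k = wt k ^ 4 * S k + wt k ^ 4 * S (-k) + wt k ^ 4 * a k := by
          simp only [hH]; ring
      _ ≤ _ := add_le_add_left (add_le_add (hest k) h2) _
      _ = 6 * C₁ * conv (quadMaj H) H k + (6 * (1 + M) + 1) * (wt k ^ 4 * a k) := by ring
      _ ≤ _ := by
        refine add_le_add (mul_le_mul_left ?_ _) (mul_le_mul_left ?_ _)
        · rw [hC, add_assoc]; exact le_self_add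
        · rw [hC, add_assoc]; exact le_add_self
  have hSb : ∑' k, (wt k ^ 2 * S k) ^ 2 ≤ 9 * (3 * M) := by
    calc _ ≤ ∑' k, 9 * ∑ i, (wt k ^ 2 * ‖fc (v i) k‖ₑ) ^ 2 := by
          refine ENNReal.tsum_le_tsum fun k => ?_
          rw [hS, Finset.mul_sum, Fin.sum_univ_three, Fin.sum_univ_three]
          refine (ENNReal.add_sq_le _ _).trans ?_
          calc _ ≤ 3 * (3 * ((wt k ^ 2 * ‖fc (v 0) k‖ₑ) ^ 2 + (wt k ^ 2 * ‖fc (v 1) k‖ₑ) ^ 2) +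
                3 * (wt k ^ 2 * ‖fc (v 2) k‖ₑ) ^ 2) := by
                gcongr
                · exact ENNReal.add_sq_le _ _
                · exact le_mul_of_one_le_left' (by norm_num)
            _ = _ := by ring
      _ = 9 * ∑ i, ∑' k, (wt k ^ 2 * ‖fc (v i) k‖ₑ) ^ 2 := by
          rw [ENNReal.tsum_mul_left]
          simp only [Fin.sum_univ_three, ENNReal.tsum_add]
      _ ≤ _ := by
          gcongr
          exact (Finset.sum_le_card_nsmul _ _ _ fun j _ => hb j).trans_eq (by simp)
  have hSb' : ∑' k, (wt k ^ 2 * S (-k)) ^ 2 ≤ 9 * (3 * M) := by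
    rw [← (Equiv.neg (ℤ × ℤ)).tsum_eq]
    simpa only [Equiv.neg_apply, neg_neg, wt_neg] using hSb
  have hab : ∑' k, (wt k ^ 2 * a k) ^ 2 ≤ (∑' k, wt k ^ 2 * a k) ^ 2 := by
    rw [sq (∑' k, _), ← ENNReal.tsum_mul_right]
    refine ENNReal.tsum_le_tsum fun k => ?_
    rw [sq]
    exact mul_le_mul_right (ENNReal.le_tsum k) _
  have hHb : ∑' k, (wt k ^ 2 * H k) ^ 2 ≤ M' := by
    calc _ ≤ ∑' k, (9 * (wt k ^ 2 * S k) ^ 2 + 9 * (wt k ^ 2 * S (-k)) ^ 2 +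
          3 * (wt k ^ 2 * a k) ^ 2) := by
          refine ENNReal.tsum_le_tsum fun k => ?_
          simp only [hH, mul_add]
          refine (ENNReal.add_sq_le _ _).trans ?_
          calc _ ≤ 3 * (3 * ((wt k ^ 2 * S k) ^ 2 + (wt k ^ 2 * S (-k)) ^ 2) +
                (wt k ^ 2 * a k) ^ 2) := by
                gcongr
                exact ENNReal.add_sq_le _ _
            _ = _ := by ring
      _ = 9 * ∑' k, (wt k ^ 2 * S k) ^ 2 + 9 * ∑' k, (wt k ^ 2 * S (-k)) ^ 2 +
          3 * ∑' k, (wt k ^ 2 * a k) ^ 2 := by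
          simp only [ENNReal.tsum_add, ENNReal.tsum_mul_left]
      _ ≤ 9 * (9 * (3 * M)) + 9 * (9 * (3 * M)) + 3 * (∑' k, wt k ^ 2 * a k) ^ 2 := by gcongr
      _ = _ := by rw [hM']; ring
  calc wt k ^ s * ‖fc (v i) k‖ₑ ≤ wt k ^ s * H k :=
        mul_le_mul_right ((hle i k).trans (hSH k)) _
    _ ≤ ∑' k, wt k ^ s * H k := ENNReal.le_tsum k
    _ ≤ B := hall H hstar hHb

end GLData

theorem norm_sym_sq (κ : ℤ × ℤ) : ‖sym 0 κ‖ ^ 2 = 4 * Real.pi ^ 2 * (κ.1 : ℝ) ^ 2 ∧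
    ‖sym 1 κ‖ ^ 2 = 4 * Real.pi ^ 2 * (κ.2 : ℝ) ^ 2 := by
  constructor <;> simp only [sym, Matrix.cons_val_zero, Matrix.cons_val_one, norm_mul,
    Complex.norm_I, Complex.norm_ofNat, Complex.norm_real, Complex.norm_intCast, mul_pow, sq_abs,
    Real.norm_eq_abs] <;> ring

theorem sq_add_sq_le_sum_norm_sym_sq (κ : ℤ × ℤ) :
    (κ.1 : ℝ) ^ 2 + (κ.2 : ℝ) ^ 2 ≤ ∑ k, ‖sym k κ‖ ^ 2 := by
  rw [Fin.sum_univ_two, (norm_sym_sq κ).1, (norm_sym_sq κ).2, ← mul_add]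
  have hpi : (9 : ℝ) ≤ Real.pi ^ 2 := by nlinarith [Real.pi_gt_three]
  exact le_mul_of_one_le_left (by positivity) (by linarith)

theorem hasSum_sq_norm_pdv {f : ℝ × ℝ → ℂ} (hf : SmoothPer f) :
    HasSum (fun κ => (∑ k, ‖sym k κ‖ ^ 2) * ‖fc f κ‖ ^ 2)
      (∑ k, ∫ x in unitSquare, ‖pdv k f x‖ ^ 2) := by
  have h : ∀ k : Fin 2, HasSum (fun κ => ‖sym k κ‖ ^ 2 * ‖fc f κ‖ ^ 2)
      (∫ x in unitSquare, ‖pdv k f x‖ ^ 2) := fun k => by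
    simpa only [fc_pdv hf, norm_mul, mul_pow] using hasSum_sq_norm_fc (hf.pdv k)
  simpa only [Finset.sum_mul] using hasSum_sum fun k _ => h k

/-- The Poincaré inequality. -/
theorem setIntegral_sq_norm_le {f : ℝ × ℝ → ℂ} (hf : SmoothPer f) :
    ∫ x in unitSquare, ‖f x‖ ^ 2 ≤
      ‖fc f 0‖ ^ 2 + ∑ k, ∫ x in unitSquare, ‖pdv k f x‖ ^ 2 := by
  have h0 : HasSum (fun κ : ℤ × ℤ => if κ = 0 then ‖fc f 0‖ ^ 2 else 0) (‖fc f 0‖ ^ 2) :=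
    hasSum_ite_eq 0 _
  have h := h0.add (hasSum_sq_norm_pdv hf)
  refine hasSum_le (fun κ => ?_) (hasSum_sq_norm_fc hf) h
  split_ifs with hκ
  · rw [hκ]
    exact le_add_of_nonneg_right (by positivity)
  · have h1 : (1 : ℝ) ≤ (κ.1 : ℝ) ^ 2 + (κ.2 : ℝ) ^ 2 := by
      have : 1 ≤ κ.1 ^ 2 + κ.2 ^ 2 := by
        by_contra! h
        have h1 : κ.1 = 0 := by nlinarith [sq_nonneg κ.1, sq_nonneg κ.2]
        have h2 : κ.2 = 0 := by nlinarith [sq_nonneg κ.1, sq_nonneg κ.2]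
        exact hκ (Prod.ext h1 h2)
      exact_mod_cast this
    rw [zero_add]
    exact le_mul_of_one_le_left (by positivity) (h1.trans (sq_add_sq_le_sum_norm_sym_sq κ))

theorem tsum_wt_sq_mul_sq_le {f : ℝ × ℝ → ℂ} (hf : SmoothPer f) :
    ∑' κ, (wt κ ^ 2 * ‖fc f κ‖ₑ) ^ 2 ≤ ENNReal.ofReal (3 *
      ((∫ x in unitSquare, ‖f x‖ ^ 2) + ∑ k, ∫ x in unitSquare, ‖pdv k f x‖ ^ 2)) := by
  have h := ((hasSum_sq_norm_fc hf).add (hasSum_sq_norm_pdv hf)).mul_left 3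
  rw [← h.tsum_eq, ENNReal.ofReal_tsum_of_nonneg (fun κ => by positivity) h.summable]
  refine ENNReal.tsum_le_tsum fun κ => ?_
  rw [wt_sq, ← ofReal_norm, ← ENNReal.ofReal_mul (by positivity),
    ← ENNReal.ofReal_pow (by positivity)]
  refine ENNReal.ofReal_le_ofReal ?_
  rw [mul_pow]
  calc _ ≤ (3 * (1 + ∑ k, ‖sym k κ‖ ^ 2)) * ‖fc f κ‖ ^ 2 := by
        gcongr
        have a1 := sq_abs (κ.1 : ℝ)
        have a2 := sq_abs (κ.2 : ℝ)
        nlinarith [sq_nonneg (1 - |(κ.1 : ℝ)|), sq_nonneg (1 - |(κ.2 : ℝ)|),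
          sq_nonneg (|(κ.1 : ℝ)| - |(κ.2 : ℝ)|), sq_add_sq_le_sum_norm_sym_sq κ]
    _ = _ := by ring

/-- The embedding `H¹ ⊂ L⁴`. -/
theorem ofReal_setIntegral_pow_four_le {f : ℝ × ℝ → ℂ} (hf : SmoothPer f) :
    ENNReal.ofReal (∫ x in unitSquare, ‖f x‖ ^ 4) ≤
      2 * (∑' k, (wt k)⁻¹ ^ 5) * (∑' k, (wt k ^ 2 * ‖fc f k‖ₑ) ^ 2) ^ 2 := by
  have h := tsum_sq_enorm_fc (hf.mul hf)
  simp only [norm_mul, mul_pow, ← pow_add] at h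
  rw [← h]
  refine le_trans (ENNReal.tsum_le_tsum fun k => ?_) (tsum_conv_sq_le fun k => ‖fc f k‖ₑ)
  gcongr
  exact enorm_fc_mul_le hf hf.cont k

theorem setIntegral_mono_unitSquare {f g : ℝ × ℝ → ℝ} (hf : Continuous f) (hg : Continuous g)
    (h : ∀ x ∈ unitSquare, f x ≤ g x) :
    ∫ x in unitSquare, f x ≤ ∫ x in unitSquare, g x :=
  setIntegral_mono_on (integrableOn_unitSquare hf) (integrableOn_unitSquare hg)
    measurableSet_Icc h

theorem setIntegral_unitSquare_const (c : ℝ) : ∫ _ in unitSquare, c = c := by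
  rw [setIntegral_unitSquare continuous_const]
  simp

theorem exists_norm_le_on_unitSquare {f : ℝ × ℝ → ℂ} (hf : Continuous f) :
    ∃ C, ∀ x ∈ unitSquare, ‖f x‖ ≤ C := by
  refine IsCompact.exists_bound_of_continuousOn ?_ hf.continuousOn
  rw [unitSquare, ← Set.Icc_prod_Icc]
  exact isCompact_Icc.prod isCompact_Icc

namespace GLData

variable (D : GLData)

theorem continuous_momF {v : Fin 3 → ℝ × ℝ → ℂ} (hv : ∀ i, SmoothPer (v i)) (k : Fin 2)
    (i : Fin 3) : Continuous (D.momF v k i) := (D.smoothPer_momF hv k i).cont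

/-- The constant in the coercivity estimate. -/
def coerciveConst (R : ℝ) : ℝ :=
  R ^ 2 / 2 + 2 * (∫ x in unitSquare, ‖D.q x‖ ^ 2) + D.α ^ 2 / D.β

theorem le_act_add_coerciveConst {v : Fin 3 → ℝ × ℝ → ℂ} (hv : ∀ i, SmoothPer (v i)) {R : ℝ}
    (hR : ‖fc (v 0) 0‖ ≤ R) :
    (∑ k, ∫ x in unitSquare, ‖pdv k (v 0) x‖ ^ 2) / 2 +
      (∑ k, ∑ i : Fin 2, ∫ x in unitSquare, ‖D.momF v k i.succ x‖ ^ 2) +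
      D.β / 4 * ∫ x in unitSquare, (∑ i : Fin 2, ‖v i.succ x‖ ^ 2) ^ 2 ≤
      D.act v + D.coerciveConst R := by
  have c1 : ∀ i, Continuous (v i) := fun i => (hv i).cont
  have c2 : ∀ k, Continuous (pdv k (v 0)) := fun k => ((hv 0).pdv k).cont
  have c3 : ∀ k i, Continuous (D.momF v k i) := D.continuous_momF hv
  have c4 := D.smooth_q.cont
  have hpt : ∀ x, (∑ k, ‖pdv k (v 0) x‖ ^ 2 + ∑ k, ∑ i : Fin 2, ‖D.momF v k i.succ x‖ ^ 2 +
      D.β / 4 * (∑ i : Fin 2, ‖v i.succ x‖ ^ 2) ^ 2) - ‖v 0 x‖ ^ 2 / 2 - 2 * ‖D.q x‖ ^ 2 -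
      D.α ^ 2 / D.β ≤ D.lag x (fun i => v i x) (fun k i => pdv k (v i) x) := by
    intro x
    have h1 := D.P_le x fun i => v i.succ x
    have h2 : -(‖v 0 x‖ ^ 2 / 2 + 2 * ‖D.q x‖ ^ 2) ≤
        2 * (D.q x * (starRingEnd ℂ) (v 0 x)).re := by
      have := (Complex.abs_re_le_norm (D.q x * (starRingEnd ℂ) (v 0 x)))
      rw [norm_mul, RCLike.norm_conj] at this
      have := neg_le_of_abs_le this
      nlinarith [sq_nonneg (‖v 0 x‖ - 2 * ‖D.q x‖)]
    have h3 : ∀ ρ : ℝ, D.β / 4 * ρ ^ 2 - D.α ^ 2 / D.β ≤ D.β / 2 * ρ ^ 2 - D.α * ρ := by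
      intro ρ
      have hβ := D.β_pos
      have : D.β / 2 * ρ ^ 2 - D.α * ρ - (D.β / 4 * ρ ^ 2 - D.α ^ 2 / D.β) =
          (D.β * ρ - 2 * D.α) ^ 2 / (4 * D.β) := by
        field_simp
        ring
      have h4 : 0 ≤ (D.β * ρ - 2 * D.α) ^ 2 / (4 * D.β) := by positivity
      linarith
    have h3 := h3 (∑ i : Fin 2, ‖v i.succ x‖ ^ 2)
    have h4 := mul_le_mul_of_nonneg_left h1 D.α_pos.le
    simp only [lag, momF, mom, Fin.cons_succ]
    linarith
  have hint := setIntegral_mono_unitSquare (by fun_prop) (D.continuous_lag_comp hv)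
    fun x _ => hpt x
  have hP := setIntegral_sq_norm_le (hv 0)
  have hR2 : ‖fc (v 0) 0‖ ^ 2 ≤ R ^ 2 := by gcongr
  rw [integral_sub (integrableOn_unitSquare (by fun_prop)) (integrableOn_unitSquare (by fun_prop)),
    integral_sub (integrableOn_unitSquare (by fun_prop)) (integrableOn_unitSquare (by fun_prop)),
    integral_sub (integrableOn_unitSquare (by fun_prop)) (integrableOn_unitSquare (by fun_prop)),
    integral_add (integrableOn_unitSquare (by fun_prop)) (integrableOn_unitSquare (by fun_prop)),
    integral_add (integrableOn_unitSquare (by fun_prop)) (integrableOn_unitSquare (by fun_prop)),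
    integral_finsetSum _ fun k _ => integrableOn_unitSquare (by have := c2 k; fun_prop),
    integral_finsetSum _ fun k _ => integrableOn_unitSquare (by fun_prop),
    integral_const_mul, integral_const_mul, integral_div, setIntegral_unitSquare_const] at hint
  have e : ∀ k, ∫ x in unitSquare, ∑ i : Fin 2, ‖D.momF v k i.succ x‖ ^ 2 =
      ∑ i : Fin 2, ∫ x in unitSquare, ‖D.momF v k i.succ x‖ ^ 2 := fun k =>
    integral_finsetSum _ fun i _ => integrableOn_unitSquare (by have := c3 k i.succ; fun_prop)
  simp only [e] at hint
  rw [coerciveConst, act]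
  linarith

theorem neg_coerciveConst_le_act {v : Fin 3 → ℝ × ℝ → ℂ} (hv : ∀ i, SmoothPer (v i)) {R : ℝ}
    (hR : ‖fc (v 0) 0‖ ≤ R) : -D.coerciveConst R ≤ D.act v := by
  have h := D.le_act_add_coerciveConst hv hR
  have hβ := D.β_pos
  have h2 : 0 ≤ ∫ x in unitSquare, (∑ i : Fin 2, ‖v i.succ x‖ ^ 2) ^ 2 :=
    integral_nonneg fun x => by positivity
  have h3 : 0 ≤ ∑ k, ∫ x in unitSquare, ‖pdv k (v 0) x‖ ^ 2 :=
    Finset.sum_nonneg fun k _ => integral_nonneg fun x => by positivity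
  have h4 : 0 ≤ ∑ k, ∑ i : Fin 2, ∫ x in unitSquare, ‖D.momF v k i.succ x‖ ^ 2 :=
    Finset.sum_nonneg fun k _ => Finset.sum_nonneg fun i _ =>
      integral_nonneg fun x => by positivity
  have := mul_nonneg (div_nonneg hβ.le (by norm_num : (0 : ℝ) ≤ 4)) h2
  linarith

theorem exists_norm_low_sq_le : ∃ K : ℝ, 0 ≤ K ∧ ∀ x ∈ unitSquare, ∀ (p : Fin 3 → ℂ) (k i : Fin 2),
    ‖D.low x p k i‖ ^ 2 ≤ K * (1 + (∑ i : Fin 2, ‖p i.succ‖ ^ 2) ^ 2 + ‖p 0‖ ^ 4) := by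
  choose C hC using fun k i j => exists_norm_le_on_unitSquare (D.smooth_A k i j).cont
  have hsum : ∀ x ∈ unitSquare, ∀ k i j, ‖D.A k i j x‖ ≤ ∑ k, ∑ i, ∑ j, |C k i j| := by
    intro x hx k i j
    refine ((hC k i j x hx).trans (le_abs_self _)).trans ?_
    refine (Finset.single_le_sum (f := fun j => |C k i j|) (fun _ _ => abs_nonneg _)
      (Finset.mem_univ j)).trans ?_
    refine (Finset.single_le_sum (f := fun i => ∑ j, |C k i j|)
      (fun _ _ => Finset.sum_nonneg fun _ _ => abs_nonneg _) (Finset.mem_univ i)).trans ?_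
    exact Finset.single_le_sum (f := fun k => ∑ i, ∑ j, |C k i j|)
      (fun _ _ => Finset.sum_nonneg fun _ _ => Finset.sum_nonneg fun _ _ => abs_nonneg _)
      (Finset.mem_univ k)
  set c := ∑ k, ∑ i, ∑ j, |C k i j|
  refine ⟨3 * c ^ 2 + 3, by positivity, fun x hx p k i => ?_⟩
  have hA := hsum x hx k i
  have hcoord : ‖(coord k (p 0) : ℂ)‖ ≤ ‖p 0‖ := by
    rw [Complex.norm_real]
    fin_cases k
    · exact Complex.abs_re_le_norm _
    · exact Complex.abs_im_le_norm _
  have hn : ‖D.low x p k i‖ ≤ c * ‖p 1‖ + c * ‖p 2‖ + ‖p 0‖ * ‖p i.succ‖ := by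
    rw [low, Fin.sum_univ_two]
    refine (norm_add_le _ _).trans (add_le_add ((norm_add_le _ _).trans (add_le_add ?_ ?_)) ?_)
    · rw [norm_mul]
      exact mul_le_mul_of_nonneg_right (hA 0) (norm_nonneg _)
    · rw [norm_mul]
      exact mul_le_mul_of_nonneg_right (hA 1) (norm_nonneg _)
    · rw [norm_mul, norm_mul, Complex.norm_I, one_mul]
      gcongr
  have hi : ‖p i.succ‖ ^ 2 ≤ ‖p 1‖ ^ 2 + ‖p 2‖ ^ 2 := by
    fin_cases i
    · exact le_add_of_nonneg_right (by positivity)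
    · exact le_add_of_nonneg_left (by positivity)
  have e : ∑ i : Fin 2, ‖p i.succ‖ ^ 2 = ‖p 1‖ ^ 2 + ‖p 2‖ ^ 2 := by
    rw [Fin.sum_univ_two]; rfl
  rw [e]
  set ρ := ‖p 1‖ ^ 2 + ‖p 2‖ ^ 2 with hρ
  have hρ0 : 0 ≤ ρ := by positivity
  have h3 : ∀ a b d : ℝ, (a + b + d) ^ 2 ≤ 3 * (a ^ 2 + b ^ 2 + d ^ 2) := fun a b d => by
    nlinarith [sq_nonneg (a - b), sq_nonneg (b - d), sq_nonneg (a - d)]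
  calc ‖D.low x p k i‖ ^ 2 ≤ (c * ‖p 1‖ + c * ‖p 2‖ + ‖p 0‖ * ‖p i.succ‖) ^ 2 := by gcongr
    _ ≤ 3 * ((c * ‖p 1‖) ^ 2 + (c * ‖p 2‖) ^ 2 + (‖p 0‖ * ‖p i.succ‖) ^ 2) := h3 _ _ _
    _ = 3 * c ^ 2 * ρ + 3 * (‖p 0‖ ^ 2 * ‖p i.succ‖ ^ 2) := by rw [hρ]; ring
    _ ≤ 3 * c ^ 2 * (1 + ρ ^ 2 + ‖p 0‖ ^ 4) + 3 * (1 + ρ ^ 2 + ‖p 0‖ ^ 4) := by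
        refine add_le_add ?_ ?_
        · refine mul_le_mul_of_nonneg_left ?_ (by positivity)
          nlinarith [sq_nonneg (ρ - 1), sq_nonneg (‖p 0‖ ^ 2)]
        · refine mul_le_mul_of_nonneg_left ?_ (by norm_num)
          have := mul_le_mul_of_nonneg_left hi (sq_nonneg ‖p 0‖)
          nlinarith [sq_nonneg (ρ - ‖p 0‖ ^ 2), sq_nonneg (ρ + ‖p 0‖ ^ 2)]
    _ = _ := by ring

/-- Sublevel sets of the action are bounded in `H¹`. -/
theorem exists_bound_of_act_le (E R : ℝ) : ∃ M : ℝ≥0∞, M ≠ ∞ ∧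
    ∀ v : Fin 3 → ℝ × ℝ → ℂ, (∀ i, SmoothPer (v i)) → D.act v ≤ E → ‖fc (v 0) 0‖ ≤ R →
      ∀ i, ∑' k, (wt k ^ 2 * ‖fc (v i) k‖ₑ) ^ 2 ≤ M := by
  obtain ⟨K, hK, hlow⟩ := D.exists_norm_low_sq_le
  set T := E + D.coerciveConst R with hT
  set M₀ : ℝ≥0∞ := ENNReal.ofReal (3 * (R ^ 2 + 4 * T)) with hM₀
  set B₄ : ℝ := (2 * (∑' k, (wt k)⁻¹ ^ 5) * M₀ ^ 2).toReal with hB₄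
  set ρ₂ : ℝ := 4 * T / D.β with hρ₂
  set M₁ : ℝ≥0∞ := ENNReal.ofReal (3 * (1 + ρ₂ + 2 * (2 * T + 2 * (K * (1 + ρ₂ + B₄))))) with hM₁
  have hM₀t : 2 * (∑' k, (wt k)⁻¹ ^ 5) * M₀ ^ 2 ≠ ∞ :=
    ENNReal.mul_ne_top (ENNReal.mul_ne_top (by simp) tsum_inv_wt_pow_ne_top)
      (ENNReal.pow_ne_top ENNReal.ofReal_ne_top)
  refine ⟨M₀ + M₁, ENNReal.add_ne_top.2 ⟨ENNReal.ofReal_ne_top, ENNReal.ofReal_ne_top⟩,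
    fun v hv hE hR => ?_⟩
  have hβ := D.β_pos
  have c1 : ∀ i, Continuous (v i) := fun i => (hv i).cont
  have c2 : ∀ k i, Continuous (pdv k (v i)) := fun k i => ((hv i).pdv k).cont
  have c3 : ∀ k i, Continuous (D.momF v k i) := D.continuous_momF hv
  have hco := D.le_act_add_coerciveConst hv hR
  have n2 : 0 ≤ ∫ x in unitSquare, (∑ i : Fin 2, ‖v i.succ x‖ ^ 2) ^ 2 :=
    integral_nonneg fun x => by positivity
  have n3 : 0 ≤ ∑ k, ∫ x in unitSquare, ‖pdv k (v 0) x‖ ^ 2 :=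
    Finset.sum_nonneg fun k _ => integral_nonneg fun x => by positivity
  have n4 : ∀ k (i : Fin 2), 0 ≤ ∫ x in unitSquare, ‖D.momF v k i.succ x‖ ^ 2 := fun k i =>
    integral_nonneg fun x => by positivity
  have n5 : 0 ≤ ∑ k, ∑ i : Fin 2, ∫ x in unitSquare, ‖D.momF v k i.succ x‖ ^ 2 :=
    Finset.sum_nonneg fun k _ => Finset.sum_nonneg fun i _ => n4 k i
  have n6 := mul_nonneg (div_nonneg hβ.le (by norm_num : (0 : ℝ) ≤ 4)) n2
  have b1 : ∑ k, ∫ x in unitSquare, ‖pdv k (v 0) x‖ ^ 2 ≤ 2 * T := by linarith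
  have b2 : ∀ k (i : Fin 2), ∫ x in unitSquare, ‖D.momF v k i.succ x‖ ^ 2 ≤ T := by
    intro k i
    have h1 := Finset.single_le_sum (f := fun i : Fin 2 => ∫ x in unitSquare,
      ‖D.momF v k i.succ x‖ ^ 2) (fun i _ => n4 k i) (Finset.mem_univ i)
    have h2 := Finset.single_le_sum (f := fun k => ∑ i : Fin 2, ∫ x in unitSquare,
      ‖D.momF v k i.succ x‖ ^ 2) (fun k _ => Finset.sum_nonneg fun i _ => n4 k i)
      (Finset.mem_univ k)
    linarith
  have b3 : ∫ x in unitSquare, (∑ i : Fin 2, ‖v i.succ x‖ ^ 2) ^ 2 ≤ ρ₂ := by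
    rw [hρ₂, le_div_iff₀ hβ]
    linarith
  have h0 : ∑' k, (wt k ^ 2 * ‖fc (v 0) k‖ₑ) ^ 2 ≤ M₀ := by
    refine (tsum_wt_sq_mul_sq_le (hv 0)).trans (ENNReal.ofReal_le_ofReal ?_)
    have hP := setIntegral_sq_norm_le (hv 0)
    have hR2 : ‖fc (v 0) 0‖ ^ 2 ≤ R ^ 2 := by gcongr
    linarith
  have b4 : ∫ x in unitSquare, ‖v 0 x‖ ^ 4 ≤ B₄ := by
    rw [hB₄, ← ENNReal.ofReal_le_iff_le_toReal hM₀t]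
    refine (ofReal_setIntegral_pow_four_le (hv 0)).trans ?_
    gcongr
  have h1 : ∀ i : Fin 2, ∑' k, (wt k ^ 2 * ‖fc (v i.succ) k‖ₑ) ^ 2 ≤ M₁ := by
    intro i
    refine (tsum_wt_sq_mul_sq_le (hv i.succ)).trans (ENNReal.ofReal_le_ofReal ?_)
    have e1 : ∫ x in unitSquare, ‖v i.succ x‖ ^ 2 ≤ 1 + ρ₂ := by
      calc _ ≤ ∫ x in unitSquare, (1 + (∑ i : Fin 2, ‖v i.succ x‖ ^ 2) ^ 2) := by
            refine setIntegral_mono_unitSquare (by fun_prop) (by fun_prop) fun x _ => ?_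
            have := Finset.single_le_sum (f := fun i : Fin 2 => ‖v i.succ x‖ ^ 2)
              (fun _ _ => by positivity) (Finset.mem_univ i)
            nlinarith [sq_nonneg (∑ i : Fin 2, ‖v i.succ x‖ ^ 2 - 1)]
        _ = 1 + ∫ x in unitSquare, (∑ i : Fin 2, ‖v i.succ x‖ ^ 2) ^ 2 := by
            rw [integral_add (integrableOn_unitSquare (by fun_prop))
              (integrableOn_unitSquare (by fun_prop)), setIntegral_unitSquare_const]
        _ ≤ _ := by linarith
    have e2 : ∀ k, ∫ x in unitSquare, ‖pdv k (v i.succ) x‖ ^ 2 ≤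
        2 * T + 2 * (K * (1 + ρ₂ + B₄)) := by
      intro k
      have c2' := c2 k i.succ
      have c3' := c3 k i.succ
      calc _ ≤ ∫ x in unitSquare, (2 * ‖D.momF v k i.succ x‖ ^ 2 +
            2 * (K * (1 + (∑ i : Fin 2, ‖v i.succ x‖ ^ 2) ^ 2 + ‖v 0 x‖ ^ 4))) := by
            refine setIntegral_mono_unitSquare (by fun_prop) (by fun_prop) fun x hx => ?_
            have hl := hlow x hx (fun i => v i x) k i
            have e : pdv k (v i.succ) x =
                D.momF v k i.succ x - D.low x (fun i => v i x) k i := by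
              simp [momF, mom]
            have := norm_sub_le (D.momF v k i.succ x) (D.low x (fun i => v i x) k i)
            rw [← e] at this
            have h5 := pow_le_pow_left₀ (norm_nonneg _) this 2
            nlinarith [sq_nonneg (‖D.momF v k i.succ x‖ - ‖D.low x (fun i => v i x) k i‖)]
        _ = 2 * (∫ x in unitSquare, ‖D.momF v k i.succ x‖ ^ 2) +
            2 * (K * (1 + (∫ x in unitSquare, (∑ i : Fin 2, ‖v i.succ x‖ ^ 2) ^ 2) +
              ∫ x in unitSquare, ‖v 0 x‖ ^ 4)) := by
            rw [integral_add (integrableOn_unitSquare (by fun_prop))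
              (integrableOn_unitSquare (by fun_prop)), integral_const_mul, integral_const_mul,
              integral_const_mul, integral_add (integrableOn_unitSquare (by fun_prop))
              (integrableOn_unitSquare (by fun_prop)),
              integral_add (integrableOn_unitSquare (by fun_prop))
              (integrableOn_unitSquare (by fun_prop)), setIntegral_unitSquare_const]
        _ ≤ _ := by
            gcongr
            exact b2 k i
    have e3 := e2 0
    have e4 := e2 1
    rw [Fin.sum_univ_two]
    linarith
  intro i
  refine Fin.cases ?_ (fun i => ?_) i
  · exact h0.trans le_self_add
  · exact (h1 i).trans le_add_self

end GLData

theorem rapid_of_finset {c : ℤ × ℤ → ℂ} (T : Finset (ℤ × ℤ)) (h : ∀ k ∉ T, c k = 0) : Rapid c := by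
  intro s
  rw [tsum_eq_sum (s := T) fun k hk => by simp [h k hk]]
  exact ENNReal.sum_ne_top.2 fun k _ =>
    ENNReal.mul_ne_top (ENNReal.pow_ne_top (wt_ne_top k)) enorm_ne_top

namespace GLData

variable (D : GLData)

/-- Smooth periodic states whose first component has mean at most `R`. -/
structure Admissible (R : ℝ) (v : Fin 3 → ℝ × ℝ → ℂ) : Prop where
  smooth : ∀ i, SmoothPer (v i)
  mean : ‖fc (v 0) 0‖ ≤ R

theorem admissible_zero {R : ℝ} (hR : 0 ≤ R) : Admissible R fun _ _ => 0 :=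
  ⟨fun _ => SmoothPer.const 0, by simpa [fc] using hR⟩

open Filter Topology

theorem exists_galerkin_minimizer {R : ℝ} (hR : 0 ≤ R) (T : Finset (ℤ × ℤ)) :
    ∃ v, Admissible R v ∧ (∀ i, ∀ k ∉ T, fc (v i) k = 0) ∧
      ∀ w, Admissible R w → (∀ i, ∀ k ∉ T, fc (w i) k = 0) → D.act v ≤ D.act w := by
  set S : Set ℝ := {t | ∃ v, (Admissible R v ∧ ∀ i, ∀ k ∉ T, fc (v i) k = 0) ∧ D.act v = t}
    with hS
  have hne : S.Nonempty := ⟨_, fun _ _ => 0, ⟨admissible_zero hR, fun i k _ => by simp [fc]⟩, rfl⟩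
  have hbdd : BddBelow S := by
    refine ⟨-D.coerciveConst R, ?_⟩
    rintro _ ⟨v, ⟨hv, -⟩, rfl⟩
    exact D.neg_coerciveConst_le_act hv.smooth hv.mean
  obtain ⟨u, hu, hlim, hmem⟩ := exists_seq_tendsto_sInf hne hbdd
  choose v hv hvu using hmem
  obtain ⟨M, hM, hbound⟩ := D.exists_bound_of_act_le (u 0) R
  have hb : ∀ n i k, ‖fc (v n i) k‖ₑ ≤ M + 1 := by
    intro n i k
    have h1 := hbound (v n) (hv n).1.smooth ((hvu n).trans_le (hu n.zero_le)) (hv n).1.mean i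
    have h2 := (ENNReal.le_tsum k).trans h1
    have h3 : ‖fc (v n i) k‖ₑ ≤ wt k ^ 2 * ‖fc (v n i) k‖ₑ :=
      le_mul_of_one_le_left zero_le (one_le_pow₀ (one_le_wt k))
    refine h3.trans ?_
    rcases le_total (wt k ^ 2 * ‖fc (v n i) k‖ₑ) 1 with h | h
    · exact h.trans le_add_self
    · exact ((le_self_pow₀ h two_ne_zero).trans h2).trans le_self_add
  obtain ⟨c', φ, hφ, hr, hc, hact⟩ := D.exists_subseq_tendsto_act
    (c := fun n i => fc (v n i)) fun s => by
      refine ⟨(∑ k ∈ T, wt k ^ s) * (M + 1), ENNReal.mul_ne_top (ENNReal.sum_ne_top.2 fun k _ =>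
        ENNReal.pow_ne_top (wt_ne_top k)) (ENNReal.add_ne_top.2 ⟨hM, by simp⟩), fun n i k => ?_⟩
      by_cases hk : k ∈ T
      · exact mul_le_mul' (Finset.single_le_sum (f := fun k => wt k ^ s) (fun _ _ => zero_le) hk)
          (hb n i k)
      · simp [(hv n).2 i k hk]
  refine ⟨fun i => ev (c' i), ⟨fun i => smoothPer_ev (hr i), ?_⟩, fun i k hk => ?_,
    fun w hw hw' => ?_⟩
  · rw [fc_ev (hr 0)]
    exact le_of_tendsto (hc 0 0).norm (Eventually.of_forall fun n => (hv (φ n)).1.mean)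
  · rw [fc_ev (hr i)]
    refine tendsto_nhds_unique (hc i k) ?_
    simp only [(hv _).2 i k hk, tendsto_const_nhds]
  · have e : ∀ n, (D.act fun i => ev (fc (v (φ n) i))) = u (φ n) := fun n => by
      rw [← hvu]
      congr 1
      funext i
      exact ((hv (φ n)).1.smooth i).eq_ev.symm
    simp only [e] at hact
    rw [tendsto_nhds_unique hact (hlim.comp hφ.tendsto_atTop)]
    exact csInf_le hbdd ⟨w, ⟨hw, hw'⟩, rfl⟩

theorem eq_zero_or_isCritical {R : ℝ} {T : Finset (ℤ × ℤ)} {v : Fin 3 → ℝ × ℝ → ℂ}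
    (hv : Admissible R v) (hT : ∀ i, ∀ k ∉ T, fc (v i) k = 0)
    (hmin : ∀ w, Admissible R w → (∀ i, ∀ k ∉ T, fc (w i) k = 0) → D.act v ≤ D.act w)
    (j : Fin 3) (κ : ℤ × ℤ) (hκ : κ ≠ 0) : fc (v j) κ = 0 ∨ D.IsCritical v j κ := by
  by_cases hmem : κ ∈ T
  swap
  · exact Or.inl (hT j κ hmem)
  refine Or.inr (D.isCritical_of_forall_le hv.smooth j κ fun z => ?_)
  have hη : ∀ i, SmoothPer fun x => (if i = j then z else 0) * fe κ x := fun i =>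
    (SmoothPer.const _).mul (smoothPer_fe κ)
  have hfc : ∀ i k, k ≠ κ →
      fc (fun x => v i x + (if i = j then z else 0) * fe κ x) k = fc (v i) k := by
    intro i k hk
    rw [fc_add (hv.smooth i).cont (hη i).cont, fc_const_mul, fc_fe, if_neg hk.symm, mul_zero,
      add_zero]
  refine hmin _ ⟨fun i => (hv.smooth i).add (hη i), ?_⟩ fun i k hk => ?_
  · rw [hfc 0 0 hκ.symm]
    exact hv.mean
  · rw [hfc i k fun h => hk (h ▸ hmem)]
    exact hT i k hk

/-- The action attains its minimum on admissible states. -/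
theorem exists_minimizer {R : ℝ} (hR : 0 ≤ R) :
    ∃ v, Admissible R v ∧ ∀ w, Admissible R w → D.act v ≤ D.act w := by
  set T : ℕ → Finset (ℤ × ℤ) := fun n => Finset.Icc (-n, -n) (n, n) with hT
  choose v hv hvT hmin using fun n => D.exists_galerkin_minimizer hR (T n)
  obtain ⟨M, hM, hbound⟩ := D.exists_bound_of_act_le (D.act fun _ _ => 0) R
  have hM' := fun n => hbound (v n) (hv n).smooth
    (hmin n _ (admissible_zero hR) fun i k _ => by simp [fc]) (hv n).mean
  obtain ⟨c', φ, hφ, hr, hc, hact⟩ := D.exists_subseq_tendsto_act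
    (c := fun n i => fc (v n i)) fun s => by
      obtain ⟨B, hB, h⟩ := D.exists_bound_of_isCritical hM s
      exact ⟨B, hB, fun n => h (v n) (hv n).smooth
        (D.eq_zero_or_isCritical (hv n) (hvT n) (hmin n)) (hM' n)⟩
  refine ⟨fun i => ev (c' i), ⟨fun i => smoothPer_ev (hr i), ?_⟩, fun w hw => ?_⟩
  · rw [fc_ev (hr 0)]
    exact le_of_tendsto (hc 0 0).norm (Eventually.of_forall fun n => (hv (φ n)).mean)
  set W : ℕ → Fin 3 → ℤ × ℤ → ℂ := fun n i k => if k ∈ T n then fc (w i) k else 0 with hW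
  have hWr : ∀ n i, Rapid (W n i) := fun n i => rapid_of_finset (T n) fun k hk => if_neg hk
  have hWle : ∀ n i k, ‖W n i k‖ ≤ ‖fc (w i) k‖ := fun n i k => by
    simp only [hW]
    split_ifs
    · exact le_rfl
    · simp
  have hWlim : ∀ i k, Tendsto (fun n => W n i k) atTop (𝓝 (fc (w i) k)) := by
    intro i k
    refine tendsto_const_nhds.congr' ?_
    filter_upwards [eventually_ge_atTop (k.1.natAbs + k.2.natAbs)] with n hn
    refine (if_pos ?_).symm
    simp only [hT, Finset.mem_Icc, Prod.le_def]
    omega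
  have hWact : Tendsto (fun n => D.act fun i => ev (W n i)) atTop (𝓝 (D.act w)) := by
    choose C hC hle using fun i => exists_bound_wt_pow_mul_fc 4 (w i) (hw.smooth i)
    have h := D.tendsto_act (B := ∑ i, C i) (ENNReal.sum_ne_top.2 fun i _ => hC i)
      (fun n i k => ?_) hWr (fun i => (hw.smooth i).rapid) hWlim
    · simpa only [← (hw.smooth _).eq_ev] using h
    · calc wt k ^ 7 * ‖W n i k‖ₑ ≤ wt k ^ (2 * 4) * ‖fc (w i) k‖ₑ := by
            refine mul_le_mul' (pow_le_pow_right₀ (one_le_wt k) (by norm_num)) ?_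
            exact enorm_le_iff_norm_le.2 (hWle n i k)
        _ ≤ C i := hle i k
        _ ≤ ∑ i, C i := Finset.single_le_sum (fun _ _ => zero_le) (Finset.mem_univ i)
  refine le_of_tendsto_of_tendsto' hact (hWact.comp hφ.tendsto_atTop) fun n => ?_
  have e : (fun i => ev (fc (v (φ n) i))) = v (φ n) := by
    funext i
    exact ((hv (φ n)).smooth i).eq_ev.symm
  rw [e]
  refine hmin (φ n) _ ⟨fun i => smoothPer_ev (hWr _ i), ?_⟩ fun i k hk => ?_
  · rw [fc_ev (hWr _ 0)]
    exact (hWle _ 0 0).trans hw.mean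
  · rw [fc_ev (hWr _ i)]
    exact if_neg hk

end GLData

section PartialDerivatives

variable {f g : ℝ × ℝ → ℂ}

theorem pdv_add (hf : Differentiable ℝ f) (hg : Differentiable ℝ g) (k : Fin 2) (x : ℝ × ℝ) :
    pdv k (fun y => f y + g y) x = pdv k f x + pdv k g x := by
  fin_cases k
  · exact pd1_add hf hg x
  · exact pd2_add hf hg x

theorem pdv_mul (hf : Differentiable ℝ f) (hg : Differentiable ℝ g) (k : Fin 2) (x : ℝ × ℝ) :
    pdv k (fun y => f y * g y) x = pdv k f x * g x + f x * pdv k g x := by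
  fin_cases k
  · exact pd1_mul hf hg x
  · exact pd2_mul hf hg x

theorem pdv_conj (hf : Differentiable ℝ f) (k : Fin 2) (x : ℝ × ℝ) :
    pdv k (fun y => (starRingEnd ℂ) (f y)) x = (starRingEnd ℂ) (pdv k f x) := by
  fin_cases k
  · exact pd1_conj hf x
  · exact pd2_conj hf x

theorem pdv_const (c : ℂ) (k : Fin 2) (x : ℝ × ℝ) : pdv k (fun _ => c) x = 0 := by
  fin_cases k
  · exact pd1_const c x
  · exact pd2_const c x

theorem pdv_comp_add (f : ℝ × ℝ → ℂ) (c : ℝ × ℝ) (k : Fin 2) (x : ℝ × ℝ) :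
    pdv k (fun y => f (y + c)) x = pdv k f (x + c) := by
  fin_cases k <;> simp [pd1, pd2, fderiv_comp_add_right]

theorem ContDiff.pdv (hf : ContDiff ℝ (⊤ : ℕ∞) f) (k : Fin 2) :
    ContDiff ℝ (⊤ : ℕ∞) (pdv k f) := by
  fin_cases k
  · exact hf.pd1
  · exact hf.pd2

theorem setIntegral_pdv_eq_zero (hf : SmoothPer f) (k : Fin 2) :
    ∫ x in unitSquare, pdv k f x = 0 := by
  fin_cases k
  · exact setIntegral_pd1_eq_zero hf
  · exact setIntegral_pd2_eq_zero hf

end PartialDerivatives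

/-- Smooth sections of the line bundle of degree `d`. -/
structure QuasiPer (d : ℤ) (f : ℝ × ℝ → ℂ) : Prop where
  smooth : ContDiff ℝ (⊤ : ℕ∞) f
  per1 : ∀ x : ℝ × ℝ, f (x.1 + 1, x.2) = f x
  per2 : ∀ x : ℝ × ℝ, f (x.1, x.2 + 1) = fe (d, 0) x * f x

/-- Smooth connections on the line bundle of degree `d`. -/
structure IsConn (d : ℤ) (a : Fin 2 → ℝ × ℝ → ℝ) : Prop where
  smooth : ∀ k, ContDiff ℝ (⊤ : ℕ∞) (a k)
  per1 : ∀ k, ∀ x : ℝ × ℝ, a k (x.1 + 1, x.2) = a k x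
  per2 : ∀ k, ∀ x : ℝ × ℝ, (a k (x.1, x.2 + 1) : ℂ) = a k x + I * sym k (d, 0)

/-- The covariant derivative in the direction `k`. -/
def cov (a : Fin 2 → ℝ × ℝ → ℝ) (k : Fin 2) (f : ℝ × ℝ → ℂ) (x : ℝ × ℝ) : ℂ :=
  pdv k f x + I * (a k x : ℂ) * f x

theorem contDiff_ofReal_comp {f : ℝ × ℝ → ℝ} (hf : ContDiff ℝ (⊤ : ℕ∞) f) :
    ContDiff ℝ (⊤ : ℕ∞) fun x => (f x : ℂ) := ofRealCLM.contDiff.comp hf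

theorem conj_fe_mul_fe (k : ℤ × ℤ) (x : ℝ × ℝ) : (starRingEnd ℂ) (fe k x) * fe k x = 1 := by
  rw [conj_fe, ← fe_add, neg_add_cancel, fe_zero]

namespace QuasiPer

variable {d : ℤ} {f g : ℝ × ℝ → ℂ} {a : Fin 2 → ℝ × ℝ → ℝ}

theorem diff (hf : QuasiPer d f) : Differentiable ℝ f := hf.smooth.differentiable_top

theorem cont (hf : QuasiPer d f) : Continuous f := hf.smooth.continuous

theorem add (hf : QuasiPer d f) (hg : QuasiPer d g) : QuasiPer d fun x => f x + g x :=
  ⟨hf.smooth.add hg.smooth, fun x => by rw [hf.per1, hg.per1],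
    fun x => by rw [hf.per2, hg.per2]; ring⟩

theorem smul (hf : SmoothPer f) (hg : QuasiPer d g) : QuasiPer d fun x => f x * g x :=
  ⟨hf.smooth.mul hg.smooth, fun x => by rw [hf.per1, hg.per1],
    fun x => by rw [hf.per2, hg.per2]; ring⟩

theorem const_mul (c : ℂ) (hg : QuasiPer d g) : QuasiPer d fun x => c * g x :=
  smul (SmoothPer.const c) hg

theorem conj_mul (hf : QuasiPer d f) (hg : QuasiPer d g) :
    SmoothPer fun x => (starRingEnd ℂ) (f x) * g x :=
  ⟨(conjCLE.contDiff.comp hf.smooth).mul hg.smooth, fun x => by rw [hf.per1, hg.per1],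
    fun x => by
      rw [hf.per2, hg.per2, map_mul]
      linear_combination (starRingEnd ℂ) (f x) * g x * conj_fe_mul_fe (d, 0) x⟩

theorem pdv_per2 (hf : QuasiPer d f) (k : Fin 2) (x : ℝ × ℝ) :
    pdv k f (x.1, x.2 + 1) = fe (d, 0) x * (pdv k f x + sym k (d, 0) * f x) := by
  rw [snd_add_one_eq, ← pdv_comp_add, show (fun y => f (y + (0, 1))) =
    fun y => fe (d, 0) y * f y from funext fun y => by rw [← snd_add_one_eq, hf.per2],
    pdv_mul (smoothPer_fe _).diff hf.diff, pdv_fe]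
  ring

theorem pdv_per1 (hf : QuasiPer d f) (k : Fin 2) (x : ℝ × ℝ) :
    pdv k f (x.1 + 1, x.2) = pdv k f x := by
  rw [fst_add_one_eq, ← pdv_comp_add]
  congr 1
  funext y
  rw [← fst_add_one_eq, hf.per1]

theorem cov (hf : QuasiPer d f) (ha : IsConn d a) (k : Fin 2) : QuasiPer d (cov a k f) := by
  refine ⟨?_, fun x => ?_, fun x => ?_⟩
  · exact (hf.smooth.pdv k).add
      ((contDiff_const.mul (contDiff_ofReal_comp (ha.smooth k))).mul hf.smooth)
  · rw [_root_.cov, hf.pdv_per1, hf.per1, ha.per1, _root_.cov]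
  · rw [_root_.cov, hf.pdv_per2, hf.per2, ha.per2, _root_.cov]
    linear_combination fe (d, 0) x * sym k (d, 0) * f x * I_mul_I

end QuasiPer

theorem pdv_conj_mul_eq {d : ℤ} {f g : ℝ × ℝ → ℂ} (hf : QuasiPer d f) (hg : QuasiPer d g)
    (a : Fin 2 → ℝ × ℝ → ℝ) (k : Fin 2) (x : ℝ × ℝ) :
    pdv k (fun y => (starRingEnd ℂ) (f y) * g y) x =
      (starRingEnd ℂ) (cov a k f x) * g x + (starRingEnd ℂ) (f x) * cov a k g x := by
  have hc : Differentiable ℝ fun y => (starRingEnd ℂ) (f y) :=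
    conjCLE.differentiable.comp hf.diff
  rw [pdv_mul hc hg.diff, pdv_conj hf.diff, cov, cov]
  simp
  ring

/-- A smooth function which is positive exactly on the open unit interval. -/
def bump (s : ℝ) : ℝ := expNegInvGlue s * expNegInvGlue (1 - s)

theorem contDiff_bump : ContDiff ℝ (⊤ : ℕ∞) bump :=
  expNegInvGlue.contDiff.mul (expNegInvGlue.contDiff.comp (contDiff_const.sub contDiff_id))

theorem bump_of_nonpos {s : ℝ} (h : s ≤ 0) : bump s = 0 := by
  rw [bump, expNegInvGlue.zero_of_nonpos h, zero_mul]

theorem bump_of_one_le {s : ℝ} (h : 1 ≤ s) : bump s = 0 := by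
  rw [bump, expNegInvGlue.zero_of_nonpos (sub_nonpos.2 h), mul_zero]

theorem bump_pos {s : ℝ} (h0 : 0 < s) (h1 : s < 1) : 0 < bump s :=
  mul_pos (expNegInvGlue.pos_of_pos h0) (expNegInvGlue.pos_of_pos (sub_pos.2 h1))

/-- A section of the bundle of degree `d` which vanishes exactly where `x.2` is an integer. -/
def bumpSection (d : ℤ) (x : ℝ × ℝ) : ℂ := fe (d * ⌊x.2⌋, 0) x * (bump (Int.fract x.2) : ℂ)

theorem bumpSection_ne_zero (d : ℤ) {x : ℝ × ℝ} (h : 0 < Int.fract x.2) :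
    bumpSection d x ≠ 0 := by
  refine mul_ne_zero (norm_ne_zero_iff.1 ?_) ?_
  · rw [norm_fe]
    exact one_ne_zero
  · exact_mod_cast (bump_pos h (Int.fract_lt_one _)).ne'

theorem quasiPer_bumpSection (d : ℤ) : QuasiPer d (bumpSection d) := by
  refine ⟨contDiff_iff_contDiffAt.2 fun x => ?_, fun x => ?_, fun x => ?_⟩
  · set m := ⌊x.2⌋ with hm
    have hsm : ContDiff ℝ (⊤ : ℕ∞) fun y : ℝ × ℝ =>
        fe (d * m, 0) y * (bump (y.2 - m) : ℂ) +
          fe (d * (m - 1), 0) y * (bump (y.2 - (m - 1)) : ℂ) :=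
      ((smoothPer_fe _).smooth.mul (contDiff_ofReal_comp
        (contDiff_bump.comp (contDiff_snd.sub contDiff_const)))).add
      ((smoothPer_fe _).smooth.mul (contDiff_ofReal_comp
        (contDiff_bump.comp (contDiff_snd.sub contDiff_const))))
    refine hsm.contDiffAt.congr_of_eventuallyEq ?_
    have h1 : (m : ℝ) - 1 < x.2 := by linarith [Int.floor_le x.2]
    have h2 : x.2 < m + 1 := Int.lt_floor_add_one x.2
    filter_upwards [continuous_snd.continuousAt.eventually (lt_mem_nhds h1),
      continuous_snd.continuousAt.eventually (gt_mem_nhds h2)] with y hy1 hy2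
    rcases le_or_gt (m : ℝ) y.2 with h | h
    · have hf : ⌊y.2⌋ = m := Int.floor_eq_iff.2 ⟨h, hy2⟩
      rw [bumpSection, Int.fract, hf, bump_of_one_le (s := y.2 - (m - 1)) (by linarith)]
      simp
    · have hf : ⌊y.2⌋ = m - 1 := Int.floor_eq_iff.2 ⟨by push_cast; exact hy1.le, by
        push_cast; linarith⟩
      rw [bumpSection, Int.fract, hf, bump_of_nonpos (s := y.2 - m) (by linarith)]
      simp
  · simp only [bumpSection, (smoothPer_fe _).per1]
  · simp only [bumpSection, (smoothPer_fe _).per2, Int.floor_add_one, Int.fract_add_one,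
      show ((d * (⌊x.2⌋ + 1), 0) : ℤ × ℤ) = (d, 0) + (d * ⌊x.2⌋, 0) from
        Prod.ext (by simp; ring) (by simp), fe_add, mul_assoc]

/-- The translation of a section in the second variable. -/
theorem QuasiPer.comp_add_snd {d : ℤ} {f : ℝ × ℝ → ℂ} (hf : QuasiPer d f) (c : ℝ) :
    QuasiPer d fun x => f (x.1, x.2 + c) := by
  refine ⟨hf.smooth.comp (contDiff_fst.prodMk (contDiff_snd.add contDiff_const)),
    fun x => hf.per1 (x.1, x.2 + c), fun x => ?_⟩
  rw [show x.2 + 1 + c = x.2 + c + 1 by ring, hf.per2 (x.1, x.2 + c)]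
  simp [fe]

/-- A pair of sections of the bundle of degree `d` without common zeros, normalized. -/
structure Frame (d : ℤ) where
  t : Fin 2 → ℝ × ℝ → ℂ
  quasiPer : ∀ i, QuasiPer d (t i)
  sum_conj_mul : ∀ x, ∑ i, (starRingEnd ℂ) (t i x) * t i x = 1

theorem nonempty_frame (d : ℤ) : Nonempty (Frame d) := by
  set f : Fin 2 → ℝ × ℝ → ℂ :=
    ![bumpSection d, fun x => bumpSection d (x.1, x.2 + 1 / 2)] with hf
  have hq : ∀ i, QuasiPer d (f i) := by
    intro i
    fin_cases i
    · exact quasiPer_bumpSection d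
    · exact (quasiPer_bumpSection d).comp_add_snd _
  set N : ℝ × ℝ → ℝ := fun x => ∑ i, ‖f i x‖ ^ 2 with hN
  have hpos : ∀ x, 0 < N x := by
    intro x
    have h : f 0 x ≠ 0 ∨ f 1 x ≠ 0 := by
      by_cases h : Int.fract x.2 = 0
      · refine Or.inr (bumpSection_ne_zero d ?_)
        have : x.2 = ⌊x.2⌋ := by rw [Int.fract] at h; linarith
        change 0 < Int.fract (x.2 + 1 / 2)
        rw [this, Int.fract_intCast_add, Int.fract_eq_self.2 (by norm_num)]
        norm_num
      · exact Or.inl (bumpSection_ne_zero d ((Int.fract_nonneg _).lt_of_ne' h))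
    simp only [hN, Fin.sum_univ_two]
    rcases h with h | h
    · have := norm_pos_iff.2 h
      positivity
    · have := norm_pos_iff.2 h
      positivity
  have hsm : ContDiff ℝ (⊤ : ℕ∞) fun x => (√(N x))⁻¹ :=
    ((ContDiff.sum fun i _ => (hq i).smooth.norm_sq ℝ).sqrt fun x => (hpos x).ne').inv
      fun x => (Real.sqrt_pos.2 (hpos x)).ne'
  have hper : SmoothPer fun x => (((√(N x))⁻¹ : ℝ) : ℂ) := by
    refine ⟨contDiff_ofReal_comp hsm, fun x => ?_, fun x => ?_⟩
    · simp only [hN, (hq _).per1]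
    · simp only [hN, (hq _).per2, norm_mul, norm_fe, one_mul]
  refine ⟨⟨fun i x => (((√(N x))⁻¹ : ℝ) : ℂ) * f i x, fun i => QuasiPer.smul hper (hq i),
    fun x => ?_⟩⟩
  have h : ∀ i, (starRingEnd ℂ) ((((√(N x))⁻¹ : ℝ) : ℂ) * f i x) *
      ((((√(N x))⁻¹ : ℝ) : ℂ) * f i x) = (((N x)⁻¹ * ‖f i x‖ ^ 2 : ℝ) : ℂ) := by
    intro i
    rw [← Complex.normSq_eq_conj_mul_self, Complex.normSq_eq_norm_sq, norm_mul, mul_pow,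
      Complex.norm_real, Real.norm_eq_abs, sq_abs, inv_pow, Real.sq_sqrt (hpos x).le]
  simp only [h]
  rw [← Complex.ofReal_sum, ← Finset.mul_sum, inv_mul_cancel₀ (hpos x).ne', Complex.ofReal_one]

/-- `∂₁ - i ∂₂`: for a real vector field `w` its real and imaginary parts are the divergence
and the curl. -/
def divCurl (w : ℝ × ℝ → ℂ) (x : ℝ × ℝ) : ℂ := pdv 0 w x - I * pdv 1 w x

theorem SmoothPer.divCurl {w : ℝ × ℝ → ℂ} (hw : SmoothPer w) : SmoothPer (divCurl w) :=
  (hw.pdv 0).sub ((SmoothPer.const I).mul (hw.pdv 1))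

theorem fc_divCurl {w : ℝ × ℝ → ℂ} (hw : SmoothPer w) (κ : ℤ × ℤ) :
    fc (divCurl w) κ = (sym 0 κ - I * sym 1 κ) * fc w κ := by
  unfold divCurl
  rw [fc_sub (hw.pdv 0).cont ((SmoothPer.const I).mul (hw.pdv 1)).cont, fc_const_mul,
    fc_pdv hw, fc_pdv hw]
  ring

theorem sq_norm_sym_sub (κ : ℤ × ℤ) : ‖sym 0 κ - I * sym 1 κ‖ ^ 2 = ∑ k, ‖sym k κ‖ ^ 2 := by
  rw [Fin.sum_univ_two, (norm_sym_sq κ).1, (norm_sym_sq κ).2, ← Complex.normSq_eq_norm_sq,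
    Complex.normSq_apply]
  simp [sym]
  ring

theorem setIntegral_sq_norm_divCurl {w : ℝ × ℝ → ℂ} (hw : SmoothPer w) :
    ∫ x in unitSquare, ‖divCurl w x‖ ^ 2 = ∑ k, ∫ x in unitSquare, ‖pdv k w x‖ ^ 2 := by
  refine (hasSum_sq_norm_fc hw.divCurl).unique ?_
  convert hasSum_sq_norm_pdv hw using 2 with κ
  rw [fc_divCurl hw, norm_mul, mul_pow, sq_norm_sym_sub]

theorem setIntegral_mul_divCurl {g w : ℝ × ℝ → ℂ} (hg : SmoothPer g) (hw : SmoothPer w) :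
    ∫ x in unitSquare, g x * divCurl w x = -∫ x in unitSquare, divCurl g x * w x := by
  have h1 := setIntegral_pd1_mul hg hw
  have h2 := setIntegral_pd2_mul hg hw
  have e1 : ∀ x, g x * divCurl w x = g x * pd1 w x - I * (g x * pd2 w x) := fun x => by
    rw [divCurl, pdv_zero, pdv_one]
    ring
  have e2 : ∀ x, divCurl g x * w x = pd1 g x * w x - I * (pd2 g x * w x) := fun x => by
    rw [divCurl, pdv_zero, pdv_one]
    ring
  simp only [e1, e2]
  rw [integral_sub (integrableOn_unitSquare (hg.mul hw.pd1).cont)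
      (integrableOn_unitSquare ((SmoothPer.const I).mul (hg.mul hw.pd2)).cont),
    integral_sub (integrableOn_unitSquare (hg.pd1.mul hw).cont)
      (integrableOn_unitSquare ((SmoothPer.const I).mul (hg.pd2.mul hw)).cont),
    integral_const_mul, integral_const_mul, h1, h2]
  ring

theorem contDiff_coord (k : Fin 2) : ContDiff ℝ (⊤ : ℕ∞) (coord k) := by
  fin_cases k
  · exact reCLM.contDiff
  · exact imCLM.contDiff

theorem IsConn.add_coord {d : ℤ} {a : Fin 2 → ℝ × ℝ → ℝ} (ha : IsConn d a) {w : ℝ × ℝ → ℂ}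
    (hw : SmoothPer w) : IsConn d fun k x => a k x + coord k (w x) :=
  ⟨fun k => (ha.smooth k).add ((contDiff_coord k).comp hw.smooth),
    fun k x => by rw [ha.per1, hw.per1],
    fun k x => by push_cast; rw [ha.per2, hw.per2]; ring⟩

theorem curv_add_coord {d : ℤ} {a : Fin 2 → ℝ × ℝ → ℝ} (ha : IsConn d a) {w : ℝ × ℝ → ℂ}
    (hw : SmoothPer w) (x : ℝ × ℝ) :
    curv (fun x => a 0 x + coord 0 (w x)) (fun x => a 1 x + coord 1 (w x)) x =
      curv (a 0) (a 1) x + (divCurl w x).im := by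
  have hd : ∀ k, Differentiable ℝ (a k) := fun k => (ha.smooth k).differentiable_top
  have h0 : Differentiable ℝ fun x => coord 0 (w x) :=
    ((contDiff_coord 0).comp hw.smooth).differentiable_top
  have h1 : Differentiable ℝ fun x => coord 1 (w x) :=
    ((contDiff_coord 1).comp hw.smooth).differentiable_top
  have e0 : pd2 (fun x => coord 0 (w x)) x = (pd2 w x).re := pd2_clm reCLM hw.diff x
  have e1 : pd1 (fun x => coord 1 (w x)) x = (pd1 w x).im := pd1_clm imCLM hw.diff x
  rw [curv, curv, pd1_add (hd 1) h1, pd2_add (hd 0) h0, e0, e1, divCurl]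
  simp
  ring

theorem ofReal_curv {d : ℤ} {a : Fin 2 → ℝ × ℝ → ℝ} (ha : IsConn d a) (x : ℝ × ℝ) :
    (curv (a 0) (a 1) x : ℂ) = pdv 0 (fun x => (a 1 x : ℂ)) x - pdv 1 (fun x => (a 0 x : ℂ)) x := by
  have hd : ∀ k, Differentiable ℝ (a k) := fun k => (ha.smooth k).differentiable_top
  rw [pdv_zero, pdv_one, pd1_ofReal (hd 1), pd2_ofReal (hd 0), curv]
  push_cast
  rfl

theorem IsConn.smoothPer_pdv {d : ℤ} {a : Fin 2 → ℝ × ℝ → ℝ} (ha : IsConn d a) (k l : Fin 2) :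
    SmoothPer (pdv k fun x => (a l x : ℂ)) := by
  have hs := contDiff_ofReal_comp (ha.smooth l)
  refine ⟨hs.pdv k, fun x => ?_, fun x => ?_⟩
  · rw [fst_add_one_eq, ← pdv_comp_add]
    congr 1
    funext y
    rw [← fst_add_one_eq, ha.per1]
  · rw [snd_add_one_eq, ← pdv_comp_add, show (fun y => ((a l (y + (0, 1)) : ℝ) : ℂ)) =
      fun y => (a l y : ℂ) + I * sym l (d, 0) from funext fun y => by
        rw [← snd_add_one_eq, ha.per2], pdv_add hs.differentiable_top (differentiable_const _),
      pdv_const, add_zero]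

theorem IsConn.smoothPer_curv {d : ℤ} {a : Fin 2 → ℝ × ℝ → ℝ} (ha : IsConn d a) :
    SmoothPer fun x => (curv (a 0) (a 1) x : ℂ) := by
  simp only [ofReal_curv ha]
  exact (ha.smoothPer_pdv 0 1).sub (ha.smoothPer_pdv 1 0)

theorem IsConn.smoothPer_sub {d : ℤ} {a b : Fin 2 → ℝ × ℝ → ℝ} (ha : IsConn d a)
    (hb : IsConn d b) (k : Fin 2) : SmoothPer fun x => (a k x : ℂ) - b k x :=
  ⟨(contDiff_ofReal_comp (ha.smooth k)).sub (contDiff_ofReal_comp (hb.smooth k)),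
    fun x => by rw [ha.per1, hb.per1], fun x => by rw [ha.per2, hb.per2]; ring⟩

namespace Frame

variable {d : ℤ} (τ : Frame d)

/-- The connection for which the frame is orthogonal to its covariant derivatives. -/
def conn (k : Fin 2) (x : ℝ × ℝ) : ℝ := -(∑ i, (starRingEnd ℂ) (τ.t i x) * pdv k (τ.t i) x).im

theorem I_mul_conn (k : Fin 2) (x : ℝ × ℝ) :
    I * (τ.conn k x : ℂ) = -∑ i, (starRingEnd ℂ) (τ.t i x) * pdv k (τ.t i) x := by
  set S := ∑ i, (starRingEnd ℂ) (τ.t i x) * pdv k (τ.t i) x with hS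
  have hc : ∀ i, Differentiable ℝ fun y => (starRingEnd ℂ) (τ.t i y) := fun i =>
    conjCLE.differentiable.comp (τ.quasiPer i).diff
  have h : (starRingEnd ℂ) S + S = 0 := by
    have h1 : pdv k (fun y => (starRingEnd ℂ) (τ.t 0 y) * τ.t 0 y +
        (starRingEnd ℂ) (τ.t 1 y) * τ.t 1 y) x = 0 := by
      rw [show (fun y => (starRingEnd ℂ) (τ.t 0 y) * τ.t 0 y +
        (starRingEnd ℂ) (τ.t 1 y) * τ.t 1 y) = fun _ => 1 from funext fun y => by
          rw [← τ.sum_conj_mul y, Fin.sum_univ_two], pdv_const]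
    have hm : ∀ i, Differentiable ℝ fun y => (starRingEnd ℂ) (τ.t i y) * τ.t i y := fun i =>
      (hc i).mul (τ.quasiPer i).diff
    rw [pdv_add (hm 0) (hm 1),
      pdv_mul (hc 0) (τ.quasiPer 0).diff, pdv_mul (hc 1) (τ.quasiPer 1).diff,
      pdv_conj (τ.quasiPer 0).diff, pdv_conj (τ.quasiPer 1).diff] at h1
    rw [hS, Fin.sum_univ_two]
    simp only [map_add, map_mul, conj_conj]
    linear_combination h1
  have hre : S.re = 0 := by
    have := congrArg Complex.re h
    simp at this
    linarith
  rw [conn, ← hS]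
  apply Complex.ext <;> simp [hre]

theorem sum_conj_mul_cov (k : Fin 2) (x : ℝ × ℝ) :
    ∑ i, (starRingEnd ℂ) (τ.t i x) * cov τ.conn k (τ.t i) x = 0 := by
  have h1 := τ.sum_conj_mul x
  have h2 := τ.I_mul_conn k x
  rw [Fin.sum_univ_two] at *
  simp only [cov]
  linear_combination I * (τ.conn k x : ℂ) * h1 + h2

theorem isConn_conn : IsConn d τ.conn := by
  refine ⟨fun k => ?_, fun k x => ?_, fun k x => ?_⟩
  · have h : ContDiff ℝ (⊤ : ℕ∞) fun x => ∑ i, (starRingEnd ℂ) (τ.t i x) * pdv k (τ.t i) x :=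
      ContDiff.sum fun i _ => (conjCLE.contDiff.comp (τ.quasiPer i).smooth).mul
        ((τ.quasiPer i).smooth.pdv k)
    exact (imCLM.contDiff.comp h).neg
  · simp only [conn, (τ.quasiPer _).per1, (τ.quasiPer _).pdv_per1]
  · refine mul_left_cancel₀ I_ne_zero ?_
    rw [mul_add, I_mul_conn, I_mul_conn]
    have h1 := τ.sum_conj_mul x
    have h2 := conj_fe_mul_fe (d, 0) x
    rw [Fin.sum_univ_two] at *
    simp only [(τ.quasiPer _).per2, (τ.quasiPer _).pdv_per2, map_mul, Fin.sum_univ_two]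
    linear_combination
      (-(starRingEnd ℂ) (τ.t 0 x) * (pdv k (τ.t 0) x + sym k (d, 0) * τ.t 0 x) -
        (starRingEnd ℂ) (τ.t 1 x) * (pdv k (τ.t 1) x + sym k (d, 0) * τ.t 1 x)) * h2 -
        sym k (d, 0) * h1 - sym k (d, 0) * I_mul_I

theorem sum_sq_norm (x : ℝ × ℝ) : ∑ i, ‖τ.t i x‖ ^ 2 = 1 := by
  have h := τ.sum_conj_mul x
  simp only [← Complex.normSq_eq_conj_mul_self, Complex.normSq_eq_norm_sq] at h
  exact_mod_cast h

theorem norm_sum_mul_sq_le (x : ℝ × ℝ) (z : Fin 2 → ℂ) :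
    ‖∑ i, τ.t i x * z i‖ ^ 2 ≤ ∑ i, ‖z i‖ ^ 2 := by
  calc ‖∑ i, τ.t i x * z i‖ ^ 2 ≤ (∑ i, ‖τ.t i x‖ * ‖z i‖) ^ 2 := by
        gcongr
        exact (norm_sum_le _ _).trans_eq (Finset.sum_congr rfl fun i _ => norm_mul _ _)
    _ ≤ (∑ i, ‖τ.t i x‖ ^ 2) * ∑ i, ‖z i‖ ^ 2 := Finset.sum_mul_sq_le_sq_mul_sq _ _ _
    _ = _ := by rw [sum_sq_norm, one_mul]

theorem re_sum_sum_eq (x : ℝ × ℝ) (z : Fin 2 → ℂ) :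
    (∑ i, ∑ j, (starRingEnd ℂ) (τ.t i x) * τ.t j x * (starRingEnd ℂ) (z i) * z j).re =
      ‖∑ i, τ.t i x * z i‖ ^ 2 := by
  rw [← Complex.normSq_eq_norm_sq, ← Complex.ofReal_re (Complex.normSq _),
    Complex.normSq_eq_conj_mul_self]
  congr 1
  simp only [Fin.sum_univ_two, map_add, map_mul]
  ring

variable {α β : ℝ} (hα : 0 < α) (hβ : 0 < β) {G : ℝ × ℝ → ℝ}
  (hG : SmoothPer fun x => (G x : ℂ))

/-- The functional of the components with respect to the frame. -/
def data : GLData where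
  α := α
  β := β
  q x := I * (starRingEnd ℂ) (divCurl (fun x => (G x : ℂ)) x)
  A k i j x := (starRingEnd ℂ) (τ.t i x) * cov τ.conn k (τ.t j) x -
    (starRingEnd ℂ) (cov τ.conn k (τ.t i) x) * τ.t j x
  P i j x := (starRingEnd ℂ) (τ.t i x) * τ.t j x
  α_pos := hα
  β_pos := hβ
  smooth_q := (SmoothPer.const I).mul hG.divCurl.conj
  smooth_A k i j := ((τ.quasiPer i).conj_mul ((τ.quasiPer j).cov τ.isConn_conn k)).sub
    (((τ.quasiPer i).cov τ.isConn_conn k).conj_mul (τ.quasiPer j))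
  smooth_P i j := (τ.quasiPer i).conj_mul (τ.quasiPer j)
  P_conj i j x := by rw [map_mul, conj_conj, mul_comm]
  P_le x z := (τ.re_sum_sum_eq x z).trans_le (τ.norm_sum_mul_sq_le x z)

end Frame

theorem norm_sub_I_mul_sq (z : ℂ) (g : ℝ) :
    ‖z - I * g‖ ^ 2 = (z.im - g) ^ 2 + z.re ^ 2 := by
  rw [← Complex.normSq_eq_norm_sq, Complex.normSq_apply]
  simp
  ring

theorem setIntegral_im {f : ℝ × ℝ → ℂ} (hf : Continuous f) :
    ∫ x in unitSquare, (f x).im = (∫ x in unitSquare, f x).im :=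
  imCLM.integral_comp_comm (integrableOn_unitSquare hf)

theorem setIntegral_sum_sq_add {G : ℝ × ℝ → ℝ} (hG : SmoothPer fun x => (G x : ℂ))
    {w : ℝ × ℝ → ℂ} (hw : SmoothPer w) :
    (∫ x in unitSquare, (∑ k, ‖pdv k w x‖ ^ 2 +
      2 * (I * (starRingEnd ℂ) (divCurl (fun x => (G x : ℂ)) x) * (starRingEnd ℂ) (w x)).re)) +
      (∫ x in unitSquare, G x ^ 2) = ∫ x in unitSquare, ‖divCurl w x - I * G x‖ ^ 2 := by
  have hGc : Continuous G := Complex.continuous_re.comp hG.cont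
  have hp : ∀ k, Continuous (pdv k w) := fun k => (hw.pdv k).cont
  have hwc := hw.cont
  have hd := hw.divCurl.cont
  have hdG := hG.divCurl.cont
  have e1 : ∀ x, (I * (starRingEnd ℂ) (divCurl (fun x => (G x : ℂ)) x) *
      (starRingEnd ℂ) (w x)).re = (divCurl (fun x => (G x : ℂ)) x * w x).im := fun x => by
    simp
    ring
  have e2 : ∀ x, ‖divCurl w x - I * G x‖ ^ 2 =
      ‖divCurl w x‖ ^ 2 - 2 * ((G x : ℂ) * divCurl w x).im + G x ^ 2 := fun x => by
    rw [norm_sub_I_mul_sq, ← Complex.normSq_eq_norm_sq, Complex.normSq_apply]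
    simp
    ring
  have h := congrArg Complex.im (setIntegral_mul_divCurl hG hw)
  rw [Complex.neg_im, ← setIntegral_im (by fun_prop), ← setIntegral_im (by fun_prop)] at h
  have him := Complex.continuous_im
  simp only [e1, e2]
  generalize divCurl (fun x => (G x : ℂ)) = g at *
  rw [integral_add (integrableOn_unitSquare (by fun_prop)) (integrableOn_unitSquare (by fun_prop)),
    integral_add (integrableOn_unitSquare (by fun_prop)) (integrableOn_unitSquare (by fun_prop)),
    integral_sub (integrableOn_unitSquare (by fun_prop)) (integrableOn_unitSquare (by fun_prop)),
    integral_const_mul, integral_const_mul, setIntegral_sq_norm_divCurl hw, h,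
    integral_finsetSum _ fun k _ => integrableOn_unitSquare (by fun_prop)]
  ring

namespace Frame

variable {d : ℤ} (τ : Frame d)

/-- The connection determined by periodic fields. -/
def toConn (v : Fin 3 → ℝ × ℝ → ℂ) (k : Fin 2) (x : ℝ × ℝ) : ℝ := τ.conn k x + coord k (v 0 x)

/-- The section determined by periodic fields. -/
def toSec (v : Fin 3 → ℝ × ℝ → ℂ) (x : ℝ × ℝ) : ℂ := ∑ i : Fin 2, τ.t i x * v i.succ x

variable {v : Fin 3 → ℝ × ℝ → ℂ}

theorem isConn_toConn (hv : ∀ i, SmoothPer (v i)) : IsConn d (τ.toConn v) :=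
  τ.isConn_conn.add_coord (hv 0)

theorem quasiPer_toSec (hv : ∀ i, SmoothPer (v i)) : QuasiPer d (τ.toSec v) := by
  unfold toSec
  simp only [Fin.sum_univ_two, mul_comm (τ.t _ _)]
  exact (QuasiPer.smul (hv _) (τ.quasiPer 0)).add (QuasiPer.smul (hv _) (τ.quasiPer 1))

variable {α β : ℝ} (hα : 0 < α) (hβ : 0 < β) {G : ℝ × ℝ → ℝ}
  (hG : SmoothPer fun x => (G x : ℂ))

theorem cov_toSec (hv : ∀ i, SmoothPer (v i)) (k : Fin 2) (x : ℝ × ℝ) :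
    cov (τ.toConn v) k (τ.toSec v) x =
      ∑ i, τ.t i x * (pdv k (v i.succ) x + (τ.data hα hβ hG).low x (fun i => v i x) k i) := by
  have h0 := congrArg (starRingEnd ℂ) (τ.sum_conj_mul_cov k x)
  have h1 := τ.sum_conj_mul x
  have hd : ∀ i : Fin 2, Differentiable ℝ fun y => τ.t i y * v i.succ y := fun i =>
    (τ.quasiPer i).diff.mul (hv i.succ).diff
  have e : pdv k (τ.toSec v) x = pdv k (τ.t 0) x * v 1 x + τ.t 0 x * pdv k (v 1) x +
      (pdv k (τ.t 1) x * v 2 x + τ.t 1 x * pdv k (v 2) x) := by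
    unfold toSec
    simp only [Fin.sum_univ_two]
    rw [pdv_add (hd 0) (hd 1), pdv_mul (τ.quasiPer 0).diff (hv _).diff,
      pdv_mul (τ.quasiPer 1).diff (hv _).diff]
    rfl
  rw [cov, e]
  simp only [Fin.sum_univ_two, map_add, map_mul, map_zero, conj_conj] at h0 h1
  simp only [GLData.low, data, toConn, toSec, Fin.sum_univ_two, Fin.succ_zero_eq_one,
    Fin.succ_one_eq_two]
  have c0 : cov τ.conn k (τ.t 0) x = pdv k (τ.t 0) x + I * (τ.conn k x : ℂ) * τ.t 0 x := rfl
  have c1 : cov τ.conn k (τ.t 1) x = pdv k (τ.t 1) x + I * (τ.conn k x : ℂ) * τ.t 1 x := rfl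
  push_cast
  linear_combination (τ.t 0 x * v 1 x + τ.t 1 x * v 2 x) * h0 -
    (cov τ.conn k (τ.t 0) x * v 1 x + cov τ.conn k (τ.t 1) x * v 2 x) * h1 -
    v 1 x * c0 - v 2 x * c1

theorem act_data_add (hv : ∀ i, SmoothPer (v i)) :
    (τ.data hα hβ hG).act v + (∫ x in unitSquare, G x ^ 2) =
    ∫ x in unitSquare, (‖divCurl (v 0) x - I * G x‖ ^ 2 +
      (∑ k, ∑ i : Fin 2,
        ‖pdv k (v i.succ) x + (τ.data hα hβ hG).low x (fun i => v i x) k i‖ ^ 2 -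
      α * ‖τ.toSec v x‖ ^ 2 + β / 2 * (∑ i : Fin 2, ‖v i.succ x‖ ^ 2) ^ 2)) := by
  have hGc : Continuous G := Complex.continuous_re.comp hG.cont
  have hvc : ∀ i, Continuous (v i) := fun i => (hv i).cont
  have hp : ∀ k i, Continuous (pdv k (v i)) := fun k i => ((hv i).pdv k).cont
  have hd := (hv 0).divCurl.cont
  have hdG := hG.divCurl.cont
  have hs := (τ.quasiPer_toSec hv).cont
  have hre := Complex.continuous_re
  have hconj := Complex.continuous_conj
  have hc : Continuous fun x => ∑ k, ‖pdv k (v 0) x‖ ^ 2 + 2 *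
      (I * (starRingEnd ℂ) (divCurl (fun x => (G x : ℂ)) x) * (starRingEnd ℂ) (v 0 x)).re := by
    generalize divCurl (fun x => (G x : ℂ)) = g at *
    fun_prop
  have hl : ∀ k i, Continuous fun x => (τ.data hα hβ hG).low x (fun i => v i x) k i := fun k i =>
    ((τ.data hα hβ hG).continuous_low k i).comp (f := fun x => (x, fun i => v i x)) (by fun_prop)
  rw [integral_add (integrableOn_unitSquare (by fun_prop)) (integrableOn_unitSquare (by fun_prop)),
    ← setIntegral_sum_sq_add hG (hv 0), add_right_comm,
    ← integral_add (integrableOn_unitSquare hc) (integrableOn_unitSquare (by fun_prop))]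
  congr 1
  refine integral_congr_ae (Filter.Eventually.of_forall fun x => ?_)
  have h := τ.re_sum_sum_eq x fun i => v i.succ x
  have h' : ((∑ i : Fin 2, ∑ j : Fin 2, (τ.data hα hβ hG).P i j x *
      (starRingEnd ℂ) (v i.succ x) * v j.succ x).re) = ‖τ.toSec v x‖ ^ 2 := h
  simp only [GLData.lag, h']
  simp only [data]
  ring

end Frame

/-- Twice the free energy, in terms of a connection and a section. -/
def dblEnergy (α β : ℝ) (F₀ : ℝ × ℝ → ℝ) (a : Fin 2 → ℝ × ℝ → ℝ) (f : ℝ × ℝ → ℂ) : ℝ :=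
  ∫ x in unitSquare, ((curv (a 0) (a 1) x - F₀ x) ^ 2 + ∑ k, ‖cov a k f x‖ ^ 2 -
    α * ‖f x‖ ^ 2 + β / 2 * ‖f x‖ ^ 4)

theorem continuous_dblEnergy_density {d : ℤ} {a : Fin 2 → ℝ × ℝ → ℝ} {f : ℝ × ℝ → ℂ}
    (ha : IsConn d a) (hf : QuasiPer d f) {F₀ : ℝ × ℝ → ℝ} (hF : Continuous F₀) (α β : ℝ) :
    Continuous fun x => (curv (a 0) (a 1) x - F₀ x) ^ 2 + ∑ k, ‖cov a k f x‖ ^ 2 -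
      α * ‖f x‖ ^ 2 + β / 2 * ‖f x‖ ^ 4 := by
  have h1 : Continuous (curv (a 0) (a 1)) := Complex.continuous_re.comp ha.smoothPer_curv.cont
  have h2 : ∀ k, Continuous (cov a k f) := fun k => (hf.cov ha k).cont
  have h3 := hf.cont
  fun_prop

namespace FieldPair

variable {d : ℤ}

theorem isConn (P : FieldPair d) : IsConn d ![P.a1, P.a2] := by
  refine ⟨fun k => ?_, fun k x => ?_, fun k x => ?_⟩ <;> fin_cases k
  · exact P.smooth_a1
  · exact P.smooth_a2
  · exact P.per1_a1 x
  · exact P.per1_a2 x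
  · have h := P.per2_a1 x
    simp only [sym, Fin.zero_eta, Matrix.cons_val_zero, h]
    push_cast
    linear_combination (2 * Real.pi * d : ℂ) * I_mul_I.symm
  · simp [sym, P.per2_a2 x]

theorem quasiPer (P : FieldPair d) : QuasiPer d P.φ :=
  ⟨P.smooth_φ, P.per1_φ, fun x => by
    rw [P.per2_φ, fe]
    congr 2
    push_cast
    ring⟩

/-- The field pair given by a connection and a section. -/
def ofConn {a : Fin 2 → ℝ × ℝ → ℝ} {f : ℝ × ℝ → ℂ} (ha : IsConn d a) (hf : QuasiPer d f) :
    FieldPair d where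
  a1 := a 0
  a2 := a 1
  φ := f
  smooth_a1 := ha.smooth 0
  smooth_a2 := ha.smooth 1
  smooth_φ := hf.smooth
  per1_a1 := ha.per1 0
  per1_a2 := ha.per1 1
  per1_φ := hf.per1
  per2_a2 x := by
    have h := ha.per2 1 x
    simpa [sym] using h
  per2_a1 x := by
    have h := congrArg Complex.re (ha.per2 0 x)
    simpa [sym, sub_eq_add_neg] using h
  per2_φ x := by
    rw [hf.per2, fe]
    congr 2
    push_cast
    ring

theorem energy_eq (α β : ℝ) (F₀ : ℝ × ℝ → ℝ) (P : FieldPair d) :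
    energy α β F₀ P = 1 / 2 * dblEnergy α β F₀ ![P.a1, P.a2] P.φ := by
  unfold energy dblEnergy
  simp only [Fin.sum_univ_two, ← add_assoc]
  rfl

theorem energy_ofConn (α β : ℝ) (F₀ : ℝ × ℝ → ℝ) {a : Fin 2 → ℝ × ℝ → ℝ} {f : ℝ × ℝ → ℂ}
    (ha : IsConn d a) (hf : QuasiPer d f) :
    energy α β F₀ (ofConn ha hf) = 1 / 2 * dblEnergy α β F₀ a f := by
  unfold energy dblEnergy
  simp only [Fin.sum_univ_two, ← add_assoc]
  rfl

end FieldPair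

namespace Frame

variable {d : ℤ} (τ : Frame d) {v : Fin 3 → ℝ × ℝ → ℂ} {α β : ℝ} (hα : 0 < α) (hβ : 0 < β)
  {F₀ : ℝ × ℝ → ℝ} (hG : SmoothPer fun x => ((F₀ x - curv (τ.conn 0) (τ.conn 1) x : ℝ) : ℂ))

theorem dblEnergy_le (hF : Continuous F₀) (hv : ∀ i, SmoothPer (v i)) :
    dblEnergy α β F₀ (τ.toConn v) (τ.toSec v) ≤ (τ.data hα hβ hG).act v +
      (∫ x in unitSquare, (F₀ x - curv (τ.conn 0) (τ.conn 1) x) ^ 2) := by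
  rw [τ.act_data_add hα hβ hG hv]
  have hGc : Continuous fun x => F₀ x - curv (τ.conn 0) (τ.conn 1) x :=
    Complex.continuous_re.comp hG.cont
  have hvc : ∀ i, Continuous (v i) := fun i => (hv i).cont
  have hp : ∀ k i, Continuous (pdv k (v i)) := fun k i => ((hv i).pdv k).cont
  have hd := (hv 0).divCurl.cont
  have hs := (τ.quasiPer_toSec hv).cont
  have hl : ∀ k i, Continuous fun x => (τ.data hα hβ hG).low x (fun i => v i x) k i := fun k i =>
    ((τ.data hα hβ hG).continuous_low k i).comp (f := fun x => (x, fun i => v i x)) (by fun_prop)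
  refine setIntegral_mono_unitSquare
    (continuous_dblEnergy_density (τ.isConn_toConn hv) (τ.quasiPer_toSec hv) hF α β)
    (by fun_prop) fun x _ => ?_
  have h1 : (curv (τ.toConn v 0) (τ.toConn v 1) x - F₀ x) ^ 2 ≤
      ‖divCurl (v 0) x - I * (F₀ x - curv (τ.conn 0) (τ.conn 1) x : ℝ)‖ ^ 2 := by
    have h : curv (τ.toConn v 0) (τ.toConn v 1) x =
      curv (τ.conn 0) (τ.conn 1) x + (divCurl (v 0) x).im :=
      curv_add_coord τ.isConn_conn (hv 0) x
    rw [norm_sub_I_mul_sq, h]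
    nlinarith [sq_nonneg (divCurl (v 0) x).re]
  have h2 : ∑ k, ‖cov (τ.toConn v) k (τ.toSec v) x‖ ^ 2 ≤ ∑ k, ∑ i : Fin 2,
      ‖pdv k (v i.succ) x + (τ.data hα hβ hG).low x (fun i => v i x) k i‖ ^ 2 :=
    Finset.sum_le_sum fun k _ => by
      rw [τ.cov_toSec hα hβ hG hv]
      exact τ.norm_sum_mul_sq_le x _
  have h3 : β / 2 * ‖τ.toSec v x‖ ^ 4 ≤ β / 2 * (∑ i : Fin 2, ‖v i.succ x‖ ^ 2) ^ 2 := by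
    have := τ.norm_sum_mul_sq_le x fun i => v i.succ x
    rw [show ‖τ.toSec v x‖ ^ 4 = (‖τ.toSec v x‖ ^ 2) ^ 2 by ring]
    gcongr
    exact this
  linarith

end Frame

theorem pdv_sub {f g : ℝ × ℝ → ℂ} (hf : Differentiable ℝ f) (hg : Differentiable ℝ g)
    (k : Fin 2) (x : ℝ × ℝ) : pdv k (fun y => f y - g y) x = pdv k f x - pdv k g x := by
  fin_cases k
  · exact pd1_sub hf hg x
  · exact pd2_sub hf hg x

theorem pdv_comm {f : ℝ × ℝ → ℂ} (hf : ContDiff ℝ (⊤ : ℕ∞) f) (k l : Fin 2) (x : ℝ × ℝ) :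
    pdv k (pdv l f) x = pdv l (pdv k f) x := by
  fin_cases k <;> fin_cases l
  · rfl
  · exact pd1_pd2_comm hf x
  · exact (pd1_pd2_comm hf x).symm
  · rfl

theorem pdv_cexp {f : ℝ × ℝ → ℂ} (hf : Differentiable ℝ f) (k : Fin 2) (x : ℝ × ℝ) :
    pdv k (fun y => exp (f y)) x = exp (f x) * pdv k f x := by
  fin_cases k <;> simp [pd1, pd2, (hf x).hasFDerivAt.cexp.fderiv]

theorem sym_sq (k : Fin 2) (κ : ℤ × ℤ) : sym k κ ^ 2 = -((‖sym k κ‖ ^ 2 : ℝ) : ℂ) := by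
  rw [← Complex.normSq_eq_norm_sq, Complex.normSq_eq_conj_mul_self, conj_sym]
  ring

theorem norm_sym_neg (k : Fin 2) (κ : ℤ × ℤ) : ‖sym k (-κ)‖ = ‖sym k κ‖ := by
  fin_cases k <;> simp [sym]

theorem sym_zero (k : Fin 2) : sym k 0 = 0 := by
  fin_cases k <;> simp [sym]

theorem eq_of_fc_eq {f g : ℝ × ℝ → ℂ} (hf : SmoothPer f) (hg : SmoothPer g)
    (h : ∀ κ, fc f κ = fc g κ) : f = g := by
  rw [hf.eq_ev, hg.eq_ev, funext h]

theorem fc_add_fun {f g : ℝ × ℝ → ℂ} (hf : SmoothPer f) (hg : SmoothPer g) (κ : ℤ × ℤ) :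
    fc (fun x => f x + g x) κ = fc f κ + fc g κ := fc_add hf.cont hg.cont κ

/-- Poisson's equation on the torus, for real functions. -/
theorem exists_laplacian_eq {g : ℝ × ℝ → ℂ} (hg : SmoothPer g) (h0 : fc g 0 = 0)
    (hr : ∀ x, (starRingEnd ℂ) (g x) = g x) :
    ∃ χ : ℝ × ℝ → ℝ, SmoothPer (fun x => (χ x : ℂ)) ∧
      ∀ x, ∑ k, pdv k (pdv k fun x => (χ x : ℂ)) x = g x := by
  set S : ℤ × ℤ → ℝ := fun κ => ∑ k, ‖sym k κ‖ ^ 2 with hS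
  set c : ℤ × ℤ → ℂ := fun κ => -fc g κ / S κ with hc
  have hS1 : ∀ κ, κ ≠ 0 → 1 ≤ S κ := fun κ hκ => by
    refine le_trans ?_ (sq_add_sq_le_sum_norm_sym_sq κ)
    have : (1 : ℤ) ≤ κ.1 ^ 2 + κ.2 ^ 2 := by
      by_contra! h
      apply hκ
      have e1 : κ.1 ^ 2 = 0 := by nlinarith [sq_nonneg κ.1, sq_nonneg κ.2]
      have e2 : κ.2 ^ 2 = 0 := by nlinarith [sq_nonneg κ.1, sq_nonneg κ.2]
      exact Prod.ext (pow_eq_zero_iff two_ne_zero |>.1 e1) (pow_eq_zero_iff two_ne_zero |>.1 e2)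
    exact_mod_cast this
  have hSc : ∀ κ, S κ * c κ = -fc g κ := fun κ => by
    rcases eq_or_ne κ 0 with rfl | hκ
    · simp [hc, h0]
    · have : (S κ : ℂ) ≠ 0 := by exact_mod_cast (zero_lt_one.trans_le (hS1 κ hκ)).ne'
      simp only [hc]
      field_simp
  have hrc : Rapid c := hg.rapid.of_le ENNReal.one_ne_top 0 fun κ => by
    rw [pow_zero, one_mul, one_mul, ← ofReal_norm, ← ofReal_norm]
    refine ENNReal.ofReal_le_ofReal ?_
    rcases eq_or_ne κ 0 with rfl | hκ
    · simp [hc, h0]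
    · have := hS1 κ hκ
      simp only [hc]
      rw [norm_div, norm_neg, Complex.norm_real, Real.norm_of_nonneg (by linarith)]
      exact div_le_self (norm_nonneg _) this
  have he := smoothPer_ev hrc
  have hreal : (fun x => (starRingEnd ℂ) (ev c x)) = ev c := by
    refine eq_of_fc_eq he.conj he fun κ => ?_
    have h1 : fc g κ = (starRingEnd ℂ) (fc g (-κ)) := by
      rw [← fc_conj]
      simp only [hr]
    rw [fc_conj, fc_ev hrc]
    simp only [hc, hS, norm_sym_neg, map_div₀, map_neg, conj_ofReal, ← h1]
  have hre : (fun x => ((ev c x).re : ℂ)) = ev c := funext fun x =>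
    Complex.conj_eq_iff_re.1 (congrFun hreal x)
  refine ⟨fun x => (ev c x).re, by rwa [hre], fun x => ?_⟩
  rw [hre]
  refine congrFun (f := fun x => ∑ k, pdv k (pdv k (ev c)) x) (eq_of_fc_eq ?_ hg fun κ => ?_) x
  · simp only [Fin.sum_univ_two]
    exact ((he.pdv 0).pdv 0).add ((he.pdv 1).pdv 1)
  · simp only [Fin.sum_univ_two]
    rw [fc_add_fun ((he.pdv 0).pdv 0) ((he.pdv 1).pdv 1), fc_pdv (he.pdv 0), fc_pdv (he.pdv 1),
      fc_pdv he, fc_pdv he, fc_ev hrc]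
    have h1 := hSc κ
    simp only [hS, Fin.sum_univ_two] at h1
    push_cast at h1
    have h2 := sym_sq 0 κ
    have h3 := sym_sq 1 κ
    push_cast at h2 h3
    linear_combination c κ * h2 + c κ * h3 - h1

namespace Frame

variable {d : ℤ} (τ : Frame d) {α β : ℝ} (hα : 0 < α) (hβ : 0 < β)

/-- The periodic fields representing the section `g`. -/
def ofSec (w g : ℝ × ℝ → ℂ) : Fin 3 → ℝ × ℝ → ℂ :=
  Fin.cons w fun i x => (starRingEnd ℂ) (τ.t i x) * g x

theorem smoothPer_ofSec {w g : ℝ × ℝ → ℂ} (hw : SmoothPer w) (hg : QuasiPer d g) (i : Fin 3) :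
    SmoothPer (τ.ofSec w g i) := by
  refine Fin.cases hw (fun i => ?_) i
  exact (τ.quasiPer i).conj_mul hg

theorem toSec_ofSec (w g : ℝ × ℝ → ℂ) : τ.toSec (τ.ofSec w g) = g := by
  funext x
  have h := τ.sum_conj_mul x
  simp only [toSec, ofSec, Fin.cons_succ, Fin.sum_univ_two] at h ⊢
  linear_combination g x * h

theorem sum_norm_conj_mul_sq (x : ℝ × ℝ) (z : ℂ) :
    ∑ i, ‖(starRingEnd ℂ) (τ.t i x) * z‖ ^ 2 = ‖z‖ ^ 2 := by
  simp only [norm_mul, RCLike.norm_conj, mul_pow, ← Finset.sum_mul, τ.sum_sq_norm, one_mul]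

theorem pdv_add_low_ofSec {G : ℝ × ℝ → ℝ} (hG : SmoothPer fun x => (G x : ℂ))
    (w : ℝ × ℝ → ℂ) {g : ℝ × ℝ → ℂ} (hg : QuasiPer d g) (k i : Fin 2)
    (x : ℝ × ℝ) :
    pdv k (τ.ofSec w g i.succ) x + (τ.data hα hβ hG).low x (fun i => τ.ofSec w g i x) k i =
      (starRingEnd ℂ) (τ.t i x) * cov (fun k x => τ.conn k x + coord k (w x)) k g x := by
  have h0 := τ.sum_conj_mul_cov k x
  have h0' := congrArg (starRingEnd ℂ) h0
  have h1 := τ.sum_conj_mul x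
  have e := pdv_conj_mul_eq (τ.quasiPer i) hg τ.conn k x
  simp only [ofSec, Fin.cons_succ, GLData.low, data, Fin.sum_univ_two, Fin.cons_zero, map_add,
    map_mul, map_zero, conj_conj] at h0 h0' h1 e ⊢
  rw [e]
  simp only [cov] at h0 h0' ⊢
  push_cast
  simp only [map_add, map_mul, conj_I, conj_ofReal] at h0 h0' ⊢
  linear_combination (starRingEnd ℂ) (τ.t i x) * g x * h0 -
    ((starRingEnd ℂ) (pdv k (τ.t i) x) + -I * τ.conn k x * (starRingEnd ℂ) (τ.t i x)) * g x * h1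

/-- Each pair is gauge equivalent to one in Coulomb gauge with bounded mean, for which the
two functionals agree. -/
theorem exists_gauge {a : Fin 2 → ℝ × ℝ → ℝ} {f : ℝ × ℝ → ℂ} (ha : IsConn d a)
    (hf : QuasiPer d f) : ∃ w g, SmoothPer w ∧ QuasiPer d g ∧ ‖fc w 0‖ ≤ 10 ∧
      (∀ x, ‖g x‖ = ‖f x‖) ∧
      (∀ k x, ‖cov (fun k x => τ.conn k x + coord k (w x)) k g x‖ = ‖cov a k f x‖) ∧
      ∀ x, divCurl w x = I * (curv (a 0) (a 1) x - curv (τ.conn 0) (τ.conn 1) x) := by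
  have hb : ∀ k, SmoothPer fun x => (a k x : ℂ) - τ.conn k x := ha.smoothPer_sub τ.isConn_conn
  set b : Fin 2 → ℝ × ℝ → ℂ := fun k x => (a k x : ℂ) - τ.conn k x with hbd
  obtain ⟨χ, hχ, hlap⟩ := exists_laplacian_eq (((hb 0).pdv 0).add ((hb 1).pdv 1))
    (by rw [fc_add_fun ((hb 0).pdv 0) ((hb 1).pdv 1), fc_pdv (hb 0), fc_pdv (hb 1), sym_zero,
      sym_zero]; ring)
    (fun x => by
      rw [map_add, ← pdv_conj (hb 0).diff, ← pdv_conj (hb 1).diff]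
      simp only [map_sub, conj_ofReal])
  set e : Fin 2 → ℝ × ℝ → ℂ := fun k => pdv k fun x => (χ x : ℂ) with hed
  have he : ∀ k, SmoothPer (e k) := fun k => hχ.pdv k
  have hereal : ∀ k x, ((e k x).re : ℂ) = e k x := fun k x => by
    refine Complex.conj_eq_iff_re.1 ?_
    simp only [hed]
    rw [← pdv_conj hχ.diff]
    simp only [conj_ofReal]
  set w₀ : ℝ × ℝ → ℂ := fun x => b 0 x - e 0 x + I * (b 1 x - e 1 x) with hw₀
  have hw₀s : SmoothPer w₀ :=
    ((hb 0).sub (he 0)).add ((SmoothPer.const I).mul ((hb 1).sub (he 1)))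
  set n : ℤ × ℤ := (round ((fc w₀ 0).re / (2 * Real.pi)), round ((fc w₀ 0).im / (2 * Real.pi)))
    with hn
  have hcs : SmoothPer fun _ => (2 * Real.pi * (n.1 + I * n.2) : ℂ) := SmoothPer.const _
  have hcoord : ∀ k x, ((τ.conn k x + coord k (w₀ x - 2 * Real.pi * (n.1 + I * n.2)) : ℝ) : ℂ) =
      a k x - e k x + I * sym k n := fun k x => by
    rw [← hereal k x]
    have hw : w₀ x - 2 * Real.pi * (n.1 + I * n.2) =
        ((a 0 x - τ.conn 0 x - (e 0 x).re - 2 * Real.pi * n.1 : ℝ) : ℂ) +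
        ((a 1 x - τ.conn 1 x - (e 1 x).re - 2 * Real.pi * n.2 : ℝ) : ℂ) * I := by
      simp only [hw₀, hbd]
      push_cast
      linear_combination hereal 0 x + I * hereal 1 x
    rw [hw]
    fin_cases k
    · rw [Fin.zero_eta, coord_zero, Complex.add_re, Complex.ofReal_re, Complex.re_ofReal_mul, I_re]
      simp only [sym, Matrix.cons_val_zero]
      push_cast
      linear_combination (-2 * Real.pi * n.1 : ℂ) * I_mul_I
    · rw [Fin.mk_one, coord_one, Complex.add_im, Complex.ofReal_im, Complex.im_ofReal_mul, I_im]
      simp only [sym, Matrix.cons_val_one]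
      push_cast
      linear_combination (-2 * Real.pi * n.2 : ℂ) * I_mul_I
  have hψ1 : SmoothPer fun x => exp (I * χ x) :=
    ⟨((SmoothPer.const I).mul hχ).smooth.cexp, fun x => by rw [hχ.per1], fun x => by rw [hχ.per2]⟩
  have hψ := hψ1.mul (smoothPer_fe n)
  have hψn : ∀ x, ‖exp (I * χ x) * fe n x‖ = 1 := fun x => by
    rw [norm_mul, norm_fe, mul_comm I, norm_exp_ofReal_mul_I, one_mul]
  have hψd : ∀ k x, pdv k (fun y => exp (I * χ y) * fe n y) x =
      (I * e k x + sym k n) * (exp (I * χ x) * fe n x) := fun k x => by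
    rw [pdv_mul hψ1.diff (smoothPer_fe n).diff, pdv_fe, pdv_cexp ((SmoothPer.const I).mul hχ).diff,
      pdv_mul (SmoothPer.const I).diff hχ.diff, pdv_const]
    ring
  refine ⟨fun x => w₀ x - 2 * Real.pi * (n.1 + I * n.2),
    fun x => (exp (I * χ x) * fe n x) * f x, hw₀s.sub hcs, QuasiPer.smul hψ hf, ?_,
    fun x => by rw [norm_mul, hψn, one_mul], fun k x => ?_, fun x => ?_⟩
  · have hc1 : fc (fun _ => (2 * Real.pi * (n.1 + I * n.2) : ℂ)) 0 =
        2 * Real.pi * (n.1 + I * n.2) := by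
      have := fc_const_mul (2 * Real.pi * (n.1 + I * n.2)) (fe 0) 0
      rw [fc_fe, if_pos rfl, mul_one] at this
      simpa only [fe_zero, mul_one] using this
    rw [fc_sub hw₀s.cont hcs.cont, hc1]
    have hr : ∀ r : ℝ, |r - 2 * Real.pi * round (r / (2 * Real.pi))| ≤ Real.pi := fun r => by
      have h1 := abs_sub_round (r / (2 * Real.pi))
      have hpi := Real.pi_pos
      have h2 : r - 2 * Real.pi * round (r / (2 * Real.pi)) =
          2 * Real.pi * (r / (2 * Real.pi) - round (r / (2 * Real.pi))) := by
        field_simp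
      rw [h2, abs_mul, abs_of_pos (by positivity)]
      nlinarith
    refine (Complex.norm_le_abs_re_add_abs_im _).trans ?_
    have h1 := hr (fc w₀ 0).re
    have h2 := hr (fc w₀ 0).im
    have hpi := Real.pi_lt_four
    have e1 : (2 * Real.pi * (n.1 + I * n.2) : ℂ) =
        ((2 * Real.pi * n.1 : ℝ) : ℂ) + ((2 * Real.pi * n.2 : ℝ) : ℂ) * I := by
      push_cast
      ring
    rw [e1, Complex.sub_re, Complex.sub_im, Complex.add_re, Complex.add_im, Complex.ofReal_re,
      Complex.ofReal_im, Complex.re_ofReal_mul, Complex.im_ofReal_mul, I_re, I_im, mul_zero,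
      mul_one, add_zero, zero_add]
    linarith
  · have : cov (fun k x => τ.conn k x + coord k (w₀ x - 2 * Real.pi * (n.1 + I * n.2))) k
        (fun x => (exp (I * χ x) * fe n x) * f x) x =
        (exp (I * χ x) * fe n x) * cov a k f x := by
      rw [cov, cov, pdv_mul hψ.diff hf.diff, hψd, hcoord]
      linear_combination sym k n * (exp (I * χ x) * fe n x) * f x * I_mul_I
    rw [this, norm_mul, hψn, one_mul]
  · rw [ofReal_curv ha, ofReal_curv τ.isConn_conn]
    have hp : ∀ k, pdv k (fun y => w₀ y - 2 * Real.pi * (n.1 + I * n.2)) x =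
        pdv k (b 0) x - pdv k (e 0) x + I * (pdv k (b 1) x - pdv k (e 1) x) := fun k => by
      have h0 : Differentiable ℝ fun y => b 0 y - e 0 y := ((hb 0).sub (he 0)).diff
      have h1 : Differentiable ℝ fun y => b 1 y - e 1 y := ((hb 1).sub (he 1)).diff
      have h2 : Differentiable ℝ fun y => I * (b 1 y - e 1 y) :=
        ((SmoothPer.const I).mul ((hb 1).sub (he 1))).diff
      rw [pdv_sub hw₀s.diff hcs.diff, pdv_const, hw₀, pdv_add h0 h2,
        pdv_mul (SmoothPer.const I).diff h1, pdv_const, pdv_sub (hb 0).diff (he 0).diff,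
        pdv_sub (hb 1).diff (he 1).diff]
      ring
    have hq : ∀ k l, pdv k (b l) x =
        pdv k (fun x => (a l x : ℂ)) x - pdv k (fun x => (τ.conn l x : ℂ)) x := fun k l =>
      pdv_sub (contDiff_ofReal_comp (ha.smooth l)).differentiable_top
        (contDiff_ofReal_comp (τ.isConn_conn.smooth l)).differentiable_top k x
    have hl : pdv 0 (e 0) x + pdv 1 (e 1) x = pdv 0 (b 0) x + pdv 1 (b 1) x := by
      rw [← hlap x, Fin.sum_univ_two]
    have hc : pdv 0 (e 1) x = pdv 1 (e 0) x := pdv_comm hχ.smooth 0 1 x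
    rw [divCurl, hp, hp]
    linear_combination I * hq 0 1 - I * hq 1 0 - hl - I * hc -
      (pdv 1 (b 1) x - pdv 1 (e 1) x) * I_mul_I

/-- Every pair is matched by admissible periodic fields. -/
theorem exists_admissible {F₀ : ℝ × ℝ → ℝ}
    (hG : SmoothPer fun x => ((F₀ x - curv (τ.conn 0) (τ.conn 1) x : ℝ) : ℂ))
    {a : Fin 2 → ℝ × ℝ → ℝ} {f : ℝ × ℝ → ℂ} (ha : IsConn d a) (hf : QuasiPer d f) :
    ∃ v, GLData.Admissible 10 v ∧ (τ.data hα hβ hG).act v +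
      (∫ x in unitSquare, (F₀ x - curv (τ.conn 0) (τ.conn 1) x) ^ 2) =
        dblEnergy α β F₀ a f := by
  obtain ⟨w, g, hw, hg, hm, hn, hcov, hdc⟩ := τ.exists_gauge ha hf
  have hv := τ.smoothPer_ofSec hw hg
  refine ⟨τ.ofSec w g, ⟨hv, hm⟩, ?_⟩
  rw [τ.act_data_add hα hβ hG hv, dblEnergy]
  refine integral_congr_ae (Filter.Eventually.of_forall fun x => ?_)
  have h1 : ‖divCurl (τ.ofSec w g 0) x - I * (F₀ x - curv (τ.conn 0) (τ.conn 1) x : ℝ)‖ ^ 2 =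
      (curv (a 0) (a 1) x - F₀ x) ^ 2 := by
    have h : divCurl (τ.ofSec w g 0) x - I * (F₀ x - curv (τ.conn 0) (τ.conn 1) x : ℝ) =
        I * (curv (a 0) (a 1) x - F₀ x : ℝ) := by
      rw [ofSec, Fin.cons_zero, hdc]
      push_cast
      ring
    rw [h, norm_mul, norm_I, one_mul, Complex.norm_real, Real.norm_eq_abs, sq_abs]
  have h2 : ∑ i : Fin 2, ‖τ.ofSec w g i.succ x‖ ^ 2 = ‖f x‖ ^ 2 := by
    simp only [ofSec, Fin.cons_succ, sum_norm_conj_mul_sq, hn]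
  simp only [h1, h2, τ.pdv_add_low_ofSec hα hβ hG w hg, sum_norm_conj_mul_sq, hcov,
    toSec_ofSec, hn]
  ring

end Frame

/-- A minimizing pair. -/
theorem exists_dblEnergy_le (d : ℤ) {α β : ℝ} (hα : 0 < α) (hβ : 0 < β) {F₀ : ℝ × ℝ → ℝ}
    (hF : SmoothPer fun x => (F₀ x : ℂ)) :
    ∃ a f, IsConn d a ∧ QuasiPer d f ∧ ∀ a' f', IsConn d a' → QuasiPer d f' →
      dblEnergy α β F₀ a f ≤ dblEnergy α β F₀ a' f' := by
  obtain ⟨τ⟩ := nonempty_frame d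
  have hG : SmoothPer fun x => ((F₀ x - curv (τ.conn 0) (τ.conn 1) x : ℝ) : ℂ) := by
    simp only [Complex.ofReal_sub]
    exact hF.sub τ.isConn_conn.smoothPer_curv
  obtain ⟨v, hv, hmin⟩ := (τ.data hα hβ hG).exists_minimizer (by norm_num : (0 : ℝ) ≤ 10)
  refine ⟨τ.toConn v, τ.toSec v, τ.isConn_toConn hv.smooth, τ.quasiPer_toSec hv.smooth,
    fun a f ha hf => ?_⟩
  obtain ⟨w, hw, he⟩ := τ.exists_admissible hα hβ hG ha hf
  have h := τ.dblEnergy_le hα hβ hG (Complex.continuous_re.comp hF.cont) hv.smooth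
  linarith [hmin w hw]

theorem coord_ofReal_mul (k : Fin 2) (s : ℝ) (z : ℂ) : coord k (s * z) = s * coord k z := by
  fin_cases k <;> simp

theorem setIntegral_re {f : ℝ × ℝ → ℂ} (hf : Continuous f) :
    ∫ x in unitSquare, (f x).re = (∫ x in unitSquare, f x).re :=
  reCLM.integral_comp_comm (integrableOn_unitSquare hf)

theorem SmoothPer.eq_zero_of_setIntegral_le {f : ℝ × ℝ → ℂ} (hf : SmoothPer f)
    (h : ∫ x in unitSquare, ‖f x‖ ^ 2 ≤ 0) : f = 0 := by
  have h1 := hasSum_sq_norm_fc hf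
  have h2 : ∫ x in unitSquare, ‖f x‖ ^ 2 = 0 := le_antisymm h (by positivity)
  rw [h2, hasSum_zero_iff_of_nonneg fun k => by positivity] at h1
  refine eq_zero_of_fc_eq_zero hf fun k => ?_
  have := congrFun h1 k
  simpa using this

theorem norm_add_ofReal_mul_sq (z w : ℂ) (s : ℝ) :
    ‖z + s * w‖ ^ 2 = ‖z‖ ^ 2 + s * (2 * (z * (starRingEnd ℂ) w).re) + s ^ 2 * ‖w‖ ^ 2 := by
  simp only [← Complex.normSq_eq_norm_sq, Complex.normSq_apply]
  simp
  ring

section FirstVariation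

variable {d : ℤ} {α β : ℝ} {F₀ : ℝ × ℝ → ℝ} {a : Fin 2 → ℝ × ℝ → ℝ} {f ψ w : ℝ × ℝ → ℂ}

theorem cov_add_ofReal_mul (hf : Differentiable ℝ f) (hψ : Differentiable ℝ ψ) (s : ℝ) (k : Fin 2)
    (x : ℝ × ℝ) :
    cov (fun k x => a k x + coord k (s * w x)) k (fun x => f x + s * ψ x) x =
      cov a k f x + s * (cov a k ψ x + I * coord k (w x) * f x) +
        (s : ℂ) ^ 2 * (I * coord k (w x) * ψ x) := by
  have h1 : Differentiable ℝ fun x => (s : ℂ) * ψ x := hψ.const_mul _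
  rw [cov, cov, cov, pdv_add hf h1, pdv_mul (differentiable_const _) hψ, pdv_const,
    coord_ofReal_mul]
  push_cast
  ring

theorem hasQuartic_dblEnergy (ha : IsConn d a) (hf : QuasiPer d f) (hw : SmoothPer w)
    (hψ : QuasiPer d ψ) (hF : Continuous F₀) :
    HasQuartic (fun s x =>
      (curv (fun x => a 0 x + coord 0 (s * w x)) (fun x => a 1 x + coord 1 (s * w x)) x - F₀ x) ^ 2
        + ∑ k, ‖cov (fun k x => a k x + coord k (s * w x)) k (fun x => f x + s * ψ x) x‖ ^ 2 -
        α * ‖f x + s * ψ x‖ ^ 2 + β / 2 * ‖f x + s * ψ x‖ ^ 4)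
      (fun x => 2 * ((curv (a 0) (a 1) x - F₀ x) * (divCurl w x).im +
        ∑ k, (cov a k f x * (starRingEnd ℂ) (cov a k ψ x)).re +
        ∑ k, coord k (w x) * ((starRingEnd ℂ) (f x) * cov a k f x).im +
        (β * ‖f x‖ ^ 2 - α) * (f x * (starRingEnd ℂ) (ψ x)).re)) := by
  have h1 : Continuous (curv (a 0) (a 1)) := Complex.continuous_re.comp ha.smoothPer_curv.cont
  have h2 : ∀ k, Continuous (cov a k f) := fun k => (hf.cov ha k).cont
  have h3 : ∀ k, Continuous (cov a k ψ) := fun k => (hψ.cov ha k).cont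
  have h4 := hw.divCurl.cont
  have h5 := hf.cont
  have h6 := hψ.cont
  have h7 := hw.cont
  have hre := Complex.continuous_re
  have him := Complex.continuous_im
  have hconj := Complex.continuous_conj
  have hcoord := continuous_coord
  have t1 := HasQuartic.sq (a := fun x => curv (a 0) (a 1) x - F₀ x)
    (b := fun x => (divCurl w x).im) (e := fun _ => 0) (by fun_prop) (him.comp h4) (by fun_prop)
  have t2 := HasQuartic.sum Finset.univ fun k : Fin 2 => HasQuartic.normSq (X := cov a k f)
    (Y := fun x => cov a k ψ x + I * coord k (w x) * f x)
    (Z := fun x => I * coord k (w x) * ψ x) (h2 k)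
    (by have := h3 k; have := hcoord k; fun_prop) (by have := hcoord k; fun_prop)
  have t3 := (HasQuartic.normSq (X := f) (Y := ψ) (Z := fun _ => 0) h5 h6
    (by fun_prop)).const_mul (-α)
  have t4 := (HasQuartic.sq (a := fun x => ‖f x‖ ^ 2)
    (b := fun x => 2 * (f x * (starRingEnd ℂ) (ψ x)).re) (e := fun x => ‖ψ x‖ ^ 2) (by fun_prop)
    (by fun_prop) (by fun_prop)).const_mul (β / 2)
  refine (((t1.add t2).add t3).add t4).congr (fun s x => ?_) fun x => ?_
  · have hc := curv_add_coord ha ((SmoothPer.const (s : ℂ)).mul hw) x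
    have hdc : divCurl (fun x => (s : ℂ) * w x) x = s * divCurl w x := by
      rw [divCurl, divCurl, pdv_mul (differentiable_const _) hw.diff,
        pdv_mul (differentiable_const _) hw.diff, pdv_const, pdv_const]
      ring
    rw [hc, hdc, Complex.im_ofReal_mul, ← norm_add_ofReal_mul_sq]
    simp only [cov_add_ofReal_mul hf.diff hψ.diff, mul_zero, add_zero]
    ring
  · have hk : ∀ k, (cov a k f x * (starRingEnd ℂ) (cov a k ψ x + I * coord k (w x) * f x)).re =
        (cov a k f x * (starRingEnd ℂ) (cov a k ψ x)).re +
        coord k (w x) * ((starRingEnd ℂ) (f x) * cov a k f x).im := fun k => by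
      simp
      ring
    simp only [hk, Fin.sum_univ_two]
    ring

/-- The residual of the equation for the section. -/
def secResidual (α β : ℝ) (a : Fin 2 → ℝ × ℝ → ℝ) (f : ℝ × ℝ → ℂ) (x : ℝ × ℝ) : ℂ :=
  -∑ k, cov a k (cov a k f) x + ((β * ‖f x‖ ^ 2 - α : ℝ) : ℂ) * f x

/-- The residual of the equations for the connection. -/
def connResidual (F₀ : ℝ × ℝ → ℝ) (a : Fin 2 → ℝ × ℝ → ℝ) (f : ℝ × ℝ → ℂ) (x : ℝ × ℝ) : ℂ :=
  ((pd2 (fun y => curv (a 0) (a 1) y - F₀ y) x + ((starRingEnd ℂ) (f x) * cov a 0 f x).im : ℝ) : ℂ)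
    + I * ((-pd1 (fun y => curv (a 0) (a 1) y - F₀ y) x +
      ((starRingEnd ℂ) (f x) * cov a 1 f x).im : ℝ) : ℂ)

theorem SmoothPer.ofReal_sq_norm (hf : QuasiPer d f) :
    SmoothPer fun x => ((‖f x‖ ^ 2 : ℝ) : ℂ) := by
  have h := hf.conj_mul hf
  simpa only [← Complex.normSq_eq_conj_mul_self, Complex.normSq_eq_norm_sq] using h

theorem quasiPer_secResidual (ha : IsConn d a) (hf : QuasiPer d f) :
    QuasiPer d (secResidual α β a f) := by
  have h1 : SmoothPer fun x => ((β * ‖f x‖ ^ 2 - α : ℝ) : ℂ) := by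
    simpa only [Complex.ofReal_sub, Complex.ofReal_mul] using
      ((SmoothPer.const (β : ℂ)).mul (SmoothPer.ofReal_sq_norm hf)).sub (SmoothPer.const (α : ℂ))
  have h2 := (((hf.cov ha 0).cov ha 0).add ((hf.cov ha 1).cov ha 1)).const_mul (-1)
  have h3 := h2.add (QuasiPer.smul h1 hf)
  unfold secResidual
  simpa only [Fin.sum_univ_two, neg_one_mul] using h3

theorem SmoothPer.ofReal_im (hf : SmoothPer f) : SmoothPer fun x => ((f x).im : ℂ) :=
  ⟨contDiff_ofReal_comp (imCLM.contDiff.comp hf.smooth), fun x => by rw [hf.per1],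
    fun x => by rw [hf.per2]⟩

theorem smoothPer_connResidual (ha : IsConn d a) (hf : QuasiPer d f)
    (hF : SmoothPer fun x => (F₀ x : ℂ)) : SmoothPer (connResidual F₀ a f) := by
  have hh : SmoothPer fun x => ((curv (a 0) (a 1) x - F₀ x : ℝ) : ℂ) := by
    simpa only [Complex.ofReal_sub] using ha.smoothPer_curv.sub hF
  have hd : Differentiable ℝ fun x => curv (a 0) (a 1) x - F₀ x :=
    reCLM.differentiable.comp hh.diff
  have hj : ∀ k, SmoothPer fun x => (((starRingEnd ℂ) (f x) * cov a k f x).im : ℂ) := fun k =>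
    (hf.conj_mul (hf.cov ha k)).ofReal_im
  have h := (hh.pd2.add (hj 0)).add ((SmoothPer.const I).mul (hh.pd1.neg.add (hj 1)))
  simp only [pd1_ofReal hd, pd2_ofReal hd, ← Complex.ofReal_neg, ← Complex.ofReal_add] at h
  exact h

theorem setIntegral_residual_eq_zero (ha : IsConn d a) (hf : QuasiPer d f)
    (hF : SmoothPer fun x => (F₀ x : ℂ)) (hw : SmoothPer w) (hψ : QuasiPer d ψ)
    (hmin : ∀ a' f', IsConn d a' → QuasiPer d f' →
      dblEnergy α β F₀ a f ≤ dblEnergy α β F₀ a' f') :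
    ∫ x in unitSquare, ((connResidual F₀ a f x * (starRingEnd ℂ) (w x)).re +
      (secResidual α β a f x * (starRingEnd ℂ) (ψ x)).re) = 0 := by
  have hFc : Continuous F₀ := Complex.continuous_re.comp hF.cont
  have hq := hasQuartic_dblEnergy (α := α) (β := β) ha hf hw hψ hFc
  have h := hq.setIntegral_eq_zero
    fun s => by
      have := hmin _ _ (ha.add_coord ((SmoothPer.const (s : ℂ)).mul hw)) (hf.add (hψ.const_mul s))
      have hz : ∀ k, coord k 0 = 0 := fun k => by fin_cases k <;> simp
      simpa only [dblEnergy, Complex.ofReal_zero, zero_mul, hz, add_zero] using this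
  have hh : SmoothPer fun x => ((curv (a 0) (a 1) x - F₀ x : ℝ) : ℂ) := by
    simpa only [Complex.ofReal_sub] using ha.smoothPer_curv.sub hF
  have hhd : Differentiable ℝ fun x => curv (a 0) (a 1) x - F₀ x :=
    reCLM.differentiable.comp hh.diff
  set H : ℝ × ℝ → ℝ := fun x => curv (a 0) (a 1) x - F₀ x with hH
  have i1 := congrArg Complex.im (setIntegral_mul_divCurl hh hw)
  have i2 : ∀ k, (∫ x in unitSquare, ((starRingEnd ℂ) (cov a k ψ x) * cov a k f x +
      (starRingEnd ℂ) (ψ x) * cov a k (cov a k f) x)) = 0 := fun k => by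
    have := setIntegral_pdv_eq_zero (hψ.conj_mul (hf.cov ha k)) k
    simpa only [pdv_conj_mul_eq hψ (hf.cov ha k) a k] using this
  have c1 := hh.cont
  have c2 := hw.divCurl.cont
  have c3 := hw.cont
  have c4 := hh.divCurl.cont
  have c5 : Continuous H := hhd.continuous
  obtain ⟨C, hC, c6, hC0⟩ : ∃ C : ℝ × ℝ → ℝ, (∀ x, C x = 2 * (H x * (divCurl w x).im +
        ∑ k, (cov a k f x * (starRingEnd ℂ) (cov a k ψ x)).re +
        ∑ k, coord k (w x) * ((starRingEnd ℂ) (f x) * cov a k f x).im +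
        (β * ‖f x‖ ^ 2 - α) * (f x * (starRingEnd ℂ) (ψ x)).re)) ∧
      Continuous C ∧ ∫ x in unitSquare, C x = 0 := ⟨_, fun _ => rfl, hq.1, h⟩
  have c7 : ∀ k, Continuous fun x => (starRingEnd ℂ) (cov a k ψ x) * cov a k f x +
      (starRingEnd ℂ) (ψ x) * cov a k (cov a k f) x := fun k => by
    have := ((hψ.conj_mul (hf.cov ha k)).pdv k).cont
    rwa [funext (pdv_conj_mul_eq hψ (hf.cov ha k) a k)] at this
  have c8 : ∀ k, Continuous fun x => ((starRingEnd ℂ) (cov a k ψ x) * cov a k f x +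
      (starRingEnd ℂ) (ψ x) * cov a k (cov a k f) x).re := fun k =>
    Complex.continuous_re.comp (c7 k)
  have him := Complex.continuous_im
  have e : ∀ x, (connResidual F₀ a f x * (starRingEnd ℂ) (w x)).re +
      (secResidual α β a f x * (starRingEnd ℂ) (ψ x)).re = 1 / 2 * C x -
      (((H x : ℂ) * divCurl w x).im + (divCurl (fun x => (H x : ℂ)) x * w x).im) -
      ∑ k, ((starRingEnd ℂ) (cov a k ψ x) * cov a k f x +
        (starRingEnd ℂ) (ψ x) * cov a k (cov a k f) x).re := fun x => by
    have e1 : divCurl (fun x => (H x : ℂ)) x = pd1 H x - I * pd2 H x := by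
      rw [divCurl, pdv_zero, pdv_one, pd1_ofReal hhd, pd2_ofReal hhd]
    rw [e1, connResidual, secResidual, ← hH, hC]
    simp only [Fin.sum_univ_two, coord_zero, coord_one]
    generalize β * ‖f x‖ ^ 2 - α = m
    simp
    ring
  simp only [e]
  clear hC e
  generalize divCurl (fun x => (H x : ℂ)) = g at *
  generalize divCurl w = g' at *
  rw [Complex.neg_im, ← setIntegral_im (by fun_prop), ← setIntegral_im (by fun_prop)] at i1
  have c9 : Continuous fun x => ((H x : ℂ) * g' x).im + (g x * w x).im := by fun_prop
  have c10 : Continuous fun x => 1 / 2 * C x := by fun_prop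
  have c11 : Continuous fun x => 1 / 2 * C x - (((H x : ℂ) * g' x).im + (g x * w x).im) :=
    c10.sub c9
  rw [integral_sub (integrableOn_unitSquare c11)
      (integrableOn_unitSquare (continuous_finsetSum _ fun k _ => c8 k)),
    integral_sub (integrableOn_unitSquare c10) (integrableOn_unitSquare c9),
    integral_const_mul, hC0, integral_add (integrableOn_unitSquare (by fun_prop))
      (integrableOn_unitSquare (by fun_prop)), i1,
    integral_finsetSum _ fun k _ => integrableOn_unitSquare (c8 k), Fin.sum_univ_two,
    setIntegral_re (c7 0), setIntegral_re (c7 1), i2, i2]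
  simp

end FirstVariation

theorem QuasiPer.eq_zero_of_setIntegral_le {d : ℤ} {f : ℝ × ℝ → ℂ} (hf : QuasiPer d f)
    (h : ∫ x in unitSquare, ‖f x‖ ^ 2 ≤ 0) : f = 0 := by
  obtain ⟨τ⟩ := nonempty_frame d
  have hc := hf.cont
  have hz : ∀ i x, (starRingEnd ℂ) (τ.t i x) * f x = 0 := fun i => by
    have hs := (τ.quasiPer i).conj_mul hf
    have ht := hs.cont
    refine congrFun (hs.eq_zero_of_setIntegral_le (le_trans (setIntegral_mono
      (integrableOn_unitSquare (by fun_prop)) (integrableOn_unitSquare (by fun_prop))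
      fun x => ?_) h))
    rw [← τ.sum_norm_conj_mul_sq x (f x)]
    exact Finset.single_le_sum (f := fun i => ‖(starRingEnd ℂ) (τ.t i x) * f x‖ ^ 2)
      (fun _ _ => by positivity) (Finset.mem_univ i)
  funext x
  have := τ.sum_norm_conj_mul_sq x (f x)
  simpa [hz] using this.symm

/-- Minimizers of the energy have vanishing residuals. -/
theorem residual_eq_zero {d : ℤ} {α β : ℝ} {F₀ : ℝ × ℝ → ℝ} {a : Fin 2 → ℝ × ℝ → ℝ}
    {f : ℝ × ℝ → ℂ} (ha : IsConn d a) (hf : QuasiPer d f) (hF : SmoothPer fun x => (F₀ x : ℂ))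
    (hmin : ∀ a' f', IsConn d a' → QuasiPer d f' →
      dblEnergy α β F₀ a f ≤ dblEnergy α β F₀ a' f') :
    connResidual F₀ a f = 0 ∧ secResidual α β a f = 0 := by
  have hR := smoothPer_connResidual ha hf hF
  have hρ := quasiPer_secResidual (α := α) (β := β) ha hf
  have hRc := hR.cont
  have hρc := hρ.cont
  have h := setIntegral_residual_eq_zero ha hf hF hR hρ hmin
  have hsq : ∀ z : ℂ, (z * (starRingEnd ℂ) z).re = ‖z‖ ^ 2 := fun z => by
    rw [Complex.mul_conj, Complex.ofReal_re, Complex.normSq_eq_norm_sq]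
  simp only [hsq] at h
  rw [integral_add (integrableOn_unitSquare (by fun_prop))
    (integrableOn_unitSquare (by fun_prop))] at h
  have h1 : 0 ≤ ∫ x in unitSquare, ‖connResidual F₀ a f x‖ ^ 2 := by positivity
  have h2 : 0 ≤ ∫ x in unitSquare, ‖secResidual α β a f x‖ ^ 2 := by positivity
  exact ⟨hR.eq_zero_of_setIntegral_le (by linarith), hρ.eq_zero_of_setIntegral_le (by linarith)⟩

theorem isGLSolution_ofConn {d : ℤ} {α β : ℝ} {F₀ : ℝ × ℝ → ℝ} {a : Fin 2 → ℝ × ℝ → ℝ}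
    {f : ℝ × ℝ → ℂ} (ha : IsConn d a) (hf : QuasiPer d f) (hR : connResidual F₀ a f = 0)
    (hρ : secResidual α β a f = 0) : IsGLSolution α β F₀ (FieldPair.ofConn ha hf) := by
  refine ⟨fun x => ?_, fun x => ?_, fun x => ?_⟩
  · have := congrArg Complex.re (congrFun hR x)
    simp only [connResidual, Complex.add_re, Complex.ofReal_re, Complex.I_mul_re,
      Complex.ofReal_im, neg_zero, add_zero] at this
    exact this
  · have := congrArg Complex.im (congrFun hR x)
    simp only [connResidual, Complex.add_im, Complex.ofReal_im, Complex.I_mul_im,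
      Complex.ofReal_re, zero_add] at this
    exact this
  · have := congrFun hρ x
    simp only [secResidual, Fin.sum_univ_two, Pi.zero_apply] at this
    push_cast at this
    change -(cov a 0 (cov a 0 f) x + cov a 1 (cov a 1 f) x) =
      (α : ℂ) * f x - (β : ℂ) * (‖f x‖ : ℂ) ^ 2 * f x
    linear_combination this

theorem ExternalField.smoothPer {d : ℤ} {F₀ : ℝ × ℝ → ℝ} (h : ExternalField d F₀) :
    SmoothPer fun x => (F₀ x : ℂ) :=
  ⟨contDiff_ofReal_comp h.1, fun x => by rw [h.2.1], fun x => by rw [h.2.2.1]⟩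

/-- the infimum of the energy over degree-`d` field pairs is finite
and is attained by a GL solution. -/
theorem statement1 (α β : ℝ) (hα : 0 < α) (hβ : 0 < β) (d : ℤ) (F₀ : ℝ × ℝ → ℝ)
    (hF₀ : ExternalField d F₀) :
    (energySet α β F₀ d).Nonempty ∧ BddBelow (energySet α β F₀ d) ∧
    ∃ P : FieldPair d, IsGLSolution α β F₀ P ∧
      energy α β F₀ P = sInf (energySet α β F₀ d) := by
  obtain ⟨a, f, ha, hf, hmin⟩ := exists_dblEnergy_le d hα hβ hF₀.smoothPer
  have hleast : IsLeast (energySet α β F₀ d) (energy α β F₀ (FieldPair.ofConn ha hf)) := by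
    refine ⟨⟨_, rfl⟩, ?_⟩
    rintro _ ⟨Q, rfl⟩
    rw [FieldPair.energy_ofConn, FieldPair.energy_eq]
    have := hmin _ _ Q.isConn Q.quasiPer
    linarith
  obtain ⟨hR, hρ⟩ := residual_eq_zero ha hf hF₀.smoothPer hmin
  exact ⟨⟨_, hleast.1⟩, ⟨_, hleast.2⟩, _, isGLSolution_ofConn ha hf hR hρ,
    hleast.csInf_eq.symm⟩
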